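/- Fix N ≥ 1, d ∈ ℕ^{N+1}, and a real d_N × d_0 matrix B whose rank r = rank(B) satisfies r ≤ min_{0 ≤ i ≤ N} d_i. Let X = Π_{i=1}^N Mat_{d_i × d_{i−1}}(ℝ) and define K : X → ℝ by K(A_1,…,A_N) = ‖A_N A_{N−1} ⋯ A_1 − B‖², the squared Frobenius norm (sum of squares of entries). Then sup{ s ∈ ℝ : the function A ↦ K(A)^{−s} is locally integrable on X } = (1/2)·( min_{μ ∈ M^r_d} c(μ) + r·(d_0 + d_N − r) ). (The real log-canonical threshold of the deep linear network loss K equals half the codimension of mult^{−1}(B).) -/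

import Mathlib

/-- The iterated product `A_n ⋯ A_2 A_1` of a tuple of composable matrices. -/
def matProd (k : Type) [Field k] (d : ℕ → ℕ)
    (A : ∀ i : ℕ, Matrix (Fin (d (i + 1))) (Fin (d i)) k) :
    ∀ n : ℕ, Matrix (Fin (d n)) (Fin (d 0)) k
  | 0 => (1 : Matrix (Fin (d 0)) (Fin (d 0)) k)
  | n + 1 => A n * matProd k d A n

/-- `m` is a Kostant partition of the dimension vector `d` for the equioriented
type-A quiver with vertices `0, …, N`. -/
def IsKostant (N : ℕ) (d : ℕ → ℕ) (m : ℕ → ℕ → ℕ) : Prop :=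
  (∀ i j : ℕ, ¬(i ≤ j ∧ j ≤ N) → m i j = 0) ∧
  ∀ k ≤ N, d k = ∑ i ∈ Finset.range (k + 1), ∑ j ∈ Finset.Icc k N, m i j

/-- `c(m) = Σ_{1 ≤ i ≤ u ≤ j ≤ v ≤ N} m_{i−1,j−1} · m_{u,v}`. -/
def kpCodim (N : ℕ) (m : ℕ → ℕ → ℕ) : ℕ :=
  ∑ i ∈ Finset.Icc 1 N, ∑ u ∈ Finset.Icc i N, ∑ j ∈ Finset.Icc u N,
    ∑ v ∈ Finset.Icc j N, m (i - 1) (j - 1) * m u v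

/-- `C = min_{m ∈ M^r_d} c(m)`. -/
noncomputable def KPmin (N : ℕ) (d : ℕ → ℕ) (r : ℕ) : ℕ :=
  sInf {n : ℕ | ∃ m : ℕ → ℕ → ℕ, IsKostant N d m ∧ m 0 N = r ∧ kpCodim N m = n}

/-- The mean square error loss of the deep linear network with weights
`x = (A_1, …, A_N)` and true matrix `B`: the squared Frobenius norm
`‖A_N ⋯ A_1 − B‖²`. -/
noncomputable def DLNloss (N : ℕ) (d : ℕ → ℕ) (B : Matrix (Fin (d N)) (Fin (d 0)) ℝ)
    (x : ∀ i : Fin N, Fin (d ((i : ℕ) + 1)) → Fin (d (i : ℕ)) → ℝ) : ℝ :=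
  ∑ a, ∑ b,
    (matProd ℝ d (fun i => if h : i < N then Matrix.of (x ⟨i, h⟩) else 0) N a b - B a b) ^ 2

/-- The cost of a decreasing path of ranks `p` below the dimension vector `d`. -/
def pathCost (N : ℕ) (d p : ℕ → ℕ) : ℕ :=
  ∑ k ∈ Finset.range N, (p k - p (k + 1)) * (d (k + 1) - p (k + 1))

/-- A rank path: it starts at `d 0`, decreases, and stays below `d`. -/
structure IsRankPath (N : ℕ) (d p : ℕ → ℕ) : Prop where
  zero : p 0 = d 0
  anti : ∀ k < N, p (k + 1) ≤ p k
  le : ∀ k ≤ N, p k ≤ d k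

lemma kpCodim_eq (N : ℕ) (m : ℕ → ℕ → ℕ) :
    kpCodim N m = ∑ i ∈ Finset.Icc 1 N, ∑ j ∈ Finset.Icc i N,
      m (i - 1) (j - 1) * ∑ u ∈ Finset.Icc i j, ∑ v ∈ Finset.Icc j N, m u v := by
  unfold kpCodim
  refine Finset.sum_congr rfl fun i _ => ?_
  rw [Finset.sum_comm' (s' := fun j => Finset.Icc i j) (t' := Finset.Icc i N)]
  · simp only [Finset.mul_sum]
  · intro x y
    simp only [Finset.mem_Icc]
    omega

lemma sum_Icc_succ_shift (a b : ℕ) (f : ℕ → ℕ) :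
    ∑ i ∈ Finset.Icc (a + 1) (b + 1), f i = ∑ i ∈ Finset.Icc a b, f (i + 1) := by
  rw [← Finset.map_add_right_Icc a b 1, Finset.sum_map]
  rfl

lemma kpCodim_succ (N : ℕ) (m : ℕ → ℕ → ℕ) :
    kpCodim (N + 1) m = (∑ j ∈ Finset.Icc 0 N,
        m 0 j * ∑ u ∈ Finset.Icc 0 j, ∑ v ∈ Finset.Icc j N, m (u + 1) (v + 1))
      + kpCodim N (fun i j => m (i + 1) (j + 1)) := by
  rw [kpCodim_eq, kpCodim_eq]
  have h0 := sum_Icc_succ_shift 0 N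
  rw [zero_add] at h0
  rw [h0]
  rw [← Finset.add_sum_Ioc_eq_sum_Icc (Nat.zero_le N)]
  congr 1
  · simp only [zero_add, Nat.sub_self]
    rw [h0]
    refine Finset.sum_congr rfl fun j _ => ?_
    rw [Nat.add_sub_cancel, show (1 : ℕ) = 0 + 1 from rfl, sum_Icc_succ_shift]
    simp only [sum_Icc_succ_shift]
  · refine Finset.sum_congr (by ext; simp [Nat.succ_le_iff]) fun i hi => ?_
    rw [sum_Icc_succ_shift]
    refine Finset.sum_congr rfl fun j hj => ?_
    simp only [Finset.mem_Icc] at hi hj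
    rw [sum_Icc_succ_shift]
    simp only [sum_Icc_succ_shift]
    congr 2 <;> omega

lemma IsKostant.exists_path {N : ℕ} {d : ℕ → ℕ} {m : ℕ → ℕ → ℕ} (hm : IsKostant N d m) :
    ∃ p, IsRankPath N d p ∧ p N = m 0 N ∧ pathCost N d p ≤ kpCodim N m := by
  have hd : ∀ k ≤ N, d k = (∑ j ∈ Finset.Icc k N, m 0 j) +
      ∑ u ∈ Finset.Icc 1 k, ∑ j ∈ Finset.Icc k N, m u j := by
    intro k hk
    rw [hm.2 k hk, Finset.sum_range_succ']
    rw [add_comm]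
    congr 1
    rw [Finset.range_eq_Ico, Finset.sum_Ico_add' (fun u => ∑ j ∈ Finset.Icc k N, m u j) 0 k 1]
    rfl
  have hstep : ∀ k < N, ∑ j ∈ Finset.Icc k N, m 0 j = m 0 k + ∑ j ∈ Finset.Icc (k + 1) N, m 0 j := by
    intro k hk
    rw [← Finset.add_sum_Ioc_eq_sum_Icc hk.le, ← Finset.Icc_succ_left_eq_Ioc]
    rfl
  refine ⟨fun k => ∑ j ∈ Finset.Icc k N, m 0 j, ⟨?_, ?_, ?_⟩, by simp, ?_⟩
  · rw [hd 0 (Nat.zero_le N)]; simp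
  · intro k hk
    simp only [hstep k hk]
    omega
  · intro k hk
    simp only [hd k hk]
    omega
  · rcases N with _ | N
    · simp [pathCost]
    · rw [kpCodim_succ]
      refine le_trans (le_of_eq ?_) (Nat.le_add_right _ _)
      unfold pathCost
      rw [Nat.range_succ_eq_Icc_zero]
      refine Finset.sum_congr rfl fun k hk => ?_
      simp only [Finset.mem_Icc] at hk
      simp only [hstep k (by omega)]
      rw [hd (k + 1) (by omega), Nat.add_sub_cancel, Nat.add_sub_cancel_left]
      congr 1
      have := sum_Icc_succ_shift 0 k
      simp only [zero_add] at this
      rw [this]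
      simp only [sum_Icc_succ_shift]

lemma IsRankPath.exists_kostant_of {N : ℕ} {d p : ℕ → ℕ} (hp : IsRankPath (N + 1) d p)
    {m' : ℕ → ℕ → ℕ} (hm' : IsKostant N (fun k => d (k + 1) - p (k + 1)) m')
    (h0 : kpCodim N m' = 0) :
    ∃ m, IsKostant (N + 1) d m ∧ m 0 (N + 1) = p (N + 1) ∧
      kpCodim (N + 1) m = pathCost (N + 1) d p := by
  let m : ℕ → ℕ → ℕ := fun i j => match i, j with
    | 0, j => if j ≤ N then p j - p (j + 1) else if j = N + 1 then p j else 0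
    | _ + 1, 0 => 0
    | i + 1, j + 1 => m' i j
  have hms : ∀ i j, m (i + 1) (j + 1) = m' i j := fun i j => rfl
  have hm0 : ∀ k ≤ N, m 0 k = p k - p (k + 1) := fun k hk => by
    change (if k ≤ N then p k - p (k + 1) else if k = N + 1 then p k else 0) = _
    rw [if_pos hk]
  have hmN : m 0 (N + 1) = p (N + 1) := by
    change (if N + 1 ≤ N then p (N + 1) - p (N + 1 + 1) else
      if N + 1 = N + 1 then p (N + 1) else 0) = _
    simp
  have hsum : ∀ k ≤ N + 1, ∑ j ∈ Finset.Icc k (N + 1), m 0 j = p k := by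
    intro k hk
    refine Nat.decreasingInduction (motive := fun k _ =>
      ∑ j ∈ Finset.Icc k (N + 1), m 0 j = p k) (fun k hk ih => ?_) (by simp [hmN]) hk
    · rw [← Finset.add_sum_Ioc_eq_sum_Icc hk.le, ← Finset.Icc_succ_left_eq_Ioc]
      change m 0 k + ∑ j ∈ Finset.Icc (k + 1) (N + 1), m 0 j = _
      rw [ih, hm0 k (by omega)]
      have := hp.anti k hk
      omega
  refine ⟨m, ⟨?_, ?_⟩, hmN, ?_⟩
  · rintro (_ | i) (_ | j) h
    · omega
    · change (if j + 1 ≤ N then p (j + 1) - p (j + 1 + 1) else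
        if j + 1 = N + 1 then p (j + 1) else 0) = 0
      rw [if_neg (by omega), if_neg (by omega)]
    · rfl
    · rw [hms]
      exact hm'.1 i j (by omega)
  · intro k hk
    rw [Finset.sum_range_succ', hsum k hk]
    rcases k with _ | k
    · simp [hp.zero]
    · simp only [sum_Icc_succ_shift, hms]
      rw [← hm'.2 k (by omega)]
      have := hp.le (k + 1) hk
      dsimp only
      omega
  · rw [kpCodim_succ]
    simp only [hms]
    rw [h0, add_zero]
    unfold pathCost
    rw [Nat.range_succ_eq_Icc_zero]
    refine Finset.sum_congr rfl fun k hk => ?_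
    simp only [Finset.mem_Icc] at hk
    rw [hm0 k hk.2, ← Nat.range_succ_eq_Icc_zero, ← hm'.2 k hk.2]

/-- The generic Kostant partition has codimension zero. -/
lemma exists_kostant_kpCodim_zero (N : ℕ) (d : ℕ → ℕ) :
    ∃ m, IsKostant N d m ∧ kpCodim N m = 0 := by
  induction N generalizing d with
  | zero =>
    refine ⟨fun i j => if i = 0 ∧ j = 0 then d 0 else 0, ⟨?_, ?_⟩, by simp [kpCodim]⟩
    · intro i j h
      simp only [ite_eq_right_iff]
      omega
    · intro k hk
      obtain rfl : k = 0 := by omega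
      simp
  | succ N ih =>
    let p : ℕ → ℕ := fun k => Nat.rec (d 0) (fun k x => min x (d (k + 1))) k
    have hps : ∀ k, p (k + 1) = min (p k) (d (k + 1)) := fun k => rfl
    have hp : IsRankPath (N + 1) d p := by
      refine ⟨rfl, fun k _ => by rw [hps]; exact min_le_left _ _, ?_⟩
      rintro (_ | k) _
      · exact le_rfl
      · rw [hps]; exact min_le_right _ _
    obtain ⟨m', h1, h2⟩ := ih (fun k => d (k + 1) - p (k + 1))
    obtain ⟨m, h3, _, h5⟩ := hp.exists_kostant_of h1 h2
    refine ⟨m, h3, ?_⟩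
    rw [h5]
    refine Finset.sum_eq_zero fun k _ => ?_
    rw [hps, mul_eq_zero]
    omega

lemma IsRankPath.KPmin_le {N : ℕ} {d p : ℕ → ℕ} (hN : 1 ≤ N) (hp : IsRankPath N d p) :
    KPmin N d (p N) ≤ pathCost N d p := by
  obtain ⟨N, rfl⟩ : ∃ k, N = k + 1 := ⟨N - 1, by omega⟩
  obtain ⟨m', h1, h2⟩ := exists_kostant_kpCodim_zero N (fun k => d (k + 1) - p (k + 1))
  obtain ⟨m, h3, h4, h5⟩ := hp.exists_kostant_of h1 h2
  exact Nat.sInf_le ⟨m, h3, h4, h5⟩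

/-- A path ending below `r` costs at least the minimum over paths ending at `r`. -/
lemma IsRankPath.KPmin_le_of_le {N : ℕ} {d p : ℕ → ℕ} {r : ℕ} (hN : 1 ≤ N)
    (hr : ∀ i ≤ N, r ≤ d i) (hp : IsRankPath N d p) (hpr : p N ≤ r) :
    KPmin N d r ≤ pathCost N d p := by
  have hq : IsRankPath N d (fun k => max (p k) r) := by
    refine ⟨?_, fun k hk => ?_, fun k hk => max_le (hp.le k hk) (hr k hk)⟩
    · simp [hp.zero, hr 0 (Nat.zero_le N)]
    · exact max_le_max_right r (hp.anti k hk)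
  have h := hq.KPmin_le hN
  simp only [max_eq_right hpr] at h
  refine h.trans (Finset.sum_le_sum fun k hk => ?_)
  have := hp.anti k (Finset.mem_range.1 hk)
  exact Nat.mul_le_mul (by dsimp only; omega) (by dsimp only; omega)

lemma exists_path_pathCost_eq_KPmin {N : ℕ} {d : ℕ → ℕ} {r : ℕ} (hN : 1 ≤ N)
    (hr : ∀ i ≤ N, r ≤ d i) :
    ∃ p, IsRankPath N d p ∧ p N = r ∧ pathCost N d p = KPmin N d r := by
  have hne : {n : ℕ | ∃ m : ℕ → ℕ → ℕ, IsKostant N d m ∧ m 0 N = r ∧ kpCodim N m = n}.Nonempty := by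
    have hp : IsRankPath N d (fun k => if k = 0 then d 0 else r) := by
      refine ⟨by simp, fun k _ => ?_, fun k hk => ?_⟩
      · have := hr 0 (Nat.zero_le N)
        rcases Nat.eq_zero_or_pos k with rfl | hk0
        · simpa using this
        · simp [hk0.ne']
      · have := hr k hk
        split_ifs with h
        · rw [h]
        · exact this
    obtain ⟨N, rfl⟩ : ∃ k, N = k + 1 := ⟨N - 1, by omega⟩
    obtain ⟨m', h1, h2⟩ := exists_kostant_kpCodim_zero N
      (fun k => d (k + 1) - (fun k => if k = 0 then d 0 else r) (k + 1))
    obtain ⟨m, h3, h4, h5⟩ := hp.exists_kostant_of h1 h2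
    exact ⟨_, m, h3, by simpa using h4, rfl⟩
  obtain ⟨m, h1, h2, h3⟩ := Nat.sInf_mem hne
  obtain ⟨p, hp, hpN, hc⟩ := h1.exists_path
  refine ⟨p, hp, hpN.trans h2, le_antisymm (hc.trans h3.le) ?_⟩
  rw [← h2, ← hpN]
  exact hp.KPmin_le hN

open Matrix MeasureTheory in
/-- `g` is invertible, and the entries of `g` and of its inverse are bounded by `K`. -/
def IsBddInv {m : ℕ} (K : ℝ) (g : Matrix (Fin m) (Fin m) ℝ) : Prop :=
  ∃ g' : Matrix (Fin m) (Fin m) ℝ, g * g' = 1 ∧ g' * g = 1 ∧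
    (∀ i j, |g i j| ≤ K) ∧ ∀ i j, |g' i j| ≤ K

lemma Matrix.abs_mul_apply_le {a b c : Type*} [Fintype b] {K L : ℝ} {g : Matrix a b ℝ}
    {h : Matrix b c ℝ} (hg : ∀ i j, |g i j| ≤ K) (hh : ∀ i j, |h i j| ≤ L) (hK : 0 ≤ K) (i : a)
    (j : c) : |(g * h) i j| ≤ Fintype.card b * (K * L) := by
  rw [Matrix.mul_apply]
  refine (Finset.abs_sum_le_sum_abs _ _).trans ?_
  refine (Finset.sum_le_sum (g := fun _ => K * L) fun k _ => ?_).trans (by simp)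
  rw [abs_mul]
  exact mul_le_mul (hg i k) (hh k j) (abs_nonneg _) hK

lemma IsBddInv.mul {m : ℕ} {K L : ℝ} {g h : Matrix (Fin m) (Fin m) ℝ} (hK : 0 ≤ K) (hL : 0 ≤ L)
    (hg : IsBddInv K g) (hh : IsBddInv L h) : IsBddInv (m * (K * L)) (g * h) := by
  obtain ⟨g', h1, h2, h3, h4⟩ := hg
  obtain ⟨h', k1, k2, k3, k4⟩ := hh
  refine ⟨h' * g', ?_, ?_, fun i j => ?_, fun i j => ?_⟩
  · rw [Matrix.mul_assoc, ← Matrix.mul_assoc h, k1, Matrix.one_mul, h1]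
  · rw [Matrix.mul_assoc, ← Matrix.mul_assoc g', h2, Matrix.one_mul, k2]
  · simpa using Matrix.abs_mul_apply_le h3 k3 hK i j
  · simpa [mul_comm K L] using Matrix.abs_mul_apply_le k4 h4 hL i j

lemma IsBddInv.mono {m : ℕ} {K L : ℝ} {g : Matrix (Fin m) (Fin m) ℝ} (hKL : K ≤ L)
    (hg : IsBddInv K g) : IsBddInv L g := by
  obtain ⟨g', h1, h2, h3, h4⟩ := hg
  exact ⟨g', h1, h2, fun i j => (h3 i j).trans hKL, fun i j => (h4 i j).trans hKL⟩

lemma Matrix.abs_one_apply_le {m : ℕ} (i j : Fin m) : |(1 : Matrix (Fin m) (Fin m) ℝ) i j| ≤ 1 := by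
  rw [Matrix.one_apply]
  split_ifs <;> simp

lemma IsBddInv.one {m : ℕ} : IsBddInv 1 (1 : Matrix (Fin m) (Fin m) ℝ) :=
  ⟨1, by simp, by simp, Matrix.abs_one_apply_le, Matrix.abs_one_apply_le⟩

lemma isBddInv_one_add_vecMulVec {m : ℕ} {c : Fin m → ℝ} {j : Fin m} (hc : c j = 0)
    (hc1 : ∀ i, |c i| ≤ 1) : IsBddInv 2 (1 + Matrix.vecMulVec c (Pi.single j 1)) := by
  have h0 : Matrix.vecMulVec c (Pi.single j 1) * Matrix.vecMulVec c (Pi.single j 1) = 0 := by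
    rw [Matrix.vecMulVec_mul_vecMulVec]
    simp [hc]
  have hb : ∀ a b, |Matrix.vecMulVec c (Pi.single j 1) a b| ≤ 1 := by
    intro a b
    rw [Matrix.vecMulVec_apply, abs_mul]
    refine mul_le_one₀ (hc1 a) (abs_nonneg _) ?_
    rw [Pi.single_apply]
    split_ifs <;> simp
  refine ⟨1 - Matrix.vecMulVec c (Pi.single j 1), ?_, ?_, fun a b => ?_, fun a b => ?_⟩
  · rw [add_mul, mul_sub, mul_sub, h0]; simp
  · rw [sub_mul, mul_add, mul_add, h0]; simp
  · have := (abs_add_le _ _).trans (add_le_add (Matrix.abs_one_apply_le a b) (hb a b))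
    rw [Matrix.add_apply]
    linarith
  · have := (abs_sub _ _).trans (add_le_add (Matrix.abs_one_apply_le a b) (hb a b))
    rw [Matrix.sub_apply]
    linarith

open MeasureTheory in
lemma volume_setOf_lt_exp_neg_le {a b : ℝ} (ha : 0 < a) (hb : 0 < b) :
    volume {v : ℝ | a < Real.exp (-v) ∧ Real.exp (-v) ≤ b} = ENNReal.ofReal (Real.log (b / a)) := by
  have : {v : ℝ | a < Real.exp (-v) ∧ Real.exp (-v) ≤ b} = Set.Ico (-Real.log b) (-Real.log a) := by
    ext v
    simp only [Set.mem_ofPred_eq, Set.mem_Ico]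
    rw [← Real.log_lt_iff_lt_exp ha, ← Real.le_log_iff_exp_le hb]
    constructor <;> rintro ⟨h1, h2⟩ <;> constructor <;> linarith
  rw [this, Real.volume_Ico, Real.log_div hb.ne' ha.ne']
  congr 1
  ring

lemma measurableSet_lt_exp_neg_le (a b : ℝ) :
    MeasurableSet {v : ℝ | a < Real.exp (-v) ∧ Real.exp (-v) ≤ b} := by
  have h : MeasurableSet ((fun v : ℝ => Real.exp (-v)) ⁻¹' Set.Ioc a b) :=
    (by fun_prop : Measurable fun v : ℝ => Real.exp (-v)) measurableSet_Ioc
  convert h using 1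
  ext v
  simp

lemma measurableSet_exp_neg_le_notMem {I : Set ℝ} (hI : MeasurableSet I) (b : ℝ) :
    MeasurableSet {v : ℝ | Real.exp (-v) ≤ b ∧ v ∉ I} := by
  have h : MeasurableSet ((fun v : ℝ => Real.exp (-v)) ⁻¹' Set.Iic b ∩ Iᶜ) :=
    ((by fun_prop : Measurable fun v : ℝ => Real.exp (-v)) measurableSet_Iic).inter hI.compl
  convert h using 1
  ext v
  simp

/-- The number of `i ∈ S` with `exp (-v) ≤ τ i`. -/
noncomputable def activeCount {ι : Type*} (S : Finset ι) (τ : ι → ℝ) (v : ℝ) : ℕ :=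
  (S.filter fun i => Real.exp (-v) ≤ τ i).card

lemma activeCount_le_card {ι : Type*} (S : Finset ι) (τ : ι → ℝ) (v : ℝ) :
    activeCount S τ v ≤ S.card := Finset.card_filter_le _ _

lemma activeCount_insert {ι : Type*} [DecidableEq ι] {S : Finset ι} {i : ι} (hi : i ∉ S)
    (τ : ι → ℝ) (v : ℝ) : activeCount (insert i S) τ v =
      activeCount S τ v + if Real.exp (-v) ≤ τ i then 1 else 0 := by
  unfold activeCount
  rw [Finset.filter_insert]
  split_ifs
  · rw [Finset.card_insert_of_notMem (by simp [hi])]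
  · rfl

lemma activeCount_congr {ι : Type*} {S : Finset ι} {τ τ' : ι → ℝ} (h : ∀ i ∈ S, τ i = τ' i)
    (v : ℝ) : activeCount S τ v = activeCount S τ' v := by
  unfold activeCount
  rw [Finset.filter_congr fun i hi => by rw [h i hi]]

lemma measurable_activeCount {ι : Type*} (S : Finset ι) (τ : ι → ℝ) :
    Measurable (activeCount S τ) := by
  classical
  have : activeCount S τ = fun v => ∑ i ∈ S, if Real.exp (-v) ≤ τ i then 1 else 0 := by
    funext v
    unfold activeCount
    rw [Finset.card_filter]
  rw [this]
  refine Finset.measurable_sum _ fun i _ => Measurable.ite ?_ measurable_const measurable_const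
  exact measurableSet_le (by fun_prop) measurable_const

open Matrix MeasureTheory in
/-- Merging a new column `y` into a weighted basis with weights `τ`: after a bounded change of
basis supported on `S`, the new weights `τ'` count one more active vector on the set `I`, and the
number of inactive vectors off `I` has controlled integral. -/
lemma exists_merge_column (m k : ℕ) : ∃ K : ℝ, 1 ≤ K ∧ ∀ S : Finset (Fin m), S.card = k →
    ∀ (τ y : Fin m → ℝ) (σ : ℝ), (∀ i, 0 ≤ τ i) → (∀ i ∈ S, y i ≠ 0) → (∀ i ∈ S, |y i| ≤ σ) →
    0 < σ → ∃ (τ' : Fin m → ℝ) (g : Matrix (Fin m) (Fin m) ℝ) (I : Set ℝ),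
      (∀ i, 0 ≤ τ' i) ∧ IsBddInv K g ∧ (∀ i ∉ S, g *ᵥ Pi.single i 1 = Pi.single i 1) ∧
      MeasurableSet I ∧ (∀ v ∈ I, ∃ i ∈ S, Real.exp (-v) ≤ |y i|) ∧
      (∀ p : Seminorm ℝ (Fin m → ℝ), ∑ i ∈ S, τ' i * p (g *ᵥ Pi.single i 1) ≤
        K * (∑ i ∈ S, τ i * p (Pi.single i 1) + p (∑ i ∈ S, Pi.single i (y i)))) ∧
      (∀ v, activeCount S τ' v = activeCount S τ v + I.indicator 1 v) ∧
      ∫⁻ v in {v | Real.exp (-v) ≤ σ ∧ v ∉ I}, ((S.card - activeCount S τ v : ℕ) : ENNReal) ≤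
        ∑ i ∈ S, ENNReal.ofReal (Real.log (σ / |y i|)) := by
  induction k with
  | zero =>
    refine ⟨1, le_rfl, fun S hS τ y σ hτ _ _ _ => ⟨τ, 1, ∅, hτ, IsBddInv.one, ?_, ?_⟩⟩
    · exact fun i _ => one_mulVec _
    · obtain rfl := Finset.card_eq_zero.1 hS
      simp [activeCount]
  | succ k ih =>
    obtain ⟨K, hK, ih⟩ := ih
    refine ⟨max (m * (2 * K)) (K + K), le_max_of_le_right (by linarith), ?_⟩
    intro S hS τ y σ hτ hy hyσ hσ
    have hne : S.Nonempty := Finset.card_pos.1 (by omega)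
    obtain ⟨j, hj, hjmax⟩ := S.exists_max_image (fun i => |y i|) hne
    have hz : 0 < |y j| := abs_pos.2 (hy j hj)
    by_cases hA : ∃ i ∈ S, |y j| ≤ τ i
    · obtain ⟨i, hi, hτi⟩ := hA
      obtain ⟨S, hiS, rfl⟩ : ∃ T, i ∉ T ∧ S = insert i T :=
        ⟨S.erase i, Finset.notMem_erase i S, (Finset.insert_erase hi).symm⟩
      rw [Finset.card_insert_of_notMem hiS] at hS
      obtain ⟨τ', g, I, h1, h2, h3, h4, h5, h6, h7, h8⟩ := ih S (by omega) τ y σ hτ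
        (fun a ha => hy a (Finset.mem_insert_of_mem ha))
        (fun a ha => hyσ a (Finset.mem_insert_of_mem ha)) hσ
      have hne' : ∀ a ∈ S, a ≠ i := fun a ha h => hiS (h ▸ ha)
      refine ⟨Function.update τ' i (τ i), g, I, ?_, h2.mono (le_max_of_le_right (by linarith)),
        ?_, h4, ?_, ?_, ?_, ?_⟩
      · intro a
        by_cases ha : a = i
        · subst ha; simpa using hτ a
        · simpa [ha] using h1 a
      · intro a ha
        exact h3 a fun h => ha (Finset.mem_insert_of_mem h)
      · intro v hv
        obtain ⟨a, ha, hav⟩ := h5 v hv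
        exact ⟨a, Finset.mem_insert_of_mem ha, hav⟩
      · intro p
        rw [Finset.sum_insert hiS, Finset.sum_insert hiS, Finset.sum_insert hiS, h3 i hiS,
          Function.update_self, Finset.sum_congr rfl (g := fun a => τ' a * p (g *ᵥ Pi.single a 1))
            fun a ha => by rw [Function.update_of_ne (hne' a ha)]]
        have e1 := h6 p
        set w₁ := ∑ a ∈ S, Pi.single a (y a) with hw₁
        set s₁ := ∑ a ∈ S, τ a * p (Pi.single a 1)
        have hs₁ : 0 ≤ s₁ := Finset.sum_nonneg fun a _ => mul_nonneg (hτ a) (apply_nonneg p _)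
        have e2 : p w₁ ≤ p (Pi.single i (y i) + w₁) + τ i * p (Pi.single i 1) := by
          have e3 : Pi.single i (y i) = y i • (Pi.single i 1 : Fin m → ℝ) := by
            rw [← Pi.single_smul, smul_eq_mul, mul_one]
          calc p w₁ = p ((Pi.single i (y i) + w₁) - Pi.single i (y i)) := by simp
            _ ≤ p (Pi.single i (y i) + w₁) + p (Pi.single i (y i)) := map_sub_le_add p _ _
            _ ≤ _ := by
              rw [e3, map_smul_eq_mul, Real.norm_eq_abs]
              gcongr
              exact (hjmax i hi).trans hτi
        have hp0 := apply_nonneg p (Pi.single i (y i) + w₁)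
        have hi0 : 0 ≤ τ i * p (Pi.single i 1) := mul_nonneg (hτ i) (apply_nonneg p _)
        have hM : K + K ≤ max (m * (2 * K)) (K + K) := le_max_right _ _
        refine le_trans ?_ (mul_le_mul_of_nonneg_right hM (by positivity))
        nlinarith
      · intro v
        rw [activeCount_insert hiS, activeCount_insert hiS,
          activeCount_congr (τ' := τ') fun a ha => by rw [Function.update_of_ne (hne' a ha)],
          h7 v, Function.update_self]
        ring
      · rw [Finset.sum_insert hiS, Finset.card_insert_of_notMem hiS, add_comm (ENNReal.ofReal _)]
        have hpt : ∀ v, ((S.card + 1 - activeCount (insert i S) τ v : ℕ) : ENNReal) ≤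
            ((S.card - activeCount S τ v : ℕ) : ENNReal) +
              {v | τ i < Real.exp (-v)}.indicator 1 v := by
          intro v
          rw [activeCount_insert hiS]
          have := activeCount_le_card S τ v
          by_cases hv : Real.exp (-v) ≤ τ i
          · rw [if_pos hv, Set.indicator_of_notMem (by simpa using hv)]
            norm_cast
            omega
          · rw [if_neg hv, Set.indicator_of_mem (by simpa using hv), Pi.one_apply]
            norm_cast
            omega
        refine (lintegral_mono hpt).trans ?_
        rw [lintegral_add_left]
        · refine add_le_add h8 ?_
          rw [lintegral_indicator_one (measurableSet_lt measurable_const (by fun_prop)),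
            Measure.restrict_apply (measurableSet_lt measurable_const (by fun_prop)),
            ← volume_setOf_lt_exp_neg_le (abs_pos.2 (hy i hi)) hσ]
          refine measure_mono fun v hv => ⟨?_, hv.2.1⟩
          exact ((hjmax i hi).trans hτi).trans_lt hv.1
        · exact (measurable_from_top (f := fun n : ℕ => ((S.card - n : ℕ) : ENNReal))).comp
            (measurable_activeCount S τ)
    · push Not at hA
      obtain ⟨S, hjS, rfl⟩ : ∃ T, j ∉ T ∧ S = insert j T :=
        ⟨S.erase j, Finset.notMem_erase j S, (Finset.insert_erase hj).symm⟩
      rw [Finset.card_insert_of_notMem hjS] at hS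
      have hne' : ∀ a ∈ S, a ≠ j := fun a ha h => hjS (h ▸ ha)
      set c : Fin m → ℝ := fun a => if a ∈ S then y a / y j else 0 with hc
      set g₁ : Matrix (Fin m) (Fin m) ℝ := 1 + vecMulVec c (Pi.single j 1) with hg₁
      have hcj : c j = 0 := by simp [hc, hjS]
      have hg₁b : IsBddInv 2 g₁ := by
        refine isBddInv_one_add_vecMulVec hcj fun a => ?_
        simp only [hc]
        split_ifs with h
        · rw [abs_div]
          exact (div_le_one hz).2 (hjmax a (Finset.mem_insert_of_mem h))
        · simp
      have hg₁v : ∀ x, g₁ *ᵥ x = x + x j • c := by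
        intro x
        rw [hg₁, add_mulVec, one_mulVec, vecMulVec_mulVec]
        simp
      have hg₁s : ∀ a, a ≠ j → g₁ *ᵥ Pi.single a 1 = Pi.single a 1 := by
        intro a ha
        rw [hg₁v]
        simp [ha]
      have hyc : ∑ a ∈ S, Pi.single a (y a) = y j • c := by
        funext b
        simp only [Finset.sum_apply, Pi.single_apply, Finset.sum_ite_eq, hc, Pi.smul_apply,
          smul_eq_mul, mul_ite, mul_zero]
        split_ifs
        · field_simp [hy j hj]
        · rfl
      have hysum : ∑ a ∈ insert j S, Pi.single a (y a) = y j • (g₁ *ᵥ Pi.single j 1) := by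
        rw [Finset.sum_insert hjS, hyc, hg₁v, smul_add]
        congr 1
        · rw [← Pi.single_smul]; simp
        · simp
      -- the data produced by the remaining indices
      obtain ⟨τ', g₂, I', h1, h2, h3, h4, h5, h6, h7, h8⟩ :
          ∃ (τ' : Fin m → ℝ) (g : Matrix (Fin m) (Fin m) ℝ) (I : Set ℝ),
          (∀ i, 0 ≤ τ' i) ∧ IsBddInv K g ∧ (∀ i ∉ S, g *ᵥ Pi.single i 1 = Pi.single i 1) ∧
          MeasurableSet I ∧ (∀ v ∈ I, Real.exp (-v) ≤ τ j) ∧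
          (∀ p : Seminorm ℝ (Fin m → ℝ), ∑ i ∈ S, τ' i * p (g *ᵥ Pi.single i 1) ≤
            K * (∑ i ∈ S, τ i * p (Pi.single i 1) + τ j * p c)) ∧
          (∀ v, activeCount S τ' v = activeCount S τ v + I.indicator 1 v) ∧
          ∫⁻ v in {v | Real.exp (-v) ≤ τ j ∧ v ∉ I},
            ((S.card - activeCount S τ v : ℕ) : ENNReal) ≤
            ∑ i ∈ S, ENNReal.ofReal (Real.log (|y j| / |y i|)) := by
        rcases (hτ j).eq_or_lt with h0 | hpos
        · refine ⟨τ, 1, ∅, hτ, IsBddInv.one.mono hK, fun i _ => one_mulVec _, MeasurableSet.empty, by simp,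
            fun p => ?_, by simp, ?_⟩
          · rw [← h0, zero_mul, add_zero]
            simp only [one_mulVec]
            exact le_mul_of_one_le_left
              (Finset.sum_nonneg fun a _ => mul_nonneg (hτ a) (apply_nonneg p _)) hK
          · rw [← h0]
            have : {v : ℝ | Real.exp (-v) ≤ 0 ∧ v ∉ (∅ : Set ℝ)} = ∅ := by
              ext v
              simp [Real.exp_pos]
            rw [this, Measure.restrict_empty, lintegral_zero_measure]
            exact zero_le
        · have hcle : ∀ a ∈ S, |c a| ≤ 1 := fun a ha => by
            simp only [hc, if_pos ha, abs_div]
            exact (div_le_one hz).2 (hjmax a (Finset.mem_insert_of_mem ha))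
          obtain ⟨τ', g, I, h1, h2, h3, h4, h5, h6, h7, h8⟩ := ih S (by omega) τ (τ j • c) (τ j) hτ
            (fun a ha => by
              simp only [hc, Pi.smul_apply, if_pos ha, smul_eq_mul]
              exact mul_ne_zero hpos.ne' (div_ne_zero (hy a (Finset.mem_insert_of_mem ha))
                (hy j hj)))
            (fun a ha => by
              rw [Pi.smul_apply, smul_eq_mul, abs_mul, abs_of_pos hpos]
              exact mul_le_of_le_one_right hpos.le (hcle a ha)) hpos
          refine ⟨τ', g, I, h1, h2, h3, h4, fun v hv => ?_, fun p => ?_, h7, ?_⟩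
          · obtain ⟨a, ha, hav⟩ := h5 v hv
            refine hav.trans ?_
            rw [Pi.smul_apply, smul_eq_mul, abs_mul, abs_of_pos hpos]
            exact mul_le_of_le_one_right hpos.le (hcle a ha)
          · have e : ∑ i ∈ S, Pi.single i ((τ j • c) i) = τ j • c := by
              funext b
              simp only [Finset.sum_apply, Pi.single_apply, Finset.sum_ite_eq, hc, Pi.smul_apply,
                smul_eq_mul, mul_ite, mul_zero]
              split_ifs <;> rfl
            have := h6 p
            rwa [e, map_smul_eq_mul, Real.norm_eq_abs, abs_of_pos hpos] at this
          · refine h8.trans (le_of_eq (Finset.sum_congr rfl fun a ha => ?_))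
            congr 2
            simp only [hc, Pi.smul_apply, if_pos ha, smul_eq_mul, abs_mul, abs_div,
              abs_of_pos hpos]
            have : |y a| ≠ 0 := abs_ne_zero.2 (hy a (Finset.mem_insert_of_mem ha))
            field_simp
      refine ⟨Function.update τ' j |y j|, g₁ * g₂,
        I' ∪ {v | τ j < Real.exp (-v) ∧ Real.exp (-v) ≤ |y j|}, ?_,
        (hg₁b.mul (by norm_num) (by linarith) h2).mono (le_max_left _ _), ?_, ?_, ?_, ?_, ?_, ?_⟩
      · intro a
        by_cases ha : a = j
        · subst ha; simp
        · simpa [ha] using h1 a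
      · intro a ha
        rw [Finset.mem_insert, not_or] at ha
        rw [← mulVec_mulVec, h3 a ha.2, hg₁s a ha.1]
      · exact h4.union (measurableSet_lt_exp_neg_le _ _)
      · rintro v (hv | hv)
        · exact ⟨j, hj, (h5 v hv).trans (hA j hj).le⟩
        · exact ⟨j, hj, hv.2⟩
      · intro p
        have e1 := h6 (p.comp (Matrix.mulVecLin g₁))
        simp only [Seminorm.comp_apply, mulVecLin_apply] at e1
        have e1' : ∑ i ∈ S, τ i * p (g₁ *ᵥ Pi.single i 1) = ∑ i ∈ S, τ i * p (Pi.single i 1) :=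
          Finset.sum_congr rfl fun a ha => by rw [hg₁s a (hne' a ha)]
        have hg₁c : g₁ *ᵥ c = c := by rw [hg₁v, hcj]; simp
        rw [e1', hg₁c] at e1
        rw [Finset.sum_insert hjS, Finset.sum_insert hjS, hysum, Function.update_self,
          Finset.sum_congr rfl (g := fun a => τ' a * p (g₁ *ᵥ (g₂ *ᵥ Pi.single a 1)))
            fun a ha => by rw [Function.update_of_ne (hne' a ha), mulVec_mulVec],
          ← mulVec_mulVec, h3 j hjS, map_smul_eq_mul, Real.norm_eq_abs]
        set X := p (g₁ *ᵥ Pi.single j 1) with hX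
        have hX0 : 0 ≤ X := apply_nonneg p _
        have hpc : p c ≤ X + p (Pi.single j 1) := by
          have : c = g₁ *ᵥ Pi.single j 1 - Pi.single j 1 := by rw [hg₁v]; simp
          conv_lhs => rw [this]
          exact map_sub_le_add p _ _
        have hτc : τ j * p c ≤ |y j| * X + τ j * p (Pi.single j 1) := by
          calc τ j * p c ≤ τ j * (X + p (Pi.single j 1)) := mul_le_mul_of_nonneg_left hpc (hτ j)
            _ = τ j * X + τ j * p (Pi.single j 1) := mul_add _ _ _
            _ ≤ _ := by
              gcongr
              exact (hA j hj).le
        set s₁ := ∑ i ∈ S, τ i * p (Pi.single i 1)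
        have hs₁ : 0 ≤ s₁ := Finset.sum_nonneg fun a _ => mul_nonneg (hτ a) (apply_nonneg p _)
        have hyX : 0 ≤ |y j| * X := by positivity
        have hj0 : 0 ≤ τ j * p (Pi.single j 1) := mul_nonneg (hτ j) (apply_nonneg p _)
        have hM : K + K ≤ max (m * (2 * K)) (K + K) := le_max_right _ _
        refine le_trans ?_ (mul_le_mul_of_nonneg_right hM (by positivity))
        nlinarith
      · intro v
        rw [activeCount_insert hjS, activeCount_insert hjS,
          activeCount_congr (τ' := τ') fun a ha => by rw [Function.update_of_ne (hne' a ha)],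
          h7 v, Function.update_self]
        classical
        simp only [Set.indicator_apply, Set.mem_union, Set.mem_ofPred_eq, Pi.one_apply]
        have a1 := h5 v
        have a2 := hA j hj
        by_cases b1 : v ∈ I'
        · have a3 := a1 b1
          simp [b1, a3, a3.trans a2.le]
        · by_cases b2 : Real.exp (-v) ≤ τ j
          · simp [b1, b2, b2.trans a2.le]
          · simp [b1, b2, not_le.1 b2]
      · have hsub : {v | Real.exp (-v) ≤ σ ∧
            v ∉ I' ∪ {v | τ j < Real.exp (-v) ∧ Real.exp (-v) ≤ |y j|}} ⊆
            {v | Real.exp (-v) ≤ τ j ∧ v ∉ I'} ∪ {v | |y j| < Real.exp (-v) ∧ Real.exp (-v) ≤ σ} := by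
          rintro v ⟨h1, h2⟩
          simp only [Set.mem_union, Set.mem_ofPred_eq, not_or, not_and, not_le] at h2 ⊢
          by_cases b2 : Real.exp (-v) ≤ τ j
          · exact Or.inl ⟨b2, h2.1⟩
          · exact Or.inr ⟨h2.2 (not_le.1 b2), h1⟩
        refine (lintegral_mono_set hsub).trans ((lintegral_union_le _ _ _).trans ?_)
        have hm1 : MeasurableSet {v | Real.exp (-v) ≤ τ j ∧ v ∉ I'} :=
          measurableSet_exp_neg_le_notMem h4 _
        have p1 : ∫⁻ v in {v | Real.exp (-v) ≤ τ j ∧ v ∉ I'},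
            (((insert j S).card - activeCount (insert j S) τ v : ℕ) : ENNReal) ≤
            ∑ i ∈ S, ENNReal.ofReal (Real.log (|y j| / |y i|)) := by
          refine le_trans (le_of_eq (setLIntegral_congr_fun hm1 fun v hv => ?_)) h8
          rw [activeCount_insert hjS, if_pos hv.1, Finset.card_insert_of_notMem hjS,
            Nat.add_sub_add_right]
        have p2 : ∫⁻ v in {v | |y j| < Real.exp (-v) ∧ Real.exp (-v) ≤ σ},
            (((insert j S).card - activeCount (insert j S) τ v : ℕ) : ENNReal) ≤
            (insert j S).card * ENNReal.ofReal (Real.log (σ / |y j|)) := by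
          refine (lintegral_mono (g := fun _ => ((insert j S).card : ENNReal)) fun v => ?_).trans ?_
          · dsimp only
            norm_cast
            omega
          · rw [setLIntegral_const, volume_setOf_lt_exp_neg_le hz hσ]
        refine (add_le_add p1 p2).trans ?_
        rw [Finset.sum_insert hjS, Finset.card_insert_of_notMem hjS]
        have p3 : ∀ i ∈ S, ENNReal.ofReal (Real.log (σ / |y i|)) =
            ENNReal.ofReal (Real.log (|y j| / |y i|)) + ENNReal.ofReal (Real.log (σ / |y j|)) := by
          intro i hi
          have hi0 : 0 < |y i| := abs_pos.2 (hy i (Finset.mem_insert_of_mem hi))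
          rw [← ENNReal.ofReal_add]
          · congr 1
            rw [Real.log_div hσ.ne' hi0.ne', Real.log_div hz.ne' hi0.ne',
              Real.log_div hσ.ne' hz.ne']
            ring
          · exact Real.log_nonneg ((one_le_div hi0).2 (hjmax i (Finset.mem_insert_of_mem hi)))
          · exact Real.log_nonneg ((one_le_div hz).2 (hyσ j hj))
        rw [Finset.sum_congr rfl p3, Finset.sum_add_distrib, Finset.sum_const, nsmul_eq_mul]
        push_cast
        refine le_of_eq ?_
        ring

/-- Lower bound, given `ρ` active columns, for the codimension lost by the remaining `n` layers;
a final rank above `r` is worth `C`. -/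
def layerCost (r C : ℕ) : ℕ → (ℕ → ℕ) → ℕ → ℕ
  | 0, _, ρ => if ρ ≤ r then 0 else C
  | n + 1, d, ρ => (Finset.range (min ρ (d 1) + 1)).inf' Finset.nonempty_range_add_one
      fun k => layerCost r C n (fun i => d (i + 1)) k + (ρ - k) * (d 1 - k)

lemma layerCost_ge (r C n : ℕ) (d : ℕ → ℕ) :
    C ≤ layerCost r C n d (d 0) ∨
      ∃ p, IsRankPath n d p ∧ p n ≤ r ∧ pathCost n d p ≤ layerCost r C n d (d 0) := by
  suffices h : ∀ ρ ≤ d 0, C ≤ layerCost r C n d ρ ∨ ∃ p : ℕ → ℕ, p 0 = ρ ∧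
      (∀ k < n, p (k + 1) ≤ p k) ∧ (∀ k ≤ n, p k ≤ d k) ∧ p n ≤ r ∧
      pathCost n d p ≤ layerCost r C n d ρ by
    refine (h _ le_rfl).imp_right ?_
    rintro ⟨p, h1, h2, h3, h4⟩
    exact ⟨p, ⟨h1, h2, h3⟩, h4⟩
  induction n generalizing d with
  | zero =>
    intro ρ hρ
    by_cases h : ρ ≤ r
    · exact Or.inr ⟨fun _ => ρ, rfl, by simp, by simpa using hρ, h, by simp [pathCost]⟩
    · exact Or.inl (by simp [layerCost, h])
  | succ n ih =>
    intro ρ hρ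
    obtain ⟨k, hk, hkeq⟩ := Finset.exists_mem_eq_inf' (s := Finset.range (min ρ (d 1) + 1))
      Finset.nonempty_range_add_one
      (fun k => layerCost r C n (fun i => d (i + 1)) k + (ρ - k) * (d 1 - k))
    rw [Finset.mem_range] at hk
    rw [layerCost, hkeq]
    rcases ih (fun i => d (i + 1)) k (show k ≤ d 1 by omega) with h | ⟨p, h1, h2, h3, h4, h5⟩
    · exact Or.inl (h.trans (Nat.le_add_right _ _))
    · refine Or.inr ⟨fun i => Nat.casesOn i ρ p, rfl, ?_, ?_, h4, ?_⟩
      · rintro (_ | i) hi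
        · change p 0 ≤ ρ
          omega
        · exact h2 i (by omega)
      · rintro (_ | i) hi
        · exact hρ
        · exact h3 i (by omega)
      · unfold pathCost at h5 ⊢
        rw [Finset.sum_range_succ']
        simp only [h1, zero_add]
        exact Nat.add_le_add_right h5 _

lemma KPmin_le_layerCost {N : ℕ} {d : ℕ → ℕ} {r : ℕ} (hN : 1 ≤ N) (hr : ∀ i ≤ N, r ≤ d i) :
    KPmin N d r ≤ layerCost r (KPmin N d r) N d (d 0) := by
  rcases layerCost_ge r (KPmin N d r) N d with h | ⟨p, hp, hpr, hc⟩
  · exact h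
  · exact (hp.KPmin_le_of_le hN hr hpr).trans hc

/-- Cost of inserting `a` further columns into an `m`-row matrix of rank `ρ`, when a final rank
`k` is worth `f k`. -/
def colCost (m : ℕ) (f : ℕ → ℕ) (a ρ : ℕ) : ℕ :=
  (Finset.range (min a (m - ρ) + 1)).inf' Finset.nonempty_range_add_one
    fun k => f (ρ + k) + (a - k) * (m - ρ - k)

lemma colCost_zero (m : ℕ) (f : ℕ → ℕ) (ρ : ℕ) : colCost m f 0 ρ = f ρ := by
  simp [colCost]

lemma colCost_succ_le {m : ℕ} (f : ℕ → ℕ) (a ρ : ℕ) (h : ρ < m) :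
    colCost m f (a + 1) ρ ≤ colCost m f a (ρ + 1) := by
  refine Finset.le_inf' _ _ fun k hk => ?_
  rw [Finset.mem_range] at hk
  refine (Finset.inf'_le (b := k + 1) _ (Finset.mem_range.2 (by omega))).trans ?_
  rw [show ρ + (k + 1) = ρ + 1 + k by ring, show a + 1 - (k + 1) = a - k by omega,
    show m - ρ - (k + 1) = m - (ρ + 1) - k by omega]

lemma colCost_succ_le_add (m : ℕ) (f : ℕ → ℕ) (a ρ : ℕ) :
    colCost m f (a + 1) ρ ≤ colCost m f a ρ + (m - ρ) := by
  rw [← Nat.sub_le_iff_le_add]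
  refine Finset.le_inf' _ _ fun k hk => ?_
  rw [Finset.mem_range] at hk
  rw [Nat.sub_le_iff_le_add]
  refine (Finset.inf'_le (b := k) _ (Finset.mem_range.2 (by omega))).trans ?_
  rw [show a + 1 - k = (a - k) + 1 by omega, add_mul, one_mul, add_assoc]
  exact Nat.add_le_add_left (Nat.add_le_add_left (Nat.sub_le _ _) _) _

lemma layerCost_succ (r C n : ℕ) (d : ℕ → ℕ) (ρ : ℕ) :
    layerCost r C (n + 1) d ρ = colCost (d 1) (layerCost r C n fun i => d (i + 1)) ρ 0 := by
  simp [layerCost, colCost]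

section MeasureLemmas

open MeasureTheory Metric

/-- A linear change of variables on a closed ball, with a constant depending only on the operator
bounds; the integrand need not be measurable. -/
lemma exists_lintegral_closedBall_comp_le {E F : Type*} [NormedAddCommGroup E] [NormedSpace ℝ E]
    [FiniteDimensional ℝ E] [MeasurableSpace E] [BorelSpace E] [NormedAddCommGroup F]
    [NormedSpace ℝ F] [FiniteDimensional ℝ F] [MeasurableSpace F] [BorelSpace F] (μ : Measure E)
    [μ.IsAddHaarMeasure] (ν : Measure F) [ν.IsAddHaarMeasure] {K : ℝ} (hK : 0 ≤ K) :
    ∃ c : ENNReal, c ≠ ⊤ ∧ ∀ L : E ≃ₗ[ℝ] F, (∀ x, ‖L x‖ ≤ K * ‖x‖) →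
      (∀ y, ‖L.symm y‖ ≤ K * ‖y‖) → ∀ (R : ℝ) (G : F → ENNReal),
      ∫⁻ x in closedBall 0 R, G (L x) ∂μ ≤ c * ∫⁻ y in closedBall 0 (K * R), G y ∂ν := by
  refine ⟨μ (closedBall 0 K) / ν (closedBall 0 1), ?_, fun L hL hL' R G => ?_⟩
  · exact ENNReal.div_ne_top (isCompact_closedBall _ _).measure_lt_top.ne
      (measure_closedBall_pos ν 0 one_pos).ne'
  · let e : E ≃L[ℝ] F := L.toContinuousLinearEquiv
    have he : ∀ x, e x = L x := fun x => rfl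
    have h1 := Measure.isAddLeftInvariant_eq_smul (μ.map e) ν
    set c := Measure.addHaarScalarFactor (μ.map e) ν with hc
    have hball : (c : ENNReal) * ν (closedBall 0 1) ≤ μ (closedBall 0 K) := by
      have h2 : (μ.map e) (closedBall 0 1) = c * ν (closedBall 0 1) := by
        rw [h1, Measure.smul_apply]
        rfl
      rw [← h2, Measure.map_apply e.continuous.measurable measurableSet_closedBall]
      refine measure_mono fun x hx => ?_
      rw [Set.mem_preimage, mem_closedBall_zero_iff] at hx
      rw [mem_closedBall_zero_iff]
      have h3 := hL' (e x)
      rw [he, L.symm_apply_apply] at h3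
      exact h3.trans (mul_le_of_le_one_right hK hx)
    have hcle : (c : ENNReal) ≤ μ (closedBall 0 K) / ν (closedBall 0 1) :=
      (ENNReal.le_div_iff_mul_le (Or.inl (measure_closedBall_pos ν 0 one_pos).ne')
        (Or.inl (isCompact_closedBall _ _).measure_lt_top.ne)).2 hball
    have hsub : closedBall (0 : E) R ⊆ e ⁻¹' closedBall 0 (K * R) := by
      intro x hx
      rw [Set.mem_preimage, mem_closedBall_zero_iff]
      rw [mem_closedBall_zero_iff] at hx
      exact (hL x).trans (mul_le_mul_of_nonneg_left hx hK)
    calc ∫⁻ x in closedBall 0 R, G (L x) ∂μ ≤ ∫⁻ x in e ⁻¹' closedBall 0 (K * R), G (e x) ∂μ :=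
          lintegral_mono_set hsub
      _ = ∫⁻ y in closedBall 0 (K * R), G y ∂(μ.map e) := by
          have hemb : MeasurableEmbedding e := e.toHomeomorph.measurableEmbedding
          rw [hemb.restrict_map, hemb.lintegral_map]
      _ = c * ∫⁻ y in closedBall 0 (K * R), G y ∂ν := by
          rw [h1, Measure.restrict_smul, lintegral_smul_measure]
          rfl
      _ ≤ _ := by gcongr

/-- Tonelli's inequality on the unit-shaped product of two closed balls. -/
lemma lintegral_closedBall_prod_le {E F : Type*} [NormedAddCommGroup E] [MeasurableSpace E]
    [NormedAddCommGroup F] [MeasurableSpace F] (μ : Measure E) (ν : Measure F) [SFinite μ]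
    [SFinite ν] (R : ℝ) (G : E × F → ENNReal) :
    ∫⁻ x in closedBall 0 R, G x ∂(μ.prod ν) ≤
      ∫⁻ x in closedBall 0 R, ∫⁻ y in closedBall 0 R, G (x, y) ∂ν ∂μ := by
  have : (closedBall 0 R : Set (E × F)) = closedBall 0 R ×ˢ closedBall 0 R :=
    (closedBall_prod_same 0 0 R).symm
  rw [this, ← Measure.prod_restrict]
  exact lintegral_prod_le _

lemma norm_finCons {n : ℕ} {M : Fin (n + 1) → Type*} [∀ i, NormedAddCommGroup (M i)] (x : M 0)
    (y : ∀ i : Fin n, M i.succ) : ‖(Fin.cons x y : ∀ i, M i)‖ = max ‖x‖ ‖y‖ := by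
  refine le_antisymm ((pi_norm_le_iff_of_nonneg (by positivity)).2 fun i => ?_) (max_le ?_ ?_)
  · refine Fin.cases ?_ (fun i => ?_) i
    · simp
    · simpa using Or.inr (norm_le_pi_norm y i)
  · simpa using norm_le_pi_norm (Fin.cons x y : ∀ i, M i) 0
  · refine (pi_norm_le_iff_of_nonneg (norm_nonneg _)).2 fun i => ?_
    simpa using norm_le_pi_norm (Fin.cons x y : ∀ i, M i) i.succ

/-- Splitting off the first factor of an integral over a ball of a finite product. -/
lemma exists_lintegral_closedBall_finCons_le {n : ℕ} (M : Fin (n + 1) → Type*)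
    [∀ i, NormedAddCommGroup (M i)] [∀ i, NormedSpace ℝ (M i)] [∀ i, FiniteDimensional ℝ (M i)]
    [∀ i, MeasureSpace (M i)] [∀ i, BorelSpace (M i)]
    [∀ i, (volume : Measure (M i)).IsAddHaarMeasure] :
    ∃ c : ENNReal, c ≠ ⊤ ∧ ∀ (R : ℝ) (G : (∀ i, M i) → ENNReal),
      ∫⁻ x in closedBall 0 R, G x ≤
        c * ∫⁻ x in closedBall 0 R, ∫⁻ y in closedBall 0 R, G (Fin.cons x y) := by
  have : ∀ i, SecondCountableTopology (M i) := fun i =>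
    have := FiniteDimensional.proper_real (M i)
    inferInstance
  obtain ⟨c, hc, h⟩ := exists_lintegral_closedBall_comp_le (volume : Measure (∀ i, M i))
    ((volume : Measure (M 0)).prod (volume : Measure (∀ i : Fin n, M i.succ))) zero_le_one
  refine ⟨c, hc, fun R G => ?_⟩
  have := h (Fin.consLinearEquiv ℝ M).symm
    (fun x => by
      obtain ⟨y, rfl⟩ := (Fin.consLinearEquiv ℝ M).surjective x
      rw [LinearEquiv.symm_apply_apply, one_mul]
      exact (norm_finCons y.1 y.2).ge)
    (fun y => by
      rw [LinearEquiv.symm_symm, one_mul]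
      exact (norm_finCons y.1 y.2).le) R (fun y => G (Fin.consLinearEquiv ℝ M y))
  simp only [LinearEquiv.apply_symm_apply, one_mul] at this
  refine this.trans ?_
  gcongr
  exact lintegral_closedBall_prod_le _ _ _ _

lemma lintegral_pi_prod_le {n : ℕ} {E : Type*} [MeasurableSpace E] (μ : Fin n → Measure E)
    [∀ i, SigmaFinite (μ i)] (F : Fin n → E → ENNReal) (hF : ∀ i, Measurable (F i)) :
    ∫⁻ x, ∏ i, F i (x i) ∂(Measure.pi μ) ≤ ∏ i, ∫⁻ x, F i x ∂(μ i) := by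
  induction n with
  | zero => simp
  | succ n ih =>
    have h := (measurePreserving_piFinSuccAbove μ 0).symm
    rw [← h.lintegral_comp_emb (MeasurableEquiv.measurableEmbedding _)]
    refine (lintegral_prod_le _).trans ?_
    simp only [Fin.prod_univ_succ]
    calc _ = ∫⁻ x, ∫⁻ y : Fin n → E, F 0 x * ∏ i, F i.succ (y i)
          ∂(Measure.pi fun i => μ i.succ) ∂(μ 0) := rfl
      _ = ∫⁻ x, F 0 x * ∫⁻ y : Fin n → E, ∏ i, F i.succ (y i)
          ∂(Measure.pi fun i => μ i.succ) ∂(μ 0) := by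
        refine lintegral_congr fun x => lintegral_const_mul _ ?_
        exact Finset.measurable_prod _ fun i _ => (hF _).comp (measurable_pi_apply i)
      _ ≤ ∫⁻ x, F 0 x * ∏ i, ∫⁻ y, F (Fin.succ i) y ∂(μ (Fin.succ i)) ∂(μ 0) := by
        gcongr with x
        exact ih (fun i => μ i.succ) (fun i => F i.succ) fun i => hF _
      _ = _ := lintegral_mul_const _ (hF 0)

lemma lintegral_closedBall_pi_prod_le {n : ℕ} {E : Type*} [NormedAddCommGroup E] [MeasureSpace E]
    [SigmaFinite (volume : Measure E)] {R : ℝ} (hR : 0 ≤ R) (F : Fin n → E → ENNReal)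
    (hF : ∀ i, Measurable (F i)) {K : ENNReal} (hK : ∀ i, ∫⁻ x in closedBall 0 R, F i x ≤ K) :
    ∫⁻ x : Fin n → E in closedBall 0 R, ∏ i, F i (x i) ≤ K ^ n := by
  rw [closedBall_pi _ hR, volume_pi, Measure.restrict_pi_pi]
  refine (lintegral_pi_prod_le _ F hF).trans ?_
  refine (Finset.prod_le_prod' fun i _ => hK i).trans (by simp)

/-- Local integrability of `|x|^{-t}` on the line, uniformly in translations. -/
lemma exists_lintegral_abs_rpow_neg_le {t : ℝ} (ht0 : 0 < t) (ht : t < 1) (R : ℝ) :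
    ∃ K : ENNReal, K ≠ ⊤ ∧ ∀ c : ℝ,
      ∫⁻ x in closedBall 0 R, ENNReal.ofReal |x + c| ^ (-t) ≤ K := by
  have h1 : ∫⁻ x in closedBall (0 : ℝ) 1, ENNReal.ofReal |x| ^ (-t) ≠ ⊤ := by
    have h2 : IntegrableOn (fun x : ℝ => |x| ^ (-t)) (Set.Icc (-1) 1) := by
      have h3 : IntegrableOn (fun x : ℝ => x ^ (-t)) (Set.Ioc 0 1) :=
        (intervalIntegrable_iff_integrableOn_Ioc_of_le zero_le_one).1
          (intervalIntegral.intervalIntegrable_rpow' (by linarith))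
      have h4 : IntegrableOn (fun x : ℝ => |x| ^ (-t)) (Set.Ioc 0 1) :=
        h3.congr_fun (fun x hx => by simp only [abs_of_pos hx.1]) measurableSet_Ioc
      have h5 : IntegrableOn (fun x : ℝ => |x| ^ (-t)) (Set.Ico (-1) 0) := by
        have := (Measure.measurePreserving_neg (volume : Measure ℝ)).integrableOn_comp_preimage
          (Homeomorph.neg ℝ).measurableEmbedding (f := fun x : ℝ => |x| ^ (-t)) (s := Set.Ioc 0 1)
        have h6 := this.2 h4
        simpa [Function.comp_def] using h6
      have h7 : Set.Icc (-1 : ℝ) 1 ⊆ (Set.Ico (-1) 0 ∪ Set.Ioc 0 1) ∪ {0} := by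
        intro x hx
        rcases lt_trichotomy x 0 with h | h | h
        · exact Or.inl (Or.inl ⟨hx.1, h⟩)
        · exact Or.inr h
        · exact Or.inl (Or.inr ⟨h, hx.2⟩)
      exact ((h5.union h4).union (by simp)).mono_set h7
    have h8 := h2.lintegral_lt_top
    rw [Real.closedBall_eq_Icc, zero_sub, zero_add]
    refine ne_of_lt (lt_of_le_of_lt (le_of_eq ?_) h8)
    refine lintegral_congr_ae (ae_restrict_of_ae ?_)
    filter_upwards [Measure.ae_ne volume (0 : ℝ)] with x hx
    rw [ENNReal.ofReal_rpow_of_pos (abs_pos.2 hx)]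
  refine ⟨(∫⁻ x in closedBall (0 : ℝ) 1, ENNReal.ofReal |x| ^ (-t)) + volume (closedBall (0 : ℝ) R),
    ENNReal.add_ne_top.2 ⟨h1, (isCompact_closedBall _ _).measure_lt_top.ne⟩, fun c => ?_⟩
  have hpt : ∀ y : ℝ, ENNReal.ofReal |y| ^ (-t) ≤
      (closedBall (0 : ℝ) 1).indicator (fun y => ENNReal.ofReal |y| ^ (-t)) y + 1 := by
    intro y
    by_cases hy : y ∈ closedBall (0 : ℝ) 1
    · rw [Set.indicator_of_mem hy]
      exact le_self_add
    · rw [Set.indicator_of_notMem hy, zero_add, ENNReal.rpow_neg]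
      rw [mem_closedBall_zero_iff, not_le, Real.norm_eq_abs] at hy
      refine ENNReal.inv_le_one.2 (ENNReal.one_le_rpow ?_ ht0)
      rw [ENNReal.one_le_ofReal]
      exact hy.le
  calc ∫⁻ x in closedBall 0 R, ENNReal.ofReal |x + c| ^ (-t)
      ≤ ∫⁻ x in closedBall 0 R,
        ((closedBall (0 : ℝ) 1).indicator (fun y => ENNReal.ofReal |y| ^ (-t)) (x + c) + 1) :=
        lintegral_mono fun x => hpt _
    _ = (∫⁻ x in closedBall 0 R,
        (closedBall (0 : ℝ) 1).indicator (fun y => ENNReal.ofReal |y| ^ (-t)) (x + c)) +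
          volume (closedBall (0 : ℝ) R) := by
        rw [lintegral_add_right _ measurable_const]
        simp
    _ ≤ (∫⁻ x, (closedBall (0 : ℝ) 1).indicator (fun y => ENNReal.ofReal |y| ^ (-t)) (x + c)) +
          volume (closedBall (0 : ℝ) R) := by
        gcongr
        exact Measure.restrict_le_self
    _ = _ := by
        rw [lintegral_add_right_eq_self
          ((closedBall (0 : ℝ) 1).indicator fun y => ENNReal.ofReal |y| ^ (-t)),
          lintegral_indicator measurableSet_closedBall]

end MeasureLemmas

section LayerIntegral

open MeasureTheory Metric Matrix

/-- The distance to a subspace, as a seminorm. -/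
noncomputable def quotSeminorm {q : ℕ} (E : Submodule ℝ (Fin q → ℝ)) : Seminorm ℝ (Fin q → ℝ) :=
  (normSeminorm ℝ ((Fin q → ℝ) ⧸ E)).comp E.mkQ

/-- The largest value of `w ^ (-z)`, for a functional `w` of seminorms evaluated at the distances
of `Q x` to the subspaces of dimension at most `r`. -/
noncomputable def supPow {q m : ℕ} (r : ℕ) (z : ℝ) (w : Seminorm ℝ (Fin m → ℝ) → ℝ)
    (Q : Matrix (Fin q) (Fin m) ℝ) : ENNReal :=
  ⨆ E : {E : Submodule ℝ (Fin q → ℝ) // Module.finrank ℝ E ≤ r},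
    ENNReal.ofReal (w ((quotSeminorm E.1).comp Q.mulVecLin)) ^ (-z)

lemma ENNReal.rpow_neg_le_rpow_neg {a b : ENNReal} {z : ℝ} (hz : 0 ≤ z) (h : b ≤ a) :
    a ^ (-z) ≤ b ^ (-z) := by
  rw [ENNReal.rpow_neg, ENNReal.rpow_neg]
  exact ENNReal.inv_le_inv.2 (ENNReal.rpow_le_rpow h hz)

lemma ENNReal.ofReal_rpow_neg_le {K a b z : ℝ} (hz : 0 ≤ z) (hK : 0 < K) (h : b ≤ K * a) :
    ENNReal.ofReal a ^ (-z) ≤ ENNReal.ofReal K ^ z * ENNReal.ofReal b ^ (-z) := by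
  have hK0 : ENNReal.ofReal K ≠ 0 := (ENNReal.ofReal_pos.2 hK).ne'
  have h1 : ENNReal.ofReal b ≤ ENNReal.ofReal K * ENNReal.ofReal a := by
    rw [← ENNReal.ofReal_mul hK.le]
    exact ENNReal.ofReal_le_ofReal h
  calc ENNReal.ofReal a ^ (-z)
      = ENNReal.ofReal K ^ z * (ENNReal.ofReal K * ENNReal.ofReal a) ^ (-z) := by
        rw [ENNReal.mul_rpow_of_ne_top ENNReal.ofReal_ne_top ENNReal.ofReal_ne_top, ← mul_assoc,
          ← ENNReal.rpow_add _ _ hK0 ENNReal.ofReal_ne_top, add_neg_cancel, ENNReal.rpow_zero,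
          one_mul]
    _ ≤ _ := mul_le_mul_right (ENNReal.rpow_neg_le_rpow_neg hz h1) _

lemma supPow_le_of_le {q m r : ℕ} {z K : ℝ} (hz : 0 ≤ z) (hK : 0 < K)
    {w w' : Seminorm ℝ (Fin m → ℝ) → ℝ} (h : ∀ p, w' p ≤ K * w p)
    (Q : Matrix (Fin q) (Fin m) ℝ) :
    supPow r z w Q ≤ ENNReal.ofReal K ^ z * supPow r z w' Q := by
  refine iSup_le fun E => ?_
  refine (ENNReal.ofReal_rpow_neg_le hz hK (h _)).trans ?_
  gcongr
  exact le_iSup (fun E : {E : Submodule ℝ (Fin q → ℝ) // Module.finrank ℝ E ≤ r} =>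
    ENNReal.ofReal (w' ((quotSeminorm E.1).comp Q.mulVecLin)) ^ (-z)) E

lemma supPow_mul {q m k r : ℕ} {z : ℝ} (w : Seminorm ℝ (Fin k → ℝ) → ℝ)
    (Q : Matrix (Fin q) (Fin m) ℝ) (g : Matrix (Fin m) (Fin k) ℝ) :
    supPow r z w (Q * g) = supPow r z (fun p => w (p.comp g.mulVecLin)) Q := by
  unfold supPow
  simp only [Matrix.mulVecLin_mul]
  rfl

/-- The iterated integral over `n` layers of matrices in the ball of radius `R`, completed by a
supremum over boundedly invertible matrices on the left. -/
noncomputable def layerIntegral (R : ℝ) : ∀ (n : ℕ) (d : ℕ → ℕ),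
    (Matrix (Fin (d n)) (Fin (d 0)) ℝ → ENNReal) → ENNReal
  | 0, d, Φ => ⨆ g : {g : Matrix (Fin (d 0)) (Fin (d 0)) ℝ // IsBddInv R g}, Φ g.1
  | n + 1, d, Φ => ∫⁻ A : Fin (d 1) → Fin (d 0) → ℝ in closedBall 0 R,
      layerIntegral R n (fun i => d (i + 1)) fun Q => Φ (Q * Matrix.of A)

lemma layerIntegral_mono {R R' : ℝ} (hR : R ≤ R') (n : ℕ) (d : ℕ → ℕ)
    {Φ Φ' : Matrix (Fin (d n)) (Fin (d 0)) ℝ → ENNReal} (h : ∀ Q, Φ Q ≤ Φ' Q) :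
    layerIntegral R n d Φ ≤ layerIntegral R' n d Φ' := by
  induction n generalizing d with
  | zero =>
    refine iSup_le fun g => (h _).trans ?_
    exact le_iSup (fun g : {g : Matrix (Fin (d 0)) (Fin (d 0)) ℝ // IsBddInv R' g} => Φ' g.1)
      ⟨g.1, g.2.mono hR⟩
  | succ n ih =>
    refine (lintegral_mono fun A => ?_).trans (lintegral_mono_set (closedBall_subset_closedBall hR))
    exact ih (fun i => d (i + 1)) fun Q => h _

lemma layerIntegral_const_mul {c : ENNReal} (hc : c ≠ ⊤) (R : ℝ) (n : ℕ) (d : ℕ → ℕ)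
    (Φ : Matrix (Fin (d n)) (Fin (d 0)) ℝ → ENNReal) :
    layerIntegral R n d (fun Q => c * Φ Q) = c * layerIntegral R n d Φ := by
  induction n generalizing d with
  | zero => exact (ENNReal.mul_iSup _ _).symm
  | succ n ih =>
    simp only [layerIntegral]
    rw [← lintegral_const_mul' _ _ hc]
    exact lintegral_congr fun A => ih (fun i => d (i + 1)) _

lemma pi_norm_apply_le {a b : ℕ} (A : Fin a → Fin b → ℝ) (i : Fin a) (j : Fin b) :
    |A i j| ≤ ‖A‖ :=
  (norm_le_pi_norm (A i) j).trans (norm_le_pi_norm A i)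

lemma pi_norm_le_of_abs_le {a b : ℕ} {A : Fin a → Fin b → ℝ} {K : ℝ} (hK : 0 ≤ K)
    (h : ∀ i j, |A i j| ≤ K) : ‖A‖ ≤ K :=
  (pi_norm_le_iff_of_nonneg hK).2 fun i => (pi_norm_le_iff_of_nonneg hK).2 fun j => h i j

/-- Multiplication by a boundedly invertible matrix is a bounded change of variables. -/
lemma IsBddInv.exists_equiv_mul_right {a b : ℕ} {K : ℝ} (hK : 0 ≤ K)
    {g : Matrix (Fin b) (Fin b) ℝ} (hg : IsBddInv K g) :
    ∃ L : (Fin a → Fin b → ℝ) ≃ₗ[ℝ] (Fin a → Fin b → ℝ),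
      (∀ A, Matrix.of (L A) = Matrix.of A * g) ∧ (∀ A, ‖L A‖ ≤ b * K * ‖A‖) ∧
      ∀ A, ‖L.symm A‖ ≤ b * K * ‖A‖ := by
  obtain ⟨g', h1, h2, hb, hb'⟩ := hg
  let L : Matrix (Fin a) (Fin b) ℝ ≃ₗ[ℝ] Matrix (Fin a) (Fin b) ℝ :=
    { toFun := fun A => A * g
      invFun := fun A => A * g'
      map_add' := fun A B => Matrix.add_mul _ _ _
      map_smul' := fun c A => Matrix.smul_mul _ _ _
      left_inv := fun A => by simp only [Matrix.mul_assoc, h1, Matrix.mul_one]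
      right_inv := fun A => by simp only [Matrix.mul_assoc, h2, Matrix.mul_one] }
  have key : ∀ (A C : Fin a → Fin b → ℝ) (h : Matrix (Fin b) (Fin b) ℝ), (∀ i j, |h i j| ≤ K) →
      Matrix.of C = Matrix.of A * h → ‖C‖ ≤ b * K * ‖A‖ := by
    intro A C h hh hC
    refine pi_norm_le_of_abs_le (by positivity) fun i j => ?_
    have := Matrix.abs_mul_apply_le (g := Matrix.of A) (fun i j => pi_norm_apply_le A i j) hh
      (norm_nonneg A) i j
    rw [← hC, Fintype.card_fin] at this
    refine this.trans (le_of_eq ?_)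
    ring
  exact ⟨L, fun A => rfl, fun A => key A (L A) g hb rfl, fun A => key A (L.symm A) g' hb' rfl⟩

lemma exists_layerIntegral_mul_le (n : ℕ) (d : ℕ → ℕ) {K : ℝ} (hK : 0 ≤ K) (R : ℝ) :
    ∃ (c : ENNReal) (R' : ℝ), c ≠ ⊤ ∧ ∀ (g : Matrix (Fin (d 0)) (Fin (d 0)) ℝ), IsBddInv K g →
      ∀ Φ : Matrix (Fin (d n)) (Fin (d 0)) ℝ → ENNReal,
      layerIntegral R n d (fun Q => Φ (Q * g)) ≤ c * layerIntegral R' n d Φ := by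
  cases n with
  | zero =>
    refine ⟨1, d 0 * (|R| * K), ENNReal.one_ne_top, fun g hg Φ => ?_⟩
    rw [one_mul]
    refine iSup_le fun h => ?_
    exact le_iSup (fun g : {g : Matrix (Fin (d 0)) (Fin (d 0)) ℝ //
      IsBddInv (d 0 * (|R| * K)) g} => Φ g.1)
      ⟨h.1 * g, (h.2.mono (le_abs_self R)).mul (abs_nonneg R) hK hg⟩
  | succ n =>
    obtain ⟨c, hc, h⟩ := exists_lintegral_closedBall_comp_le
      (volume : Measure (Fin (d 1) → Fin (d 0) → ℝ)) (volume : Measure (Fin (d 1) → Fin (d 0) → ℝ))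
      (K := d 0 * K) (by positivity)
    refine ⟨c, max R (d 0 * K * R), hc, fun g hg Φ => ?_⟩
    obtain ⟨L, hL, hL1, hL2⟩ := hg.exists_equiv_mul_right (a := d 1) hK
    have := h L hL1 hL2 R fun A => layerIntegral R n (fun i => d (i + 1))
      fun Q => Φ (Q * Matrix.of A)
    simp only [hL, ← Matrix.mul_assoc] at this
    refine this.trans ?_
    simp only [layerIntegral]
    refine mul_le_mul_right ((lintegral_mono fun A => ?_).trans
      (lintegral_mono_set (closedBall_subset_closedBall (le_max_right _ _)))) _
    exact layerIntegral_mono (le_max_left _ _) n (fun i => d (i + 1)) fun Q => le_rfl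

end LayerIntegral

section TerminalLayer

open MeasureTheory Metric Matrix

/-- Few columns of a boundedly invertible matrix are close to a subspace of small dimension. -/
lemma exists_le_quotSeminorm (m : ℕ) (R : ℝ) : ∃ c : ℝ, 0 < c ∧
    ∀ g : Matrix (Fin m) (Fin m) ℝ, IsBddInv R g → ∀ E : Submodule ℝ (Fin m → ℝ),
    ∀ J : Finset (Fin m), Module.finrank ℝ E < J.card →
    ∃ j ∈ J, c ≤ quotSeminorm E (g *ᵥ Pi.single j 1) := by
  refine ⟨1 / (m * (|R| * m) + 1), by positivity, ?_⟩
  rintro g ⟨g', h1, h2, h3, h4⟩ E J hJ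
  by_contra! hcon
  set c : ℝ := 1 / (m * (|R| * m) + 1) with hc
  have hcpos : 0 < c := by positivity
  have hx : ∀ j : J, ∃ x : E, ‖g *ᵥ Pi.single j.1 1 - x.1‖ < c := by
    intro j
    have h := hcon j j.2
    rw [quotSeminorm, Seminorm.comp_apply, coe_normSeminorm, Submodule.mkQ_apply] at h
    obtain ⟨y, hy, hyc⟩ := Submodule.Quotient.norm_mk_lt (E.mkQ (g *ᵥ Pi.single j.1 1))
      (sub_pos.2 h)
    refine ⟨⟨g *ᵥ Pi.single j.1 1 - y, (Submodule.Quotient.eq E).1 hy.symm⟩, ?_⟩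
    rw [sub_sub_cancel]
    rw [Submodule.mkQ_apply] at hyc
    linarith
  choose x hx using hx
  have hdep : ¬ LinearIndependent ℝ x := by
    intro h
    have := h.fintype_card_le_finrank
    rw [Fintype.card_coe] at this
    omega
  obtain ⟨a, ha, j0, hj0⟩ := Fintype.not_linearIndependent_iff.1 hdep
  obtain ⟨j, -, hj⟩ := Finset.univ.exists_max_image (fun j => |a j|) ⟨j0, Finset.mem_univ _⟩
  have hpos : 0 < |a j| := (abs_pos.2 hj0).trans_le (hj _ (Finset.mem_univ _))
  have hsum : ∑ i, a i • (x i : Fin m → ℝ) = 0 := by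
    simpa using congrArg Subtype.val ha
  have h5 : g' *ᵥ (∑ i, a i • (g *ᵥ Pi.single i.1 1 - (x i).1)) = ∑ i, a i • Pi.single i.1 1 := by
    simp only [smul_sub, Finset.sum_sub_distrib, hsum, sub_zero]
    rw [Matrix.mulVec_sum]
    refine Finset.sum_congr rfl fun i _ => ?_
    rw [Matrix.mulVec_smul, Matrix.mulVec_mulVec, h2, Matrix.one_mulVec]
  have h6 : (∑ i, a i • (Pi.single i.1 1 : Fin m → ℝ)) j.1 = a j := by
    rw [Finset.sum_apply, Finset.sum_eq_single j]
    · simp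
    · intro i _ hij
      have : (j : Fin m) ≠ i := fun h => hij (Subtype.ext h.symm)
      simp [this]
    · simp
  have h7 : |a j| ≤ m * (|R| * (m * (|a j| * c))) := by
    conv_lhs => rw [← h6, ← h5, Matrix.mulVec, dotProduct]
    refine (Finset.abs_sum_le_sum_abs _ _).trans ?_
    refine (Finset.sum_le_sum (g := fun _ => |R| * (m * (|a j| * c))) fun k _ => ?_).trans (by simp)
    rw [abs_mul]
    refine mul_le_mul ((h4 _ _).trans (le_abs_self R)) ?_ (abs_nonneg _) (abs_nonneg _)
    rw [Finset.sum_apply]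
    refine (Finset.abs_sum_le_sum_abs _ _).trans ?_
    refine (Finset.sum_le_sum (g := fun _ => |a j| * c) fun i _ => ?_).trans ?_
    · rw [Pi.smul_apply, smul_eq_mul, abs_mul]
      exact mul_le_mul (hj i (Finset.mem_univ _)) ((norm_le_pi_norm _ k).trans (hx i).le)
        (abs_nonneg _) (abs_nonneg _)
    · rw [Finset.sum_const, nsmul_eq_mul, Finset.card_univ, Fintype.card_coe]
      have : (J.card : ℝ) ≤ m := by exact_mod_cast (card_finset_fin_le J)
      gcongr
  have h8 : m * (|R| * m) * c < 1 := by
    rw [hc, mul_one_div, div_lt_one (by positivity)]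
    linarith
  nlinarith

lemma activeCount_mono {ι : Type*} (S : Finset ι) (τ : ι → ℝ) {v v' : ℝ} (h : v ≤ v') :
    activeCount S τ v ≤ activeCount S τ v' :=
  Finset.card_le_card fun i hi => by
    rw [Finset.mem_filter] at hi ⊢
    exact ⟨hi.1, (Real.exp_le_exp.2 (by linarith)).trans hi.2⟩

/-- The weighted sum of the values of a seminorm on the standard basis. -/
noncomputable def basisWeight {m : ℕ} (τ : Fin m → ℝ) (p : Seminorm ℝ (Fin m → ℝ)) : ℝ :=
  ∑ i, τ i * p (Pi.single i 1)

/-- The integral of the reciprocal power of the weights is controlled by the integrated deficit. -/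
def LayerBound (r C : ℕ) (t : ℝ) (n : ℕ) (d : ℕ → ℕ) : Prop :=
  ∀ R : ℝ, ∃ K : ENNReal, K ≠ ⊤ ∧ ∀ (τ : Fin (d 0) → ℝ) (θ : ℝ), (∀ i, 0 ≤ τ i) → 0 ≤ θ →
    ∫⁻ v in Set.Ici 0, ((C - layerCost r C n d (activeCount Finset.univ τ v) : ℕ) : ENNReal) ≤
      ENNReal.ofReal θ →
    layerIntegral R n d (supPow r (t * C) (basisWeight τ)) ≤ K * ENNReal.ofReal (Real.exp (t * θ))

lemma lt_activeCount_of_lintegral_le {r C m : ℕ} {τ : Fin m → ℝ} (hC : 0 < C) {θ : ℝ}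
    (hθ : 0 ≤ θ) (h : ∫⁻ v in Set.Ici 0,
      ((C - (if activeCount Finset.univ τ v ≤ r then 0 else C) : ℕ) : ENNReal) ≤
        ENNReal.ofReal θ) :
    r < activeCount Finset.univ τ (θ / C + 1) := by
  by_contra! hcon
  have hC' : (0 : ℝ) < C := by exact_mod_cast hC
  have h1 : ∫⁻ _ in Set.Icc (0 : ℝ) (θ / C + 1), (C : ENNReal) ≤ ENNReal.ofReal θ := by
    refine le_trans ?_ ((lintegral_mono_set
      (fun v hv => hv.1 : Set.Icc 0 (θ / C + 1) ⊆ Set.Ici 0)).trans h)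
    refine setLIntegral_mono' measurableSet_Icc fun v hv => ?_
    rw [if_pos ((activeCount_mono _ _ hv.2).trans hcon), Nat.sub_zero]
  rw [setLIntegral_const, Real.volume_Icc, sub_zero, ← ENNReal.ofReal_natCast,
    ← ENNReal.ofReal_mul hC'.le, ENNReal.ofReal_le_ofReal_iff hθ, mul_add, mul_div_cancel₀ _ hC'.ne'] at h1
  linarith

lemma layerBound_zero (r C : ℕ) {t : ℝ} (ht : 0 ≤ t) (d : ℕ → ℕ) : LayerBound r C t 0 d := by
  intro R
  rcases Nat.eq_zero_or_pos C with rfl | hC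
  · refine ⟨1, ENNReal.one_ne_top, fun τ θ hτ hθ _ => iSup_le fun g => iSup_le fun E => ?_⟩
    rw [Nat.cast_zero, mul_zero, neg_zero, ENNReal.rpow_zero, one_mul, ENNReal.one_le_ofReal]
    exact Real.one_le_exp (by positivity)
  obtain ⟨c, hc, hlow⟩ := exists_le_quotSeminorm (d 0) R
  have hC' : (0 : ℝ) < C := by exact_mod_cast hC
  refine ⟨ENNReal.ofReal ((c * Real.exp (-1)) ^ (-(t * C))), ENNReal.ofReal_ne_top,
    fun τ θ hτ hθ h => iSup_le fun g => iSup_le fun E => ?_⟩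
  have h1 := lt_activeCount_of_lintegral_le hC hθ h
  obtain ⟨j, hj, hjc⟩ := hlow g.1 g.2 E.1 _ (E.2.trans_lt h1)
  rw [Finset.mem_filter] at hj
  have h2 : c * Real.exp (-1) * Real.exp (-(θ / C)) ≤
      basisWeight τ ((quotSeminorm E.1).comp g.1.mulVecLin) := by
    refine le_trans ?_ (Finset.single_le_sum (f := fun i =>
      τ i * ((quotSeminorm E.1).comp g.1.mulVecLin) (Pi.single i 1))
      (fun i _ => mul_nonneg (hτ i) (apply_nonneg _ _)) (Finset.mem_univ j))
    rw [mul_assoc, ← Real.exp_add, mul_comm, show -1 + -(θ / C) = -(θ / C + 1) by ring]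
    exact mul_le_mul hj.2 hjc hc.le (hτ j)
  have h3 : (0 : ℝ) < c * Real.exp (-1) * Real.exp (-(θ / C)) := by positivity
  rw [ENNReal.ofReal_rpow_of_pos (h3.trans_le h2), ← ENNReal.ofReal_mul (by positivity)]
  refine ENNReal.ofReal_le_ofReal ((Real.rpow_le_rpow_of_nonpos h3 h2 (by
    have : 0 ≤ t * C := by positivity
    linarith)).trans (le_of_eq ?_))
  rw [Real.mul_rpow (by positivity) (by positivity), ← Real.exp_mul]
  congr 2
  field_simp

end TerminalLayer

section ColumnMerging

open MeasureTheory Metric Matrix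

lemma activeCount_fin_succ {k : ℕ} (σ : Fin (k + 1) → ℝ) (v : ℝ) :
    activeCount Finset.univ σ v =
      activeCount Finset.univ (fun j => σ (Fin.succ j)) v +
        if Real.exp (-v) ≤ σ 0 then 1 else 0 := by
  unfold activeCount
  rw [Finset.card_filter, Fin.sum_univ_succ, ← Finset.card_filter, add_comm]

/-- The deficit after inserting a column, in terms of the deficit before. -/
lemma lintegral_deficit_le {C m k : ℕ} {c : ℕ → ℕ → ℕ}
    (hc1 : ∀ a ρ, ρ < m → c (a + 1) ρ ≤ c a (ρ + 1))
    (hc2 : ∀ a ρ, c (a + 1) ρ ≤ c a ρ + (m - ρ)) {σ : Fin (k + 1) → ℝ} {τ τ' : Fin m → ℝ}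
    {I : Set ℝ} (hI : MeasurableSet I) (hIσ : ∀ v ∈ I, Real.exp (-v) ≤ σ 0)
    (hcount : ∀ v, activeCount Finset.univ τ' v = activeCount Finset.univ τ v + I.indicator 1 v) :
    ∫⁻ v in Set.Ici 0, ((C - c (activeCount Finset.univ (fun j => σ (Fin.succ j)) v)
        (activeCount Finset.univ τ' v) : ℕ) : ENNReal) ≤
      (∫⁻ v in Set.Ici 0, ((C - c (activeCount Finset.univ σ v)
        (activeCount Finset.univ τ v) : ℕ) : ENNReal)) +
      ∫⁻ v in {v | Real.exp (-v) ≤ σ 0 ∧ v ∉ I},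
        ((m - activeCount Finset.univ τ v : ℕ) : ENNReal) := by
  set S : Set ℝ := {v | Real.exp (-v) ≤ σ 0 ∧ v ∉ I} with hS
  have hSm : MeasurableSet S := measurableSet_exp_neg_le_notMem hI _
  have hmeas : Measurable fun v => ((C - c (activeCount Finset.univ σ v)
      (activeCount Finset.univ τ v) : ℕ) : ENNReal) := by
    have h1 : Measurable fun p : ℕ × ℕ => ((C - c p.1 p.2 : ℕ) : ENNReal) :=
      measurable_of_countable _
    have h2 : Measurable fun v => (activeCount Finset.univ σ v, activeCount Finset.univ τ v) :=
      (measurable_activeCount _ σ).prodMk (measurable_activeCount _ τ)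
    simpa only [Function.comp_def] using h1.comp h2
  have hpt : ∀ v, ((C - c (activeCount Finset.univ (fun j => σ (Fin.succ j)) v)
        (activeCount Finset.univ τ' v) : ℕ) : ENNReal) ≤
      ((C - c (activeCount Finset.univ σ v)
        (activeCount Finset.univ τ v) : ℕ) : ENNReal) +
      S.indicator (fun v => ((m - activeCount Finset.univ τ v : ℕ) : ENNReal)) v := by
    intro v
    rw [activeCount_fin_succ σ v]
    have hle := activeCount_le_card Finset.univ τ' v
    have hc := hcount v
    rw [Finset.card_univ, Fintype.card_fin] at hle
    by_cases hv : v ∈ I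
    · rw [Set.indicator_of_mem hv, Pi.one_apply] at hc
      rw [if_pos (hIσ v hv), hc]
      refine le_add_right (Nat.cast_le.2 ?_)
      have := hc1 (activeCount Finset.univ (fun j => σ (Fin.succ j)) v)
        (activeCount Finset.univ τ v) (by omega)
      omega
    · rw [Set.indicator_of_notMem hv, add_zero] at hc
      rw [hc]
      by_cases hσ : Real.exp (-v) ≤ σ 0
      · rw [if_pos hσ, Set.indicator_of_mem (show v ∈ S from ⟨hσ, hv⟩), ← Nat.cast_add,
          Nat.cast_le]
        have := hc2 (activeCount Finset.univ (fun j => σ (Fin.succ j)) v)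
          (activeCount Finset.univ τ v)
        omega
      · rw [if_neg hσ, add_zero]
        exact le_self_add
  refine (lintegral_mono hpt).trans ?_
  rw [lintegral_add_left hmeas, ← lintegral_indicator hSm]
  gcongr
  exact Measure.restrict_le_self

lemma basisWeight_nonneg {m : ℕ} {τ : Fin m → ℝ} (hτ : ∀ i, 0 ≤ τ i)
    (p : Seminorm ℝ (Fin m → ℝ)) : 0 ≤ basisWeight τ p :=
  Finset.sum_nonneg fun i _ => mul_nonneg (hτ i) (apply_nonneg _ _)

/-- The weighted sum of the values of a seminorm on the standard basis and on further columns. -/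
noncomputable def columnWeight {m k : ℕ} (τ : Fin m → ℝ) (σ : Fin k → ℝ) (A : Fin k → Fin m → ℝ)
    (p : Seminorm ℝ (Fin m → ℝ)) : ℝ :=
  basisWeight τ p + ∑ j, σ j * p (A j)

lemma exists_merge_supPow (m : ℕ) : ∃ K : ℝ, 1 ≤ K ∧ ∀ {k : ℕ} (τ : Fin m → ℝ)
    (σ : Fin (k + 1) → ℝ) (y : Fin m → ℝ) (R : ℝ), (∀ i, 0 ≤ τ i) → (∀ j, 0 ≤ σ j) → 1 ≤ R →
    (∀ i, y i ≠ 0) → (∀ i, |y i| ≤ R) →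
    ∃ (τ' : Fin m → ℝ) (g g' : Matrix (Fin m) (Fin m) ℝ), (∀ i, 0 ≤ τ' i) ∧ IsBddInv K g ∧
      IsBddInv K g' ∧
      (∀ (q r : ℕ) (z : ℝ), 0 ≤ z → ∀ (A : Fin k → Fin m → ℝ) (Q : Matrix (Fin q) (Fin m) ℝ),
        supPow r z (columnWeight τ σ (Fin.cons y A)) Q ≤ ENNReal.ofReal K ^ z *
          supPow r z (columnWeight τ' (fun j => σ (Fin.succ j)) fun j => g' *ᵥ A j) (Q * g)) ∧
      ∀ (C : ℕ) (f : ℕ → ℕ) (θ : ℝ), 0 ≤ θ →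
        ∫⁻ v in Set.Ici 0, ((C - colCost m f (activeCount Finset.univ σ v)
          (activeCount Finset.univ τ v) : ℕ) : ENNReal) ≤ ENNReal.ofReal θ →
        ∫⁻ v in Set.Ici 0, ((C - colCost m f (activeCount Finset.univ (fun j => σ (Fin.succ j)) v)
          (activeCount Finset.univ τ' v) : ℕ) : ENNReal) ≤
          ENNReal.ofReal (θ + ∑ i, Real.log (R / |y i|)) := by
  obtain ⟨K, hK, hmerge⟩ := exists_merge_column m m
  refine ⟨K, hK, fun {k} τ σ y R hτ hσ hR hy hyR => ?_⟩
  have hlog : ∀ i, 0 ≤ Real.log (R / |y i|) := fun i =>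
    Real.log_nonneg ((one_le_div (abs_pos.2 (hy i))).2 (hyR i))
  have hsum : ∀ (p : Seminorm ℝ (Fin m → ℝ)) (A : Fin k → Fin m → ℝ),
      columnWeight τ σ (Fin.cons y A) p =
        basisWeight τ p + σ 0 * p y + ∑ j, σ (Fin.succ j) * p (A j) := by
    intro p A
    rw [columnWeight, Fin.sum_univ_succ]
    simp only [Fin.cons_zero, Fin.cons_succ, add_assoc]
  rcases (hσ 0).eq_or_lt with h0 | h0
  · refine ⟨τ, 1, 1, hτ, IsBddInv.one.mono hK, IsBddInv.one.mono hK, ?_, ?_⟩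
    · intro q r z hz A Q
      simp only [Matrix.mul_one, Matrix.one_mulVec]
      refine supPow_le_of_le hz (by linarith) (fun p => ?_) Q
      rw [hsum, ← h0, zero_mul, add_zero]
      exact le_mul_of_one_le_left (add_nonneg (basisWeight_nonneg hτ p)
        (Finset.sum_nonneg fun j _ => mul_nonneg (hσ _) (apply_nonneg _ _))) hK
    · intro C f θ hθ h
      refine (lintegral_deficit_le (colCost_succ_le f) (colCost_succ_le_add m f) (I := ∅) (τ := τ) MeasurableSet.empty (by simp)
        (by simp)).trans ?_
      have : {v : ℝ | Real.exp (-v) ≤ σ 0 ∧ v ∉ (∅ : Set ℝ)} = ∅ := by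
        ext v
        simp [← h0, Real.exp_pos]
      rw [this, setLIntegral_empty, add_zero]
      exact h.trans (ENNReal.ofReal_le_ofReal (by
        linarith [Finset.sum_nonneg fun i (_ : i ∈ Finset.univ) => hlog i]))
  · have hR0 : 0 < R := by linarith
    obtain ⟨τ', g, I, hτ', hg, -, hI, hIex, hp, hcount, hbound⟩ :=
      hmerge Finset.univ (Fintype.card_fin m) τ (fun i => σ 0 / R * y i) (σ 0) hτ
        (fun i _ => mul_ne_zero (div_pos h0 hR0).ne' (hy i))
        (fun i _ => by
          rw [abs_mul, abs_of_pos (div_pos h0 hR0), div_mul_eq_mul_div, div_le_iff₀ hR0]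
          exact mul_le_mul_of_nonneg_left (hyR i) h0.le) h0
    obtain ⟨g', h1, h2, h3, h4⟩ := hg
    refine ⟨τ', g, g', hτ', ⟨g', h1, h2, h3, h4⟩, ⟨g, h2, h1, h4, h3⟩, ?_, ?_⟩
    · intro q r z hz A Q
      rw [supPow_mul]
      refine supPow_le_of_le hz (by linarith) (fun p => ?_) Q
      have hA : ∀ j, (p.comp g.mulVecLin) (g' *ᵥ A j) = p (A j) := fun j => by
        rw [Seminorm.comp_apply, mulVecLin_apply, mulVec_mulVec, h1, one_mulVec]
      rw [hsum, columnWeight]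
      simp only [hA]
      have h5 : basisWeight τ' (p.comp g.mulVecLin) ≤ K * (basisWeight τ p + σ 0 * p y) := by
        refine (hp p).trans (mul_le_mul_of_nonneg_left ?_ (by linarith))
        have h6 : ∑ i, Pi.single i (σ 0 / R * y i) = (σ 0 / R) • y := by
          rw [Finset.univ_sum_single]
          rfl
        rw [h6, map_smul_eq_mul, Real.norm_eq_abs, abs_of_pos (div_pos h0 hR0)]
        refine add_le_add le_rfl (mul_le_mul_of_nonneg_right ?_ (apply_nonneg _ _))
        exact div_le_self h0.le hR
      rw [mul_add]
      exact add_le_add h5 (le_mul_of_one_le_left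
        (Finset.sum_nonneg fun j _ => mul_nonneg (hσ _) (apply_nonneg _ _)) hK)
    · intro C f θ hθ h
      refine (lintegral_deficit_le (colCost_succ_le f) (colCost_succ_le_add m f) hI (fun v hv => ?_) hcount).trans ?_
      · obtain ⟨i, -, hi⟩ := hIex v hv
        refine hi.trans ?_
        rw [abs_mul, abs_of_pos (div_pos h0 hR0), div_mul_eq_mul_div, div_le_iff₀ hR0]
        exact mul_le_mul_of_nonneg_left (hyR i) h0.le
      · rw [ENNReal.ofReal_add hθ (Finset.sum_nonneg fun i _ => hlog i)]
        refine add_le_add h ?_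
        rw [Finset.card_univ, Fintype.card_fin] at hbound
        refine hbound.trans (le_of_eq ?_)
        rw [ENNReal.ofReal_sum_of_nonneg fun i _ => hlog i]
        refine Finset.sum_congr rfl fun i _ => ?_
        congr 2
        rw [abs_mul, abs_of_pos (div_pos h0 hR0)]
        have := abs_pos.2 (hy i)
        field_simp

end ColumnMerging

section LayerRecursion

open MeasureTheory Metric Matrix

lemma ENNReal.prod_eq_top_of_one_le {ι : Type*} {s : Finset ι} {f : ι → ENNReal}
    (h : ∀ i ∈ s, 1 ≤ f i) {i : ι} (hi : i ∈ s) (hf : f i = ⊤) : ∏ i ∈ s, f i = ⊤ := by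
  classical
  rw [← Finset.mul_prod_erase s f hi, hf]
  refine ENNReal.top_mul (ne_of_gt (lt_of_lt_of_le one_pos ?_))
  exact Finset.one_le_prod' fun j hj => h j (Finset.mem_of_mem_erase hj)

/-- The integral over one column, in terms of the integral over the remaining columns. -/
lemma LayerBound.lintegral_cons_le {r C n k : ℕ} {t : ℝ} {d : ℕ → ℕ} (ht : 0 < t) {R : ℝ}
    (hR : 1 ≤ R) : ∃ (c : ENNReal) (R' : ℝ), c ≠ ⊤ ∧ 1 ≤ R' ∧ ∀ (K : ENNReal),
    (∀ (τ : Fin (d 0) → ℝ) (σ : Fin k → ℝ) (θ : ℝ), (∀ i, 0 ≤ τ i) → (∀ j, 0 ≤ σ j) → 0 ≤ θ →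
      ∫⁻ v in Set.Ici 0, ((C - colCost (d 0) (layerCost r C n d) (activeCount Finset.univ σ v)
        (activeCount Finset.univ τ v) : ℕ) : ENNReal) ≤ ENNReal.ofReal θ →
      ∫⁻ A : Fin k → Fin (d 0) → ℝ in closedBall 0 R',
        layerIntegral R' n d (supPow r (t * C) (columnWeight τ σ A)) ≤
          K * ENNReal.ofReal (Real.exp (t * θ))) →
    ∀ (τ : Fin (d 0) → ℝ) (σ : Fin (k + 1) → ℝ) (θ : ℝ), (∀ i, 0 ≤ τ i) → (∀ j, 0 ≤ σ j) →
      0 ≤ θ →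
      ∫⁻ v in Set.Ici 0, ((C - colCost (d 0) (layerCost r C n d) (activeCount Finset.univ σ v)
        (activeCount Finset.univ τ v) : ℕ) : ENNReal) ≤ ENNReal.ofReal θ →
      ∀ y : Fin (d 0) → ℝ, ‖y‖ ≤ R →
      ∫⁻ A : Fin k → Fin (d 0) → ℝ in closedBall 0 R,
        layerIntegral R n d (supPow r (t * C) (columnWeight τ σ (Fin.cons y A))) ≤
          c * (K + 1) * ENNReal.ofReal (Real.exp (t * θ)) *
            ∏ i, (ENNReal.ofReal R ^ t * ENNReal.ofReal |y i| ^ (-t)) := by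
  obtain ⟨Kg, hKg, hmerge⟩ := exists_merge_supPow (d 0)
  obtain ⟨c2, R2, hc2, hinv⟩ := exists_layerIntegral_mul_le n d (K := Kg) (by linarith) R
  obtain ⟨c3, hc3, hlin⟩ := exists_lintegral_closedBall_comp_le
      (volume : Measure (Fin k → Fin (d 0) → ℝ)) (volume : Measure (Fin k → Fin (d 0) → ℝ))
      (K := d 0 * Kg) (by positivity)
  set R' := max R (max R2 (d 0 * Kg * R)) with hR'
  have hcz : ENNReal.ofReal Kg ^ (t * C) * c2 ≠ ⊤ :=
    ENNReal.mul_ne_top (ENNReal.rpow_ne_top_of_nonneg (by positivity) ENNReal.ofReal_ne_top) hc2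
  refine ⟨1 + ENNReal.ofReal Kg ^ (t * C) * c2 * c3, R', ENNReal.add_ne_top.2
    ⟨ENNReal.one_ne_top, ENNReal.mul_ne_top hcz hc3⟩, hR.trans (le_max_left _ _), ?_⟩
  intro K hK τ σ θ hτ hσ hθ hpot y hyR
  have hyR' : ∀ i, |y i| ≤ R := fun i => (norm_le_pi_norm y i).trans hyR
  by_cases hy : ∀ i, y i ≠ 0
  · obtain ⟨τ', g, g', hτ', hg, hg', hsup, hpot'⟩ := hmerge τ σ y R hτ hσ hR hy hyR'
    obtain ⟨g'', k1, k2, k3, k4⟩ := hg'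
    have hgT : IsBddInv Kg g'ᵀ := ⟨g''ᵀ, by rw [← transpose_mul, k2, transpose_one],
      by rw [← transpose_mul, k1, transpose_one], fun i j => k3 j i, fun i j => k4 j i⟩
    obtain ⟨L, hL, hL1, hL2⟩ := hgT.exists_equiv_mul_right (a := k) (by linarith)
    have hLA : ∀ A, (fun j => g' *ᵥ A j) = L A := by
      intro A
      have := hL A
      funext j i
      have h2 : (Matrix.of (L A)) j i = (Matrix.of A * g'ᵀ) j i := by rw [hL]
      rw [Matrix.of_apply] at h2
      rw [h2, Matrix.mul_apply]
      simp only [mulVec, dotProduct, transpose_apply, of_apply, mul_comm]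
    set G : (Fin k → Fin (d 0) → ℝ) → ENNReal := fun A =>
      layerIntegral R' n d (supPow r (t * C) (columnWeight τ' (fun j => σ (Fin.succ j)) A))
      with hG
    have hlog : ∀ i, 0 ≤ Real.log (R / |y i|) := fun i =>
      Real.log_nonneg ((one_le_div (abs_pos.2 (hy i))).2 (hyR' i))
    have hpt : ∀ A, layerIntegral R n d (supPow r (t * C) (columnWeight τ σ (Fin.cons y A))) ≤
        ENNReal.ofReal Kg ^ (t * C) * c2 * G (L A) := by
      intro A
      refine (layerIntegral_mono le_rfl n d fun Q =>
        hsup _ r (t * C) (by positivity) A Q).trans ?_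
      rw [layerIntegral_const_mul (ENNReal.rpow_ne_top_of_nonneg (by positivity)
        ENNReal.ofReal_ne_top), mul_assoc]
      refine mul_le_mul_right ((hinv g hg _).trans (mul_le_mul_right ?_ _)) _
      rw [hG, hLA]
      exact layerIntegral_mono (le_max_of_le_right (le_max_left _ _)) n d fun Q => le_rfl
    have hexp : ENNReal.ofReal (Real.exp (t * (θ + ∑ i, Real.log (R / |y i|)))) =
        ENNReal.ofReal (Real.exp (t * θ)) *
          ∏ i, (ENNReal.ofReal R ^ t * ENNReal.ofReal |y i| ^ (-t)) := by
      rw [mul_add, Real.exp_add, ENNReal.ofReal_mul (Real.exp_nonneg _), Finset.mul_sum,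
        Real.exp_sum, ENNReal.ofReal_prod_of_nonneg fun i _ => Real.exp_nonneg _]
      congr 1
      refine Finset.prod_congr rfl fun i _ => ?_
      have hyi := abs_pos.2 (hy i)
      have hR0 : 0 < R := by linarith
      rw [ENNReal.ofReal_rpow_of_pos hR0, ENNReal.ofReal_rpow_of_pos hyi,
        ← ENNReal.ofReal_mul (by positivity), mul_comm t, ← Real.rpow_def_of_pos (by positivity),
        Real.div_rpow hR0.le hyi.le, Real.rpow_neg hyi.le, div_eq_mul_inv]
    calc ∫⁻ A in closedBall 0 R,
          layerIntegral R n d (supPow r (t * C) (columnWeight τ σ (Fin.cons y A)))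
        ≤ ∫⁻ A in closedBall 0 R, ENNReal.ofReal Kg ^ (t * C) * c2 * G (L A) :=
          lintegral_mono hpt
      _ = ENNReal.ofReal Kg ^ (t * C) * c2 * ∫⁻ A in closedBall 0 R, G (L A) :=
          lintegral_const_mul' _ _ hcz
      _ ≤ ENNReal.ofReal Kg ^ (t * C) * c2 * (c3 * ∫⁻ A in closedBall 0 R', G A) := by
          refine mul_le_mul_right ((hlin L hL1 hL2 R G).trans (mul_le_mul_right ?_ _)) _
          exact lintegral_mono_set (closedBall_subset_closedBall
            (le_max_of_le_right (le_max_right _ _)))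
      _ ≤ ENNReal.ofReal Kg ^ (t * C) * c2 * (c3 * (K *
          (ENNReal.ofReal (Real.exp (t * θ)) *
            ∏ i, (ENNReal.ofReal R ^ t * ENNReal.ofReal |y i| ^ (-t))))) := by
          rw [← hexp]
          refine mul_le_mul_right (mul_le_mul_right (hK τ' _ _ hτ' (fun j => hσ _)
            (add_nonneg hθ (Finset.sum_nonneg fun i _ => hlog i)) (hpot' C _ θ hθ hpot)) _) _
      _ = ENNReal.ofReal Kg ^ (t * C) * c2 * c3 * K * ENNReal.ofReal (Real.exp (t * θ)) *
            ∏ i, (ENNReal.ofReal R ^ t * ENNReal.ofReal |y i| ^ (-t)) := by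
          simp only [mul_assoc]
      _ ≤ _ := by
          gcongr
          · exact le_add_self
          · exact le_self_add
  · push Not at hy
    obtain ⟨i, hi⟩ := hy
    have htop : ∏ i, (ENNReal.ofReal R ^ t * ENNReal.ofReal |y i| ^ (-t)) = ⊤ := by
      refine ENNReal.prod_eq_top_of_one_le (fun j _ => ?_) (Finset.mem_univ i) ?_
      · calc (1 : ENNReal) = ENNReal.ofReal R ^ t * ENNReal.ofReal R ^ (-t) := by
              rw [← ENNReal.rpow_add _ _ (ENNReal.ofReal_pos.2 (by linarith)).ne'
                ENNReal.ofReal_ne_top, add_neg_cancel, ENNReal.rpow_zero]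
          _ ≤ _ := mul_le_mul_right (ENNReal.rpow_neg_le_rpow_neg ht.le
              (ENNReal.ofReal_le_ofReal (hyR' j))) _
      · rw [hi, abs_zero, ENNReal.ofReal_zero, ENNReal.zero_rpow_of_neg (by linarith)]
        refine ENNReal.mul_top (ne_of_gt (ENNReal.rpow_pos (ENNReal.ofReal_pos.2 (by linarith))
          ENNReal.ofReal_ne_top))
    rw [htop, ENNReal.mul_top]
    · exact le_top
    · refine mul_ne_zero (mul_ne_zero ?_ ?_) (ENNReal.ofReal_pos.2 (Real.exp_pos _)).ne'
      · exact (lt_of_lt_of_le one_pos le_self_add).ne'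
      · exact (lt_of_lt_of_le one_pos le_add_self).ne'

lemma LayerBound.lintegral_columns_le {r C n : ℕ} {t : ℝ} {d : ℕ → ℕ} (ht : 0 < t) (ht1 : t < 1)
    (h : LayerBound r C t n d) (k : ℕ) (R : ℝ) (hR : 1 ≤ R) : ∃ K : ENNReal, K ≠ ⊤ ∧
    ∀ (τ : Fin (d 0) → ℝ) (σ : Fin k → ℝ) (θ : ℝ), (∀ i, 0 ≤ τ i) → (∀ j, 0 ≤ σ j) → 0 ≤ θ →
      ∫⁻ v in Set.Ici 0, ((C - colCost (d 0) (layerCost r C n d) (activeCount Finset.univ σ v)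
        (activeCount Finset.univ τ v) : ℕ) : ENNReal) ≤ ENNReal.ofReal θ →
      ∫⁻ A : Fin k → Fin (d 0) → ℝ in closedBall 0 R,
        layerIntegral R n d (supPow r (t * C) (columnWeight τ σ A)) ≤
          K * ENNReal.ofReal (Real.exp (t * θ)) := by
  induction k generalizing R with
  | zero =>
    obtain ⟨K, hK, hb⟩ := h R
    refine ⟨K * volume (closedBall (0 : Fin 0 → Fin (d 0) → ℝ) R), ENNReal.mul_ne_top hK
      (isCompact_closedBall _ _).measure_lt_top.ne, fun τ σ θ hτ hσ hθ hpot => ?_⟩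
    have h1 : ∀ A : Fin 0 → Fin (d 0) → ℝ, columnWeight τ σ A = basisWeight τ := by
      intro A
      funext p
      simp [columnWeight]
    have h2 : ∀ v, activeCount Finset.univ σ v = 0 := fun v => by simp [activeCount]
    simp only [h2, colCost_zero] at hpot
    simp only [h1, setLIntegral_const]
    rw [mul_right_comm]
    exact mul_le_mul_left (hb τ θ hτ hθ hpot) _
  | succ k ih =>
    obtain ⟨c, R', hc, hR', hcons⟩ := LayerBound.lintegral_cons_le (r := r) (C := C) (n := n)
      (k := k) (d := d) ht hR
    obtain ⟨K, hK, hKb⟩ := ih R' hR'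
    obtain ⟨c1, hc1, hsplit⟩ := exists_lintegral_closedBall_finCons_le
      (fun _ : Fin (k + 1) => Fin (d 0) → ℝ)
    obtain ⟨K1, hK1, hone⟩ := exists_lintegral_abs_rpow_neg_le ht ht1 R
    have hRt : ENNReal.ofReal R ^ t ≠ ⊤ :=
      ENNReal.rpow_ne_top_of_nonneg ht.le ENNReal.ofReal_ne_top
    refine ⟨c1 * (c * (K + 1) * (ENNReal.ofReal R ^ t * K1) ^ d 0), ENNReal.mul_ne_top hc1
      (ENNReal.mul_ne_top (ENNReal.mul_ne_top hc (ENNReal.add_ne_top.2 ⟨hK, ENNReal.one_ne_top⟩))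
      (ENNReal.pow_ne_top (ENNReal.mul_ne_top hRt hK1))), fun τ σ θ hτ hσ hθ hpot => ?_⟩
    refine (hsplit R _).trans ?_
    rw [mul_assoc c1]
    refine mul_le_mul_right ?_ _
    have hfin : c * (K + 1) * ENNReal.ofReal (Real.exp (t * θ)) ≠ ⊤ :=
      ENNReal.mul_ne_top (ENNReal.mul_ne_top hc (ENNReal.add_ne_top.2 ⟨hK, ENNReal.one_ne_top⟩))
        ENNReal.ofReal_ne_top
    calc _ ≤ ∫⁻ y in closedBall (0 : Fin (d 0) → ℝ) R,
          c * (K + 1) * ENNReal.ofReal (Real.exp (t * θ)) *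
            ∏ i, (ENNReal.ofReal R ^ t * ENNReal.ofReal |y i| ^ (-t)) :=
          setLIntegral_mono' measurableSet_closedBall fun y hy =>
            hcons K hKb τ σ θ hτ hσ hθ hpot y (mem_closedBall_zero_iff.1 hy)
      _ = c * (K + 1) * ENNReal.ofReal (Real.exp (t * θ)) *
          ∫⁻ y in closedBall (0 : Fin (d 0) → ℝ) R,
            ∏ i, (ENNReal.ofReal R ^ t * ENNReal.ofReal |y i| ^ (-t)) :=
          lintegral_const_mul' _ _ hfin
      _ ≤ c * (K + 1) * ENNReal.ofReal (Real.exp (t * θ)) *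
          (ENNReal.ofReal R ^ t * K1) ^ d 0 := by
          refine mul_le_mul_right (lintegral_closedBall_pi_prod_le (by linarith)
            (fun (_ : Fin (d 0)) (x : ℝ) => ENNReal.ofReal R ^ t * ENNReal.ofReal |x| ^ (-t))
            (fun _ => by fun_prop) fun _ => ?_) _
          rw [lintegral_const_mul' _ _ hRt]
          have := hone 0
          simp only [add_zero] at this
          exact mul_le_mul_right this _
      _ = _ := by ring

lemma LayerBound.succ {r C n : ℕ} {t : ℝ} {d : ℕ → ℕ} (ht : 0 < t) (ht1 : t < 1)
    (h : LayerBound r C t n fun i => d (i + 1)) : LayerBound r C t (n + 1) d := by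
  intro R
  set R' := max R 1 with hR'
  obtain ⟨K, hK, hb⟩ := h.lintegral_columns_le ht ht1 (d 0) R' (le_max_right _ _)
  obtain ⟨c, hc, hlin⟩ := exists_lintegral_closedBall_comp_le
    (volume : Measure (Fin (d 1) → Fin (d 0) → ℝ)) (volume : Measure (Fin (d 0) → Fin (d 1) → ℝ))
    zero_le_one
  refine ⟨c * K, ENNReal.mul_ne_top hc hK, fun τ θ hτ hθ hpot => ?_⟩
  have hpot' := hb (fun _ => 0) τ θ (fun _ => le_rfl) hτ hθ (by
    have : ∀ v, activeCount (Finset.univ : Finset (Fin (d 1))) (fun _ => 0) v = 0 := fun v => by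
      simp [activeCount, Real.exp_pos]
    simpa only [this, layerCost_succ] using hpot)
  let L : (Fin (d 1) → Fin (d 0) → ℝ) ≃ₗ[ℝ] (Fin (d 0) → Fin (d 1) → ℝ) :=
    transposeLinearEquiv (Fin (d 1)) (Fin (d 0)) ℝ ℝ
  have hsw : ∀ {a b : ℕ} (A : Fin a → Fin b → ℝ), ‖fun j i => A i j‖ ≤ 1 * ‖A‖ := fun A => by
    rw [one_mul]
    exact pi_norm_le_of_abs_le (norm_nonneg _) fun i j => pi_norm_apply_le A j i
  have h1 := hlin L (fun A => hsw A) (fun A => hsw A) R' fun A =>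
    layerIntegral R' n (fun i => d (i + 1))
      (supPow r (t * C) (columnWeight (fun _ => 0) τ A))
  rw [one_mul] at h1
  have h2 : ∀ A : Fin (d 1) → Fin (d 0) → ℝ, ∀ Q : Matrix (Fin (d (n + 1))) (Fin (d 1)) ℝ,
      supPow r (t * C) (basisWeight τ) (Q * Matrix.of A) =
        supPow r (t * C) (columnWeight (fun _ => 0) τ (L A)) Q := by
    intro A Q
    rw [supPow_mul]
    congr 1
    funext p
    simp only [basisWeight, columnWeight, zero_mul, Finset.sum_const_zero, zero_add]
    refine Finset.sum_congr rfl fun j _ => ?_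
    rw [Seminorm.comp_apply, mulVecLin_apply, mulVec_single_one]
    rfl
  refine (layerIntegral_mono (le_max_left R 1) (n + 1) d fun Q => le_rfl).trans ?_
  simp only [layerIntegral, h2]
  refine h1.trans ?_
  rw [mul_assoc]
  exact mul_le_mul_right hpot' _

lemma layerBound (r C n : ℕ) {t : ℝ} (ht : 0 < t) (ht1 : t < 1) (d : ℕ → ℕ) :
    LayerBound r C t n d := by
  induction n generalizing d with
  | zero => exact layerBound_zero r C ht.le d
  | succ n ih => exact (ih _).succ ht ht1

/-- Integrability of the reciprocal power of the distances of the columns of the product to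
subspaces of dimension at most `r`. -/
lemma layerIntegral_supPow_ne_top {N : ℕ} {d : ℕ → ℕ} {r : ℕ} (hN : 1 ≤ N)
    (hr : ∀ i ≤ N, r ≤ d i) {t : ℝ} (ht : 0 < t) (ht1 : t < 1) (R : ℝ) :
    layerIntegral R N d (supPow r (t * KPmin N d r) (basisWeight fun _ => 1)) ≠ ⊤ := by
  obtain ⟨K, hK, hb⟩ := layerBound r (KPmin N d r) N ht ht1 d R
  refine ne_top_of_le_ne_top (ENNReal.mul_ne_top hK ENNReal.ofReal_ne_top)
    (hb (fun _ => 1) 0 (fun _ => zero_le_one) le_rfl ?_)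
  rw [ENNReal.ofReal_zero, nonpos_iff_eq_zero]
  rw [setLIntegral_congr_fun (g := fun _ => 0) measurableSet_Ici fun v hv => ?_]
  · simp
  · have hact : activeCount (Finset.univ : Finset (Fin (d 0))) (fun _ => (1 : ℝ)) v = d 0 := by
      rw [activeCount, Finset.filter_true_of_mem, Finset.card_univ, Fintype.card_fin]
      intro _ _
      rw [Real.exp_le_one_iff]
      simpa using hv
    rw [hact, Nat.sub_eq_zero_of_le (KPmin_le_layerCost hN hr), Nat.cast_zero]

end LayerRecursion

section NetworkProduct

open MeasureTheory Metric Matrix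

lemma matProd_congr {d : ℕ → ℕ} {A A' : ∀ i : ℕ, Matrix (Fin (d (i + 1))) (Fin (d i)) ℝ} {n : ℕ}
    (h : ∀ i < n, A i = A' i) : matProd ℝ d A n = matProd ℝ d A' n := by
  induction n with
  | zero => rfl
  | succ n ih =>
    rw [matProd, matProd, ih fun i hi => h i (by omega), h n (by omega)]

lemma matProd_succ_right (d : ℕ → ℕ) (A : ∀ i : ℕ, Matrix (Fin (d (i + 1))) (Fin (d i)) ℝ)
    (n : ℕ) : matProd ℝ d A (n + 1) =
      matProd ℝ (fun i => d (i + 1)) (fun i => A (i + 1)) n * A 0 := by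
  induction n with
  | zero => simp [matProd]
  | succ n ih => rw [matProd, ih, matProd, Matrix.mul_assoc]

lemma matProd_scale {d : ℕ → ℕ} {A A' : ∀ i : ℕ, Matrix (Fin (d (i + 1))) (Fin (d i)) ℝ}
    {γ δ : ∀ i : ℕ, Matrix (Fin (d i)) (Fin (d i)) ℝ} {n : ℕ}
    (hA : ∀ i < n + 1, A' i = γ (i + 1) * A i * δ i) (hγ : ∀ i < n, δ (i + 1) * γ (i + 1) = 1) :
    matProd ℝ d A' (n + 1) = γ (n + 1) * matProd ℝ d A (n + 1) * δ 0 := by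
  induction n with
  | zero => simp [matProd, hA 0]
  | succ n ih =>
    rw [matProd, ih (fun i hi => hA i (by omega)) fun i hi => hγ i (by omega),
      hA (n + 1) (by omega)]
    conv_rhs => rw [matProd]
    simp only [Matrix.mul_assoc]
    rw [← Matrix.mul_assoc (δ (n + 1)), hγ n (by omega), Matrix.one_mul]

/-- The end-to-end matrix of a deep linear network. -/
noncomputable def netProd (N : ℕ) (d : ℕ → ℕ)
    (x : ∀ i : Fin N, Fin (d ((i : ℕ) + 1)) → Fin (d (i : ℕ)) → ℝ) :
    Matrix (Fin (d N)) (Fin (d 0)) ℝ :=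
  matProd ℝ d (fun i => if h : i < N then Matrix.of (x ⟨i, h⟩) else 0) N

/-- The sum of the squares of the entries. -/
def sqDist {a b : ℕ} (B Q : Matrix (Fin a) (Fin b) ℝ) : ℝ :=
  ∑ i, ∑ j, (Q i j - B i j) ^ 2

lemma sqDist_nonneg {a b : ℕ} (B Q : Matrix (Fin a) (Fin b) ℝ) : 0 ≤ sqDist B Q :=
  Finset.sum_nonneg fun _ _ => Finset.sum_nonneg fun _ _ => sq_nonneg _

lemma abs_sub_le_sqrt_sqDist {a b : ℕ} (B Q : Matrix (Fin a) (Fin b) ℝ) (i : Fin a) (j : Fin b) :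
    |(Q - B) i j| ≤ √(sqDist B Q) := by
  refine Real.abs_le_sqrt ?_
  rw [Matrix.sub_apply]
  exact (Finset.single_le_sum (f := fun j => (Q i j - B i j) ^ 2) (fun _ _ => sq_nonneg _)
    (Finset.mem_univ j)).trans (Finset.single_le_sum (f := fun i => ∑ j, (Q i j - B i j) ^ 2)
      (fun _ _ => Finset.sum_nonneg fun _ _ => sq_nonneg _) (Finset.mem_univ i))

lemma DLNloss_eq (N : ℕ) (d : ℕ → ℕ) (B : Matrix (Fin (d N)) (Fin (d 0)) ℝ)
    (x : ∀ i : Fin N, Fin (d ((i : ℕ) + 1)) → Fin (d (i : ℕ)) → ℝ) :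
    DLNloss N d B x = sqDist B (netProd N d x) := rfl

lemma continuous_netProd (N : ℕ) (d : ℕ → ℕ) : Continuous (netProd N d) := by
  have : ∀ n, Continuous fun x : ∀ i : Fin N, Fin (d ((i : ℕ) + 1)) → Fin (d (i : ℕ)) → ℝ =>
      matProd ℝ d (fun i => if h : i < N then Matrix.of (x ⟨i, h⟩) else 0) n := by
    intro n
    induction n with
    | zero => exact continuous_const
    | succ n ih =>
      refine Continuous.matrix_mul ?_ ih
      by_cases h : n < N
      · simp only [h, dif_pos]
        exact continuous_apply (⟨n, h⟩ : Fin N)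
      · simp only [h, dif_neg, not_false_eq_true]
        exact continuous_const
  exact this N

lemma continuous_sqDist {a b : ℕ} (B : Matrix (Fin a) (Fin b) ℝ) : Continuous (sqDist B) := by
  unfold sqDist
  fun_prop

lemma netProd_cons (n : ℕ) (d : ℕ → ℕ) (A : Fin (d 1) → Fin (d 0) → ℝ)
    (y : ∀ i : Fin n, Fin (d ((i : ℕ) + 1 + 1)) → Fin (d ((i : ℕ) + 1)) → ℝ) :
    netProd (n + 1) d (Fin.cons (α := fun i : Fin (n + 1) =>
      Fin (d ((i : ℕ) + 1)) → Fin (d (i : ℕ)) → ℝ) A y) =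
      netProd n (fun i => d (i + 1)) y * Matrix.of A := by
  rw [netProd, matProd_succ_right, netProd]
  congr 1
  refine matProd_congr fun i hi => ?_
  rw [dif_pos hi, dif_pos (by omega)]
  rfl

lemma isAddHaarMeasure_volume_pi_pi (a b : ℕ) :
    (volume : Measure (Fin a → Fin b → ℝ)).IsAddHaarMeasure :=
  have : (volume : Measure (Fin b → ℝ)).IsAddHaarMeasure := inferInstance
  Measure.pi.isAddHaarMeasure fun _ => (volume : Measure (Fin b → ℝ))

lemma exists_lintegral_netProd_le (n : ℕ) (d : ℕ → ℕ) {R : ℝ} (hR : 1 ≤ R) :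
    ∃ c : ENNReal, c ≠ ⊤ ∧ ∀ Φ : Matrix (Fin (d n)) (Fin (d 0)) ℝ → ENNReal,
      ∫⁻ x in closedBall 0 R, Φ (netProd n d x) ≤ c * layerIntegral R n d Φ := by
  induction n generalizing d with
  | zero =>
    refine ⟨volume (closedBall (0 : ∀ i : Fin 0, Fin (d ((i : ℕ) + 1)) → Fin (d (i : ℕ)) → ℝ) R),
      (isCompact_closedBall _ _).measure_lt_top.ne, fun Φ => ?_⟩
    simp only [netProd, matProd, setLIntegral_const]
    rw [mul_comm]
    exact mul_le_mul_right (le_iSup (fun g : {g : Matrix (Fin (d 0)) (Fin (d 0)) ℝ //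
      IsBddInv R g} => Φ g.1) ⟨1, IsBddInv.one.mono hR⟩) _
  | succ n ih =>
    obtain ⟨c, hc, h⟩ := ih fun i => d (i + 1)
    obtain ⟨c', hc', h'⟩ := @exists_lintegral_closedBall_finCons_le n
      (fun i : Fin (n + 1) => Fin (d ((i : ℕ) + 1)) → Fin (d (i : ℕ)) → ℝ) _ _ _ _ _
      fun i => isAddHaarMeasure_volume_pi_pi _ _
    refine ⟨c' * c, ENNReal.mul_ne_top hc' hc, fun Φ => (h' R _).trans ?_⟩
    rw [mul_assoc]
    refine mul_le_mul_right ?_ _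
    rw [layerIntegral, ← lintegral_const_mul' _ _ hc]
    refine lintegral_mono fun A => ?_
    refine (lintegral_mono fun y => le_of_eq ?_).trans
      (h fun Q => Φ (Q * (Matrix.of A : Matrix (Fin (d 1)) (Fin (d 0)) ℝ)))
    exact congrArg Φ (netProd_cons n d A y)

lemma IsBddInv.symm {m : ℕ} {K : ℝ} {g g' : Matrix (Fin m) (Fin m) ℝ} (h : IsBddInv K g)
    (hg : g * g' = 1) : IsBddInv K g' := by
  obtain ⟨g'', h1, h2, h3, h4⟩ := h
  obtain rfl : g'' = g' := by
    rw [← Matrix.mul_one g'', ← hg, ← Matrix.mul_assoc, h2, Matrix.one_mul]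
  exact ⟨g, h2, h1, h4, h3⟩

lemma IsBddInv.transpose {m : ℕ} {K : ℝ} {g : Matrix (Fin m) (Fin m) ℝ} (h : IsBddInv K g) :
    IsBddInv K gᵀ := by
  obtain ⟨g', h1, h2, h3, h4⟩ := h
  exact ⟨g'ᵀ, by rw [← transpose_mul, h2, transpose_one],
    by rw [← transpose_mul, h1, transpose_one], fun i j => h3 j i, fun i j => h4 j i⟩

/-- Multiplying every layer on both sides by boundedly invertible matrices is a bounded change of
variables. -/
lemma exists_equiv_scale (N : ℕ) (d : ℕ → ℕ) {K : ℝ} (hK : 0 ≤ K) : ∃ K' : ℝ, 0 ≤ K' ∧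
    ∀ γ δ : ∀ i : ℕ, Matrix (Fin (d i)) (Fin (d i)) ℝ, (∀ i, IsBddInv K (γ i)) →
      (∀ i, IsBddInv K (δ i)) →
    ∃ L : (∀ i : Fin N, Fin (d ((i : ℕ) + 1)) → Fin (d (i : ℕ)) → ℝ) ≃ₗ[ℝ]
        (∀ i : Fin N, Fin (d ((i : ℕ) + 1)) → Fin (d (i : ℕ)) → ℝ),
      (∀ x i, Matrix.of (L x i) = γ (i + 1) * Matrix.of (x i) * δ i) ∧
      (∀ x, ‖L x‖ ≤ K' * ‖x‖) ∧ ∀ x, ‖L.symm x‖ ≤ K' * ‖x‖ := by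
  set D : ℝ := ∑ i : Fin N, ((d (i + 1) : ℝ) + d i) with hD
  have hD1 : ∀ i : Fin N, (d (i + 1) : ℝ) + d i ≤ D := fun i =>
    Finset.single_le_sum (f := fun i : Fin N => (d (i + 1) : ℝ) + d i)
      (fun i _ => by positivity) (Finset.mem_univ i)
  have hD0 : 0 ≤ D := Finset.sum_nonneg fun i _ => by positivity
  refine ⟨D * (D * K * K), by positivity, fun γ δ hγ hδ => ?_⟩
  choose γ' hγ1 hγ2 hγ3 hγ4 using hγ
  choose δ' hδ1 hδ2 hδ3 hδ4 using hδ
  have key : ∀ (i : Fin N) (g : Matrix (Fin (d (i + 1))) (Fin (d (i + 1))) ℝ)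
      (h : Matrix (Fin (d i)) (Fin (d i)) ℝ) (A C : Fin (d (i + 1)) → Fin (d i) → ℝ),
      (∀ a b, |g a b| ≤ K) → (∀ a b, |h a b| ≤ K) → Matrix.of C = g * Matrix.of A * h →
      ‖C‖ ≤ D * (D * K * K) * ‖A‖ := by
    intro i g h A C hg hh hC
    refine pi_norm_le_of_abs_le (by positivity) fun a b => ?_
    have h1 := Matrix.abs_mul_apply_le (Matrix.abs_mul_apply_le hg
      (fun a b => pi_norm_apply_le A a b) hK) hh (by positivity) a b
    rw [Fintype.card_fin, Fintype.card_fin] at h1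
    have h2 : C a b = (g * Matrix.of A * h) a b := by rw [← hC, Matrix.of_apply]
    rw [h2]
    refine h1.trans ?_
    have h3 : (d (i + 1) : ℝ) ≤ D := le_trans (by simp) (hD1 i)
    have h4 : (d i : ℝ) ≤ D := le_trans (by simp) (hD1 i)
    calc (d i : ℝ) * (d (i + 1) * (K * ‖A‖) * K) ≤ D * (D * (K * ‖A‖) * K) := by gcongr
      _ = _ := by ring
  let e : ∀ i : Fin N, Matrix (Fin (d (i + 1))) (Fin (d i)) ℝ ≃ₗ[ℝ]
      Matrix (Fin (d (i + 1))) (Fin (d i)) ℝ := fun i =>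
    { toFun := fun A => γ (i + 1) * A * δ i
      invFun := fun A => γ' (i + 1) * A * δ' i
      map_add' := fun A B => by rw [Matrix.mul_add, Matrix.add_mul]
      map_smul' := fun c A => by rw [Matrix.mul_smul, Matrix.smul_mul]; rfl
      left_inv := fun A => by
        simp only [Matrix.mul_assoc, hδ1, Matrix.mul_one]
        rw [← Matrix.mul_assoc, hγ2, Matrix.one_mul]
      right_inv := fun A => by
        simp only [Matrix.mul_assoc, hδ2, Matrix.mul_one]
        rw [← Matrix.mul_assoc, hγ1, Matrix.one_mul] }
  let L : (∀ i : Fin N, Fin (d ((i : ℕ) + 1)) → Fin (d (i : ℕ)) → ℝ) ≃ₗ[ℝ]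
      (∀ i : Fin N, Fin (d ((i : ℕ) + 1)) → Fin (d (i : ℕ)) → ℝ) :=
    LinearEquiv.piCongrRight e
  refine ⟨L, fun x i => rfl, fun x => ?_, fun x => ?_⟩
  · refine (pi_norm_le_iff_of_nonneg (by positivity)).2 fun i => ?_
    refine (key i _ _ (x i) _ (hγ3 _) (hδ3 _) rfl).trans ?_
    exact mul_le_mul_of_nonneg_left (norm_le_pi_norm x i) (by positivity)
  · refine (pi_norm_le_iff_of_nonneg (by positivity)).2 fun i => ?_
    refine (key i _ _ (x i) _ (hγ4 _) (hδ4 _) rfl).trans ?_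
    exact mul_le_mul_of_nonneg_left (norm_le_pi_norm x i) (by positivity)

/-- Multiplication of the end-to-end matrix on both sides lifts to a bounded change of variables. -/
lemma exists_equiv_netProd {N : ℕ} (hN : 1 ≤ N) (d : ℕ → ℕ) {K : ℝ} (hK : 1 ≤ K) :
    ∃ K' : ℝ, 0 ≤ K' ∧ ∀ (g : Matrix (Fin (d N)) (Fin (d N)) ℝ)
      (h : Matrix (Fin (d 0)) (Fin (d 0)) ℝ), IsBddInv K g → IsBddInv K h →
    ∃ L : (∀ i : Fin N, Fin (d ((i : ℕ) + 1)) → Fin (d (i : ℕ)) → ℝ) ≃ₗ[ℝ]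
        (∀ i : Fin N, Fin (d ((i : ℕ) + 1)) → Fin (d (i : ℕ)) → ℝ),
      (∀ x, netProd N d (L x) = g * netProd N d x * h) ∧
      (∀ x, ‖L x‖ ≤ K' * ‖x‖) ∧ ∀ x, ‖L.symm x‖ ≤ K' * ‖x‖ := by
  obtain ⟨n, rfl⟩ : ∃ n, N = n + 1 := ⟨N - 1, by omega⟩
  obtain ⟨K', hK', hsc⟩ := exists_equiv_scale (n + 1) d (K := K) (by linarith)
  refine ⟨K', hK', fun g h hg hh => ?_⟩
  set γ : ∀ i : ℕ, Matrix (Fin (d i)) (Fin (d i)) ℝ := Function.update (fun _ => 1) (n + 1) g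
    with hγ
  set δ : ∀ i : ℕ, Matrix (Fin (d i)) (Fin (d i)) ℝ := Function.update (fun _ => 1) 0 h with hδ
  have hγn : γ (n + 1) = g := Function.update_self _ _ _
  have hδ0 : δ 0 = h := Function.update_self _ _ _
  have hγ1 : ∀ i, i ≠ n + 1 → γ i = 1 := fun i hi => Function.update_of_ne hi _ _
  have hδ1 : ∀ i, i ≠ 0 → δ i = 1 := fun i hi => Function.update_of_ne hi _ _
  obtain ⟨L, hL, hL1, hL2⟩ := hsc γ δ
    (fun i => by
      rcases eq_or_ne i (n + 1) with rfl | hi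
      · rwa [hγn]
      · rw [hγ1 i hi]
        exact IsBddInv.one.mono hK)
    (fun i => by
      rcases eq_or_ne i 0 with rfl | hi
      · rwa [hδ0]
      · rw [hδ1 i hi]
        exact IsBddInv.one.mono hK)
  refine ⟨L, fun x => ?_, hL1, hL2⟩
  rw [netProd, netProd, matProd_scale (γ := γ) (δ := δ)
    (A := fun i => if h : i < n + 1 then Matrix.of (x ⟨i, h⟩) else 0), hγn, hδ0]
  · intro i hi
    rw [dif_pos hi, dif_pos hi]
    exact hL x ⟨i, hi⟩
  · intro i hi
    rw [hγ1 _ (by omega), hδ1 _ (by omega), Matrix.one_mul]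

end NetworkProduct

section Averaging

open MeasureTheory Metric Matrix Topology

lemma exists_isBddInv_of_near_one (m : ℕ) : ∃ η : ℝ, 0 < η ∧ ∀ M : Matrix (Fin m) (Fin m) ℝ,
    (∀ i j, |(M - 1) i j| ≤ η) → IsBddInv 2 M := by
  set I : Fin m → Fin m → ℝ := fun i j => (1 : Matrix (Fin m) (Fin m) ℝ) i j with hI
  have hI1 : Matrix.of I = 1 := rfl
  have hdet : Continuous fun A : Fin m → Fin m → ℝ => (Matrix.of A).det :=
    Continuous.matrix_det continuous_id
  have hadj : Continuous fun A : Fin m → Fin m → ℝ => (Matrix.of A).adjugate :=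
    Continuous.matrix_adjugate continuous_id
  have h0 : ∀ᶠ A in 𝓝 I, (Matrix.of A).det ≠ 0 := by
    refine hdet.continuousAt.eventually_ne ?_
    rw [hI1, det_one]
    exact one_ne_zero
  have h1 : ∀ i j, ∀ᶠ A in 𝓝 I, |A i j| < 2 := fun i j => by
    have : Continuous fun A : Fin m → Fin m → ℝ => |A i j| := by fun_prop
    refine this.continuousAt.eventually_lt continuousAt_const ?_
    exact (Matrix.abs_one_apply_le i j).trans_lt one_lt_two
  have h2 : ∀ i j, ∀ᶠ A in 𝓝 I, |(Matrix.of A)⁻¹ i j| < 2 := fun i j => by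
    have : ContinuousAt (fun A : Fin m → Fin m → ℝ => |(Matrix.of A)⁻¹ i j|) I := by
      simp only [Matrix.inv_def, Ring.inverse_eq_inv', Matrix.smul_apply]
      refine (ContinuousAt.smul (hdet.continuousAt.inv₀ ?_) ?_).abs
      · rw [hI1, det_one]
        exact one_ne_zero
      · exact (hadj.matrix_elem i j).continuousAt
    refine this.eventually_lt continuousAt_const ?_
    rw [hI1, inv_one]
    exact (Matrix.abs_one_apply_le i j).trans_lt one_lt_two
  have h3 := h0.and ((Filter.eventually_all.2 fun i => Filter.eventually_all.2 (h1 i)).and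
    (Filter.eventually_all.2 fun i => Filter.eventually_all.2 (h2 i)))
  obtain ⟨η, hη, h⟩ := (Metric.nhds_basis_closedBall.eventually_iff).1 h3
  refine ⟨η, hη, fun M hM => ?_⟩
  have hMb : (fun i j => M i j) ∈ closedBall I η := by
    rw [mem_closedBall, dist_eq_norm]
    exact pi_norm_le_of_abs_le hη.le fun i j => hM i j
  obtain ⟨k1, k2, k3⟩ := h hMb
  have hu : IsUnit M.det := isUnit_iff_ne_zero.2 k1
  exact ⟨M⁻¹, Matrix.mul_nonsing_inv _ hu, Matrix.nonsing_inv_mul _ hu, fun i j => (k2 i j).le,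
    fun i j => (k3 i j).le⟩

lemma exists_lintegral_prod_abs_rpow_neg_le {t : ℝ} (ht0 : 0 < t) (ht1 : t < 1) (n r : ℕ) {K η : ℝ}
    (hK : 0 ≤ K) (hη : 0 ≤ η) : ∃ K' : ENNReal, K' ≠ ⊤ ∧ ∀ M : Matrix (Fin r) (Fin r) ℝ,
    IsBddInv K M → ∀ C : Matrix (Fin n) (Fin r) ℝ,
      ∫⁻ w : Fin n → Fin r → ℝ in closedBall 0 η,
        ∏ i, ∏ j, ENNReal.ofReal |(Matrix.of w * M + C) i j| ^ (-t) ≤ K' := by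
  obtain ⟨K₁, hK₁, h1⟩ := exists_lintegral_abs_rpow_neg_le ht0 ht1 (r * K * η)
  have : (volume : Measure (Fin n → Fin r → ℝ)).IsAddHaarMeasure :=
    isAddHaarMeasure_volume_pi_pi n r
  obtain ⟨c, hc, h2⟩ := exists_lintegral_closedBall_comp_le
    (volume : Measure (Fin n → Fin r → ℝ)) (volume : Measure (Fin n → Fin r → ℝ))
    (K := r * K) (by positivity)
  refine ⟨c * (K₁ ^ r) ^ n, ENNReal.mul_ne_top hc (by finiteness), fun M hM C => ?_⟩
  obtain ⟨L, hL, hL1, hL2⟩ := hM.exists_equiv_mul_right (a := n) hK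
  have h3 := h2 L hL1 hL2 η fun w =>
    ∏ i, ∏ j, ENNReal.ofReal |w i j + C i j| ^ (-t)
  have h4 : ∀ w i j, (Matrix.of w * M + C) i j = L w i j + C i j := fun w i j => by
    rw [← hL]
    rfl
  simp only [h4]
  refine h3.trans (mul_le_mul_right ?_ _)
  have hR : 0 ≤ r * K * η := by positivity
  have hm : ∀ (i : Fin n) (j : Fin r),
      Measurable fun x : ℝ => ENNReal.ofReal |x + C i j| ^ (-t) := fun i j => by
    fun_prop
  refine lintegral_closedBall_pi_prod_le hR
    (fun i (x : Fin r → ℝ) => ∏ j, ENNReal.ofReal |x j + C i j| ^ (-t)) (fun i => ?_) fun i => ?_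
  · refine Finset.measurable_fun_prod _ fun j _ => ?_
    simpa only [Function.comp_def] using (hm i j).comp (measurable_pi_apply j)
  · exact lintegral_closedBall_pi_prod_le hR (fun j x => ENNReal.ofReal |x + C i j| ^ (-t)) (hm i)
      fun j => h1 _

/-- A matrix of rank `r` is inverted, on the left, along a complement of its kernel. -/
lemma exists_kernel_splitting {q m : ℕ} (B : Matrix (Fin q) (Fin m) ℝ) {k : ℕ}
    (hk : m = B.rank + k) : ∃ (ℓ : Matrix (Fin B.rank) (Fin q) ℝ) (c : Matrix (Fin m) (Fin B.rank) ℝ)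
      (c' : Matrix (Fin m) (Fin k) ℝ) (e : Matrix (Fin B.rank) (Fin m) ℝ)
      (e' : Matrix (Fin k) (Fin m) ℝ),
      ℓ * (B * c) = 1 ∧ B * c' = 0 ∧ e * c = 1 ∧ e * c' = 0 ∧ e' * c = 0 ∧ e' * c' = 1 ∧
        c * e + c' * e' = 1 := by
  obtain ⟨W, hW⟩ := (LinearMap.ker B.mulVecLin).exists_isCompl
  have hrank : Module.finrank ℝ (LinearMap.range B.mulVecLin) = B.rank := rfl
  have hker : Module.finrank ℝ (LinearMap.ker B.mulVecLin) = k := by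
    have := LinearMap.finrank_range_add_finrank_ker B.mulVecLin
    rw [hrank, Module.finrank_fin_fun] at this
    omega
  have hWr : Module.finrank ℝ W = B.rank := by
    have := Submodule.finrank_add_eq_of_isCompl hW
    rw [hker, Module.finrank_fin_fun] at this
    omega
  let bK := Module.finBasisOfFinrankEq ℝ _ hker
  let bW := Module.finBasisOfFinrankEq ℝ _ hWr
  let b : Module.Basis (Fin B.rank ⊕ Fin k) ℝ (Fin m → ℝ) :=
    (bW.prod bK).map (Submodule.prodEquivOfIsCompl _ _ hW.symm)
  have hbr : ∀ j, b (Sum.inr j) = bK j := fun j => by simp [b]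
  have hbl : ∀ j, b (Sum.inl j) = bW j := fun j => by simp [b]
  set c : Matrix (Fin m) (Fin B.rank) ℝ := Matrix.of fun i j => b (Sum.inl j) i with hc
  set c' : Matrix (Fin m) (Fin k) ℝ := Matrix.of fun i j => b (Sum.inr j) i with hc'
  set e : Matrix (Fin B.rank) (Fin m) ℝ :=
    Matrix.of fun i j => b.repr (Pi.single j 1) (Sum.inl i) with he
  set e' : Matrix (Fin k) (Fin m) ℝ :=
    Matrix.of fun i j => b.repr (Pi.single j 1) (Sum.inr i) with he'
  have hsum : ∀ (x : Fin m → ℝ) (s : Fin B.rank ⊕ Fin k),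
      ∑ l, b.repr (Pi.single l 1) s * x l = b.repr x s := by
    intro x s
    conv_rhs => rw [pi_eq_sum_univ' x]
    simp [Finsupp.finsetSum_apply, mul_comm]
  have hBc : Function.Injective (B * c).mulVecLin := by
    rw [← LinearMap.ker_eq_bot, LinearMap.ker_eq_bot']
    intro x hx
    rw [mulVecLin_apply, ← mulVec_mulVec] at hx
    have h1 : c *ᵥ x = ((∑ j, x j • bW j : W) : Fin m → ℝ) := by
      funext i
      simp [Matrix.mulVec, dotProduct, hc, hbl, mul_comm]
    have h2 : c *ᵥ x ∈ (LinearMap.ker B.mulVecLin) ⊓ W :=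
      ⟨hx, h1 ▸ Submodule.coe_mem _⟩
    rw [hW.inf_eq_bot, Submodule.mem_bot, h1, Submodule.coe_eq_zero] at h2
    funext j
    exact (Fintype.linearIndependent_iff.1 bW.linearIndependent) x h2 j
  obtain ⟨f, hf⟩ := LinearMap.exists_leftInverse_of_injective _ (LinearMap.ker_eq_bot.2 hBc)
  refine ⟨LinearMap.toMatrix' f, c, c', e, e', ?_, ?_, ?_, ?_, ?_, ?_, ?_⟩
  · have : (B * c).mulVecLin = Matrix.toLin' (B * c) := rfl
    rw [this] at hf
    have h1 := congrArg LinearMap.toMatrix' hf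
    rwa [LinearMap.toMatrix'_comp, LinearMap.toMatrix'_toLin', LinearMap.toMatrix'_id] at h1
  · ext i j
    have h1 : B *ᵥ (bK j : Fin m → ℝ) = 0 := (bK j).2
    have h2 := congrFun h1 i
    rw [← hbr] at h2
    exact h2
  · ext i j
    simp only [Matrix.mul_apply, he, hc, Matrix.of_apply, hsum, Module.Basis.repr_self]
    simp [Finsupp.single_apply, Matrix.one_apply, eq_comm]
  · ext i j
    simp only [Matrix.mul_apply, he, hc', Matrix.of_apply, hsum, Module.Basis.repr_self]
    simp
  · ext i j
    simp only [Matrix.mul_apply, he', hc, Matrix.of_apply, hsum, Module.Basis.repr_self]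
    simp
  · ext i j
    simp only [Matrix.mul_apply, he', hc', Matrix.of_apply, hsum, Module.Basis.repr_self]
    simp [Finsupp.single_apply, Matrix.one_apply, eq_comm]
  · ext i j
    have h1 := congrFun (b.sum_repr (Pi.single j 1)) i
    rw [Fintype.sum_sum_type] at h1
    simp only [Matrix.add_apply, Matrix.mul_apply, he, he', hc, hc', Matrix.of_apply]
    rw [Matrix.one_apply, ← Pi.single_apply, ← h1]
    simp [mul_comm]

/-- The reciprocal power of the squared distance to `B`, truncated away from `B`. -/
noncomputable def truncPow {q m : ℕ} (B : Matrix (Fin q) (Fin m) ℝ) (s ρ : ℝ)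
    (Q : Matrix (Fin q) (Fin m) ℝ) : ENNReal :=
  if sqDist B Q ≤ ρ then ENNReal.ofReal (sqDist B Q) ^ (-s) else 0

lemma measurable_truncPow_comp {q m : ℕ} {E : Type*} [TopologicalSpace E] [MeasurableSpace E]
    [OpensMeasurableSpace E] (B : Matrix (Fin q) (Fin m) ℝ) (s ρ : ℝ)
    {f : E → Matrix (Fin q) (Fin m) ℝ} (hf : Continuous f) :
    Measurable fun x => truncPow B s ρ (f x) := by
  have h1 : Measurable fun x => sqDist B (f x) := ((continuous_sqDist B).comp hf).measurable
  have h2 : Measurable fun y : ℝ => ENNReal.ofReal y ^ (-s) := by fun_prop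
  refine Measurable.ite (measurableSet_le h1 measurable_const) ?_ measurable_const
  simpa only [Function.comp_def] using h2.comp h1

lemma exists_abs_apply_le {a b : ℕ} (A : Matrix (Fin a) (Fin b) ℝ) :
    ∃ K : ℝ, 0 ≤ K ∧ ∀ i j, |A i j| ≤ K :=
  ⟨‖fun i j => A i j‖, norm_nonneg _, fun i j => pi_norm_apply_le (fun i j => A i j) i j⟩

lemma rpow_neg_le_prod {n k : ℕ} {t K φ : ℝ} (ht : 0 ≤ t) (hK : 0 < K)
    {E : Matrix (Fin n) (Fin k) ℝ} (hE : ∀ i j, |E i j| ≤ K * φ) :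
    ENNReal.ofReal φ ^ (-(t * (n * k : ℕ))) ≤ (ENNReal.ofReal K ^ t) ^ (n * k) *
      ∏ i, ∏ j, ENNReal.ofReal |E i j| ^ (-t) := by
  have h1 : ∀ i j, ENNReal.ofReal φ ^ (-t) ≤
      ENNReal.ofReal K ^ t * ENNReal.ofReal |E i j| ^ (-t) := fun i j =>
    ENNReal.ofReal_rpow_neg_le ht hK (hE i j)
  have h2 := Finset.prod_le_prod' fun i (_ : i ∈ Finset.univ) =>
    Finset.prod_le_prod' fun j (_ : j ∈ Finset.univ) => h1 i j
  simp only [Finset.prod_const, Finset.card_univ, Fintype.card_fin, Finset.prod_mul_distrib] at h2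
  rw [← pow_mul, ← pow_mul, mul_comm k n] at h2
  rwa [← neg_mul, ENNReal.rpow_mul, ENNReal.rpow_natCast]

lemma quotSeminorm_le_norm {q : ℕ} (E : Submodule ℝ (Fin q → ℝ)) (x : Fin q → ℝ) :
    quotSeminorm E x ≤ ‖x‖ :=
  Submodule.Quotient.norm_mk_le E x

lemma quotSeminorm_add_of_mem {q : ℕ} {E : Submodule ℝ (Fin q → ℝ)} (x : Fin q → ℝ)
    {y : Fin q → ℝ} (hy : y ∈ E) : quotSeminorm E (x + y) = quotSeminorm E x := by
  change ‖E.mkQ (x + y)‖ = ‖E.mkQ x‖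
  rw [map_add, Submodule.mkQ_apply E y, (Submodule.Quotient.mk_eq_zero E).2 hy, add_zero]

lemma rpow_neg_le_supPow {q m r : ℕ} {z φ : ℝ} (hz : 0 ≤ z) {B D P : Matrix (Fin q) (Fin m) ℝ}
    (hr : B.rank ≤ r) {g : Matrix (Fin q) (Fin q) ℝ} {h : Matrix (Fin m) (Fin m) ℝ}
    (hg : IsBddInv 2 g) (hh : IsBddInv 2 h) (hP : g * P * h = D + B) (hφ : 0 ≤ φ)
    (hD : ∀ i j, |D i j| ≤ φ) :
    ENNReal.ofReal φ ^ (-z) ≤ ENNReal.ofReal (m * (m * (q * 2 * 2)) + 1) ^ z *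
      supPow r z (basisWeight fun _ => 1) P := by
  obtain ⟨g', g1, g2, g3, g4⟩ := hg
  obtain ⟨h', h1, h2, h3, h4⟩ := hh
  have hP' : P = g' * D * h' + g' * B * h' := by
    rw [← Matrix.add_mul, ← Matrix.mul_add, ← hP]
    simp only [Matrix.mul_assoc, h1, Matrix.mul_one]
    rw [← Matrix.mul_assoc, g2, Matrix.one_mul]
  set E := LinearMap.range (g' * B * h').mulVecLin with hE
  have hEr : Module.finrank ℝ E ≤ r :=
    ((Matrix.rank_mul_le_left (g' * B) h').trans (Matrix.rank_mul_le_right g' B)).trans hr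
  refine (ENNReal.ofReal_rpow_neg_le
    (b := basisWeight (fun _ => 1) ((quotSeminorm E).comp P.mulVecLin)) hz (by positivity) ?_).trans
    (mul_le_mul_right (le_iSup (fun E : {E : Submodule ℝ (Fin q → ℝ) // Module.finrank ℝ E ≤ r} =>
      ENNReal.ofReal (basisWeight (fun _ => 1) ((quotSeminorm E.1).comp P.mulVecLin)) ^ (-z))
        ⟨E, hEr⟩) _)
  have hcol : ∀ j, quotSeminorm E (P *ᵥ Pi.single j 1) ≤ m * (q * 2 * 2) * φ := by
    intro j
    rw [hP', Matrix.add_mulVec, quotSeminorm_add_of_mem _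
      (show (g' * B * h') *ᵥ Pi.single j 1 ∈ E from LinearMap.mem_range_self _ _)]
    refine (quotSeminorm_le_norm _ _).trans ((pi_norm_le_iff_of_nonneg (by positivity)).2 fun i => ?_)
    rw [Matrix.mulVec_single_one, Real.norm_eq_abs]
    have := Matrix.abs_mul_apply_le (Matrix.abs_mul_apply_le g4 hD (by norm_num)) h4
      (by positivity) i j
    rw [Fintype.card_fin, Fintype.card_fin] at this
    refine this.trans (le_of_eq ?_)
    ring
  calc basisWeight (fun _ => 1) ((quotSeminorm E).comp P.mulVecLin)
      = ∑ j, quotSeminorm E (P *ᵥ Pi.single j 1) := by simp [basisWeight]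
    _ ≤ ∑ _j : Fin m, m * (q * 2 * 2) * φ := Finset.sum_le_sum fun j _ => hcol j
    _ = m * (m * (q * 2 * 2)) * φ := by simp; ring
    _ ≤ _ := by nlinarith

/-- Near `B`, the reciprocal power of the distance to `B` is controlled by the entries of the
columns `P c`, of the rows `ℓ P c'`, and by the distance of `P` to the matrices of small rank. -/
lemma exists_truncPow_le {q m r k C : ℕ} {B : Matrix (Fin q) (Fin m) ℝ} (hr : B.rank ≤ r)
    {ℓ : Matrix (Fin r) (Fin q) ℝ} {c : Matrix (Fin m) (Fin r) ℝ} {c' : Matrix (Fin m) (Fin k) ℝ}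
    {e' : Matrix (Fin k) (Fin m) ℝ} (hℓ : ℓ * (B * c) = 1) (hc' : B * c' = 0) (he : e' * c = 0)
    (he' : e' * c' = 1) {s t : ℝ} (ht : 0 ≤ t)
    (hs : 2 * s = t * (q * r : ℕ) + t * (k * r : ℕ) + t * C) :
    ∃ (ρ K : ℝ) (K' : ENNReal), 0 < ρ ∧ 0 ≤ K ∧ K' ≠ ⊤ ∧
      ∀ (w : Matrix (Fin q) (Fin r) ℝ) (u : Matrix (Fin r) (Fin k) ℝ) (P : Matrix (Fin q) (Fin m) ℝ),
      IsBddInv 2 (1 + w * ℓ) → IsBddInv 2 (1 + ℓ * w) → IsBddInv 2 (1 + c * u * e') →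
      truncPow B s ρ ((1 + w * ℓ) * P * (1 + c * u * e')) ≠ 0 →
      IsBddInv K (ℓ * P * c) ∧ IsBddInv 2 (ℓ * ((1 + w * ℓ) * P) * c) ∧
      truncPow B s ρ ((1 + w * ℓ) * P * (1 + c * u * e')) ≤
        K' * ((∏ i, ∏ j, ENNReal.ofReal |(w * (ℓ * P * c) + (P * c - B * c)) i j| ^ (-t)) *
        (∏ i, ∏ j, ENNReal.ofReal |(uᵀ * (ℓ * ((1 + w * ℓ) * P) * c)ᵀ +
          (ℓ * ((1 + w * ℓ) * P) * c')ᵀ : Matrix (Fin k) (Fin r) ℝ) i j| ^ (-t)) *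
        supPow r (t * C) (basisWeight fun _ => 1) P) := by
  obtain ⟨Kℓ, hKℓ, hbℓ⟩ := exists_abs_apply_le ℓ
  obtain ⟨Kc, hKc, hbc⟩ := exists_abs_apply_le c
  obtain ⟨Kc', hKc', hbc'⟩ := exists_abs_apply_le c'
  obtain ⟨η, hη, hnear⟩ := exists_isBddInv_of_near_one r
  set K₁ : ℝ := m * Kc + 1 with hK₁
  set K₂ : ℝ := m * (q * Kℓ * Kc') + 1 with hK₂
  set K₃ : ℝ := m * (q * Kℓ * Kc) + 1 with hK₃
  have hK₁0 : 0 < K₁ := by positivity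
  have hK₂0 : 0 < K₂ := by positivity
  have hK₃0 : 0 < K₃ := by positivity
  refine ⟨(η / K₃) ^ 2, r * (2 * 2), (ENNReal.ofReal K₁ ^ t) ^ (q * r) *
    (ENNReal.ofReal K₂ ^ t) ^ (k * r) *
    ENNReal.ofReal (m * (m * (q * 2 * 2)) + 1) ^ (t * C), by positivity, by positivity,
    ENNReal.mul_ne_top (ENNReal.mul_ne_top
      (ENNReal.pow_ne_top (ENNReal.rpow_ne_top_of_nonneg ht ENNReal.ofReal_ne_top))
      (ENNReal.pow_ne_top (ENNReal.rpow_ne_top_of_nonneg ht ENNReal.ofReal_ne_top)))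
      (ENNReal.rpow_ne_top_of_nonneg (by positivity) ENNReal.ofReal_ne_top), fun w u P hg hw hh hne => ?_⟩
  set g := 1 + w * ℓ with hgd
  set h := 1 + c * u * e' with hhd
  set D := g * P * h - B with hDd
  set φ := √(sqDist B (g * P * h)) with hφ
  have hφ0 : 0 ≤ φ := Real.sqrt_nonneg _
  have hD : ∀ i j, |D i j| ≤ φ := abs_sub_le_sqrt_sqDist B (g * P * h)
  have hle : sqDist B (g * P * h) ≤ (η / K₃) ^ 2 := by
    by_contra hcon
    exact hne (if_neg hcon)
  have hφη : K₃ * φ ≤ η := by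
    have : φ ≤ η / K₃ := Real.sqrt_le_iff.2 ⟨by positivity, hle⟩
    rwa [le_div_iff₀' hK₃0] at this
  have hhc : h * c = c := by
    rw [hhd, Matrix.add_mul, Matrix.one_mul, Matrix.mul_assoc, he, Matrix.mul_zero, add_zero]
  have hhc' : h * c' = c' + c * u := by
    rw [hhd, Matrix.add_mul, Matrix.one_mul, Matrix.mul_assoc, he', Matrix.mul_one]
  have hDc : D * c = w * (ℓ * P * c) + (P * c - B * c) := by
    rw [hDd, Matrix.sub_mul, Matrix.mul_assoc, hhc, hgd]
    simp only [Matrix.add_mul, Matrix.one_mul, Matrix.mul_assoc]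
    abel
  have hDc' : ℓ * D * c' = ℓ * (g * P) * c * u + ℓ * (g * P) * c' := by
    rw [hDd, Matrix.mul_sub, Matrix.sub_mul, Matrix.mul_assoc ℓ B, hc', Matrix.mul_zero, sub_zero,
      Matrix.mul_assoc ℓ, Matrix.mul_assoc (g * P) h, hhc', Matrix.mul_add, Matrix.mul_add]
    simp only [Matrix.mul_assoc]
    abel
  have hM2 : ℓ * (g * P) * c - 1 = ℓ * D * c := by
    rw [hDd, Matrix.mul_sub, Matrix.sub_mul, Matrix.mul_assoc ℓ B, hℓ, Matrix.mul_assoc ℓ (g * P * h),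
      Matrix.mul_assoc (g * P) h, hhc]
    simp only [Matrix.mul_assoc]
  have hM2b : IsBddInv 2 (ℓ * (g * P) * c) := by
    refine hnear _ fun i j => ?_
    rw [hM2]
    refine (Matrix.abs_mul_apply_le (Matrix.abs_mul_apply_le hbℓ hD hKℓ) hbc (by positivity)
      i j).trans (le_trans ?_ hφη)
    rw [Fintype.card_fin, Fintype.card_fin, hK₃]
    nlinarith
  refine ⟨?_, hM2b, ?_⟩
  · obtain ⟨w', w1, w2, -⟩ := id hw
    have h1 : ℓ * P * c = w' * (ℓ * (g * P) * c) := by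
      have : ℓ * (g * P) * c = (1 + ℓ * w) * (ℓ * P * c) := by
        rw [hgd]
        simp only [Matrix.add_mul, Matrix.mul_add, Matrix.one_mul, Matrix.mul_assoc]
      rw [this, ← Matrix.mul_assoc, w2, Matrix.one_mul]
    rw [h1]
    exact (hw.symm w1).mul (by norm_num) (by norm_num) hM2b
  · have e1 := rpow_neg_le_prod (φ := φ) (E := w * (ℓ * P * c) + (P * c - B * c)) ht hK₁0
      fun i j => by
        rw [← hDc]
        refine (Matrix.abs_mul_apply_le hD hbc hφ0 i j).trans ?_
        rw [Fintype.card_fin, hK₁]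
        nlinarith
    have e2 := rpow_neg_le_prod (φ := φ) (E := uᵀ * (ℓ * (g * P) * c)ᵀ + (ℓ * (g * P) * c')ᵀ) ht hK₂0
      fun i j => by
        rw [← Matrix.transpose_mul, ← Matrix.transpose_add, ← hDc', Matrix.transpose_apply]
        refine (Matrix.abs_mul_apply_le (Matrix.abs_mul_apply_le hbℓ hD hKℓ) hbc' (by positivity)
          j i).trans ?_
        rw [Fintype.card_fin, Fintype.card_fin, hK₂]
        nlinarith
    have e3 := rpow_neg_le_supPow (z := t * C) (φ := φ) (by positivity) hr hg hh
      (sub_add_cancel (g * P * h) B).symm hφ0 hD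
    have e4 : truncPow B s ((η / K₃) ^ 2) (g * P * h) = ENNReal.ofReal φ ^ (-(t * (q * r : ℕ))) *
        ENNReal.ofReal φ ^ (-(t * (k * r : ℕ))) * ENNReal.ofReal φ ^ (-(t * C)) := by
      rw [truncPow, if_pos hle, ← Real.sq_sqrt (sqDist_nonneg B (g * P * h)), ← hφ,
        ENNReal.ofReal_pow hφ0, ← ENNReal.rpow_natCast, ← ENNReal.rpow_mul]
      simp only [ENNReal.rpow_neg, ← ENNReal.inv_rpow]
      rw [← ENNReal.rpow_add_of_nonneg _ _ (by positivity) (by positivity),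
        ← ENNReal.rpow_add_of_nonneg _ _ (by positivity) (by positivity), ← hs]
      rw [Nat.cast_ofNat, mul_neg, ENNReal.rpow_neg, ← ENNReal.inv_rpow]
    rw [e4]
    refine (mul_le_mul' (mul_le_mul' e1 e2) e3).trans (le_of_eq ?_)
    ring

end Averaging

section NetworkIntegrability

open MeasureTheory Metric Matrix Topology

lemma measurable_prod_abs_rpow_neg {n r : ℕ} (t : ℝ) (M : Matrix (Fin r) (Fin r) ℝ)
    (C : Matrix (Fin n) (Fin r) ℝ) : Measurable fun w : Fin n → Fin r → ℝ =>
      ∏ i, ∏ j, ENNReal.ofReal |(Matrix.of w * M + C) i j| ^ (-t) := by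
  refine Finset.measurable_fun_prod _ fun i _ => Finset.measurable_fun_prod _ fun j _ => ?_
  have h1 : Measurable fun x : ℝ => ENNReal.ofReal |x| ^ (-t) := by fun_prop
  have h2 : Continuous fun w : Fin n → Fin r → ℝ => (Matrix.of w * M + C) i j := by
    have h3 : Continuous fun w : Fin n → Fin r → ℝ => (Matrix.of w : Matrix (Fin n) (Fin r) ℝ) :=
      continuous_id
    exact ((h3.matrix_mul continuous_const).add continuous_const).matrix_elem i j
  simpa only [Function.comp_def] using h1.comp h2.measurable

lemma exists_radius_isBddInv {q m r k : ℕ} (ℓ : Matrix (Fin r) (Fin q) ℝ)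
    (c : Matrix (Fin m) (Fin r) ℝ) (e' : Matrix (Fin k) (Fin m) ℝ) : ∃ η : ℝ, 0 < η ∧
    ∀ (w : Matrix (Fin q) (Fin r) ℝ) (u : Matrix (Fin r) (Fin k) ℝ), (∀ i j, |w i j| ≤ η) →
      (∀ i j, |u i j| ≤ η) →
      IsBddInv 2 (1 + w * ℓ) ∧ IsBddInv 2 (1 + ℓ * w) ∧ IsBddInv 2 (1 + c * u * e') := by
  obtain ⟨Kℓ, hKℓ, hbℓ⟩ := exists_abs_apply_le ℓ
  obtain ⟨Kc, hKc, hbc⟩ := exists_abs_apply_le c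
  obtain ⟨Ke, hKe, hbe⟩ := exists_abs_apply_le e'
  obtain ⟨η₁, hη₁, h1⟩ := exists_isBddInv_of_near_one q
  obtain ⟨η₂, hη₂, h2⟩ := exists_isBddInv_of_near_one r
  obtain ⟨η₃, hη₃, h3⟩ := exists_isBddInv_of_near_one m
  set S : ℝ := r * Kℓ + q * Kℓ + k * (r * Kc * Ke) + 1 with hS
  have hS0 : 0 < S := by positivity
  have a1 : 0 ≤ r * Kℓ := by positivity
  have a2 : 0 ≤ q * Kℓ := by positivity
  have a3 : 0 ≤ k * (r * Kc * Ke) := by positivity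
  set η := min η₁ (min η₂ η₃) / S with hη
  have hη0 : 0 < η := by positivity
  have hSη : η * S = min η₁ (min η₂ η₃) := div_mul_cancel₀ _ hS0.ne'
  refine ⟨η, hη0, fun w u hw hu => ⟨h1 _ fun i j => ?_, h2 _ fun i j => ?_, h3 _ fun i j => ?_⟩⟩
  · rw [add_sub_cancel_left]
    refine (Matrix.abs_mul_apply_le hw hbℓ hη0.le i j).trans
      (le_trans ?_ (hSη.le.trans (min_le_left _ _)))
    rw [Fintype.card_fin]
    nlinarith
  · rw [add_sub_cancel_left]
    refine (Matrix.abs_mul_apply_le hbℓ hw hKℓ i j).trans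
      (le_trans ?_ (hSη.le.trans ((min_le_right _ _).trans (min_le_left _ _))))
    rw [Fintype.card_fin]
    nlinarith
  · rw [add_sub_cancel_left]
    refine (Matrix.abs_mul_apply_le (Matrix.abs_mul_apply_le hbc hu hKc) hbe (by positivity)
      i j).trans (le_trans ?_ (hSη.le.trans ((min_le_right _ _).trans (min_le_right _ _))))
    rw [Fintype.card_fin, Fintype.card_fin]
    nlinarith

/-- The average of the truncated reciprocal power over small perturbations of `P`. -/
lemma exists_lintegral_truncPow_le {q m r k C : ℕ} {B : Matrix (Fin q) (Fin m) ℝ}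
    (hr : B.rank ≤ r) {ℓ : Matrix (Fin r) (Fin q) ℝ} {c : Matrix (Fin m) (Fin r) ℝ}
    {c' : Matrix (Fin m) (Fin k) ℝ} {e' : Matrix (Fin k) (Fin m) ℝ} (hℓ : ℓ * (B * c) = 1)
    (hc' : B * c' = 0) (he : e' * c = 0) (he' : e' * c' = 1) {s t : ℝ} (ht : 0 < t) (ht1 : t < 1)
    (hs : 2 * s = t * (q * r : ℕ) + t * (k * r : ℕ) + t * C) :
    ∃ (ρ η : ℝ) (K : ENNReal), 0 < ρ ∧ 0 < η ∧ K ≠ ⊤ ∧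
      (∀ v : (Fin q → Fin r → ℝ) × (Fin k → Fin r → ℝ), v ∈ closedBall 0 η →
        IsBddInv 2 (1 + Matrix.of v.1 * ℓ) ∧ IsBddInv 2 (1 + c * (Matrix.of v.2)ᵀ * e')) ∧
      ∀ P : Matrix (Fin q) (Fin m) ℝ,
      ∫⁻ v : (Fin q → Fin r → ℝ) × (Fin k → Fin r → ℝ) in closedBall 0 η,
        truncPow B s ρ ((1 + Matrix.of v.1 * ℓ) * P * (1 + c * (Matrix.of v.2)ᵀ * e')) ≤
      K * supPow r (t * C) (basisWeight fun _ => 1) P := by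
  obtain ⟨ρ, K, K', hρ, hK, hK', hpt⟩ := exists_truncPow_le hr hℓ hc' he he' ht.le hs
  obtain ⟨η, hη, hinv⟩ := exists_radius_isBddInv ℓ c e'
  obtain ⟨K₁, hK₁, hw⟩ := exists_lintegral_prod_abs_rpow_neg_le ht ht1 q r hK hη.le
  obtain ⟨K₂, hK₂, hu⟩ := exists_lintegral_prod_abs_rpow_neg_le ht ht1 k r zero_le_two hη.le
  have hinv' : ∀ (w : Fin q → Fin r → ℝ) (y : Fin k → Fin r → ℝ), w ∈ closedBall 0 η →
      y ∈ closedBall 0 η → IsBddInv 2 (1 + Matrix.of w * ℓ) ∧ IsBddInv 2 (1 + ℓ * Matrix.of w) ∧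
        IsBddInv 2 (1 + c * (Matrix.of y)ᵀ * e') := fun w y hw hy =>
    hinv _ _ (fun i j => (pi_norm_apply_le w i j).trans (mem_closedBall_zero_iff.1 hw))
      fun i j => (pi_norm_apply_le y j i).trans (mem_closedBall_zero_iff.1 hy)
  refine ⟨ρ, η, K' * (K₁ * K₂), hρ, hη, ENNReal.mul_ne_top hK' (ENNReal.mul_ne_top hK₁ hK₂),
    fun v hv => ?_, fun P => ?_⟩
  · rw [← Prod.mk.eta (p := v), ← Prod.mk_zero_zero, ← closedBall_prod_same] at hv
    exact ⟨(hinv' v.1 v.2 hv.1 hv.2).1, (hinv' v.1 v.2 hv.1 hv.2).2.2⟩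
  · rw [Measure.volume_eq_prod]
    refine (lintegral_closedBall_prod_le _ _ _ _).trans ?_
    set σ := supPow r (t * C) (basisWeight fun _ => 1) P with hσ
    by_cases hM₁ : IsBddInv K (ℓ * P * c)
    · have hin : ∀ w : Fin q → Fin r → ℝ, w ∈ closedBall 0 η →
          ∫⁻ y : Fin k → Fin r → ℝ in closedBall 0 η,
            truncPow B s ρ ((1 + Matrix.of w * ℓ) * P * (1 + c * (Matrix.of y)ᵀ * e')) ≤
          K' * K₂ * σ * ∏ i, ∏ j,
            ENNReal.ofReal |(Matrix.of w * (ℓ * P * c) + (P * c - B * c)) i j| ^ (-t) := by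
        intro w hw'
        set π := ∏ i, ∏ j,
          ENNReal.ofReal |(Matrix.of w * (ℓ * P * c) + (P * c - B * c)) i j| ^ (-t) with hπ
        by_cases hM₂ : IsBddInv 2 (ℓ * ((1 + Matrix.of w * ℓ) * P) * c)
        · refine (setLIntegral_mono' (g := fun y : Fin k → Fin r → ℝ => K' * π * σ *
            ∏ i, ∏ j, ENNReal.ofReal |(Matrix.of y * (ℓ * ((1 + Matrix.of w * ℓ) * P) * c)ᵀ +
              (ℓ * ((1 + Matrix.of w * ℓ) * P) * c')ᵀ : Matrix (Fin k) (Fin r) ℝ) i j| ^ (-t))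
            measurableSet_closedBall fun y hy => ?_).trans ?_
          · obtain ⟨i1, i2, i3⟩ := hinv' w y hw' hy
            by_cases h0 : truncPow B s ρ
                ((1 + Matrix.of w * ℓ) * P * (1 + c * (Matrix.of y)ᵀ * e')) = 0
            · rw [h0]
              exact zero_le
            · refine (hpt _ _ P i1 i2 i3 h0).2.2.trans (le_of_eq ?_)
              rw [Matrix.transpose_transpose, ← hπ, ← hσ]
              ring
          · rw [lintegral_const_mul _ (measurable_prod_abs_rpow_neg _ _ _)]
            refine (mul_le_mul_right (hu _ hM₂.transpose _) _).trans (le_of_eq ?_)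
            ring
        · rw [setLIntegral_congr_fun (g := fun _ => 0) measurableSet_closedBall fun y hy => ?_]
          · simp
          · obtain ⟨i1, i2, i3⟩ := hinv' w y hw' hy
            by_contra h0
            exact hM₂ (hpt _ _ P i1 i2 i3 h0).2.1
      refine (setLIntegral_mono' measurableSet_closedBall hin).trans ?_
      rw [lintegral_const_mul _ (measurable_prod_abs_rpow_neg _ _ _)]
      refine (mul_le_mul_right (hw _ hM₁ _) _).trans (le_of_eq ?_)
      ring
    · rw [setLIntegral_congr_fun (g := fun _ => 0) measurableSet_closedBall fun w hw' => ?_]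
      · simp
      · rw [setLIntegral_congr_fun (g := fun _ => 0) measurableSet_closedBall fun y hy => ?_]
        · simp
        · obtain ⟨i1, i2, i3⟩ := hinv' w y hw' hy
          by_contra h0
          exact hM₁ (hpt _ _ P i1 i2 i3 h0).1

lemma isAddHaarMeasure_volume_net (N : ℕ) (d : ℕ → ℕ) :
    (volume : Measure (∀ i : Fin N, Fin (d ((i : ℕ) + 1)) → Fin (d (i : ℕ)) → ℝ)).IsAddHaarMeasure :=
  have : ∀ i : Fin N, (volume : Measure (Fin (d ((i : ℕ) + 1)) → Fin (d (i : ℕ)) →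
      ℝ)).IsAddHaarMeasure := fun _ => isAddHaarMeasure_volume_pi_pi _ _
  Measure.pi.isAddHaarMeasure fun i : Fin N =>
    (volume : Measure (Fin (d ((i : ℕ) + 1)) → Fin (d (i : ℕ)) → ℝ))

lemma exists_lintegral_truncPow_netProd_ne_top {N : ℕ} (hN : 1 ≤ N) (d : ℕ → ℕ)
    (B : Matrix (Fin (d N)) (Fin (d 0)) ℝ) (hr : ∀ i ≤ N, B.rank ≤ d i) {s t : ℝ} (ht : 0 < t)
    (ht1 : t < 1) (hs : 2 * s = t * (d N * B.rank : ℕ) + t * ((d 0 - B.rank) * B.rank : ℕ) +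
      t * KPmin N d B.rank) :
    ∃ ρ : ℝ, 0 < ρ ∧ ∀ R : ℝ, ∫⁻ x in closedBall 0 R, truncPow B s ρ (netProd N d x) ≠ ⊤ := by
  obtain ⟨ℓ, c, c', e, e', hℓ, hc', -, -, he, he', -⟩ :=
    exists_kernel_splitting B (k := d 0 - B.rank) (by have := hr 0 (Nat.zero_le _); omega)
  obtain ⟨ρ, η, K, hρ, hη, hK, hinv, hbound⟩ :=
    exists_lintegral_truncPow_le le_rfl hℓ hc' he he' ht ht1 hs
  refine ⟨ρ, hρ, fun R => ?_⟩
  have hHaar := isAddHaarMeasure_volume_net N d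
  obtain ⟨K₁, hK₁, hL⟩ := exists_equiv_netProd hN d one_le_two
  obtain ⟨C₁, hC₁, hcomp⟩ := exists_lintegral_closedBall_comp_le
    (volume : Measure (∀ i : Fin N, Fin (d ((i : ℕ) + 1)) → Fin (d (i : ℕ)) → ℝ))
    (volume : Measure (∀ i : Fin N, Fin (d ((i : ℕ) + 1)) → Fin (d (i : ℕ)) → ℝ)) hK₁
  set R' := max 1 (K₁ * R) with hR'
  obtain ⟨C₂, hC₂, hlay⟩ := exists_lintegral_netProd_le N d (le_max_left 1 (K₁ * R))
  set I := ∫⁻ x in closedBall 0 R, truncPow B s ρ (netProd N d x) with hI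
  set W := (Fin (d N) → Fin B.rank → ℝ) × (Fin (d 0 - B.rank) → Fin B.rank → ℝ)
  let F : W → (∀ i : Fin N, Fin (d ((i : ℕ) + 1)) → Fin (d (i : ℕ)) → ℝ) → ENNReal := fun v x =>
    truncPow B s ρ ((1 + Matrix.of v.1 * ℓ) * netProd N d x * (1 + c * (Matrix.of v.2)ᵀ * e'))
  have h1 : ∀ v ∈ closedBall (0 : W) η, I ≤ C₁ * ∫⁻ x in closedBall 0 R', F v x := by
    intro v hv
    obtain ⟨i1, i2⟩ := hinv v hv
    obtain ⟨L, hL0, hL1, hL2⟩ := hL _ _ i1 i2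
    have h2 := hcomp L.symm hL2 (by simpa using hL1) R fun x => F v x
    have h3 : ∀ x, F v (L.symm x) = truncPow B s ρ (netProd N d x) := fun x => by
      change truncPow B s ρ (_ * netProd N d (L.symm x) * _) = _
      rw [← hL0, L.apply_symm_apply]
    simp only [h3] at h2
    exact h2.trans (mul_le_mul_right
      (lintegral_mono_set (closedBall_subset_closedBall (le_max_right _ _))) _)
  have hmeas : Measurable (Function.uncurry F) := by
    refine measurable_truncPow_comp B s ρ ?_
    have k1 : Continuous fun z : W × (∀ i : Fin N, Fin (d ((i : ℕ) + 1)) → Fin (d (i : ℕ)) → ℝ) =>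
        (Matrix.of z.1.1 : Matrix (Fin (d N)) (Fin B.rank) ℝ) := continuous_fst.comp continuous_fst
    have k2 : Continuous fun z : W × (∀ i : Fin N, Fin (d ((i : ℕ) + 1)) → Fin (d (i : ℕ)) → ℝ) =>
        (Matrix.of z.1.2 : Matrix (Fin (d 0 - B.rank)) (Fin B.rank) ℝ) :=
      continuous_snd.comp continuous_fst
    have k3 := (continuous_netProd N d).comp (continuous_snd : Continuous fun z :
      W × (∀ i : Fin N, Fin (d ((i : ℕ) + 1)) → Fin (d (i : ℕ)) → ℝ) => z.2)
    exact ((continuous_const.add (k1.matrix_mul continuous_const)).matrix_mul k3).matrix_mul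
      (continuous_const.add ((continuous_const.matrix_mul k2.matrix_transpose).matrix_mul
        continuous_const))
  have h4 : volume (closedBall (0 : W) η) * I ≤
      C₁ * (K * (C₂ * layerIntegral R' N d
        (supPow B.rank (t * KPmin N d B.rank) (basisWeight fun _ => 1)))) := by
    calc volume (closedBall (0 : W) η) * I = ∫⁻ _ in closedBall (0 : W) η, I := by
          rw [setLIntegral_const, mul_comm]
      _ ≤ ∫⁻ v in closedBall (0 : W) η, C₁ * ∫⁻ x in closedBall 0 R', F v x :=
          setLIntegral_mono' measurableSet_closedBall h1
      _ = C₁ * ∫⁻ v in closedBall (0 : W) η, ∫⁻ x in closedBall 0 R', F v x :=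
          lintegral_const_mul' _ _ hC₁
      _ = C₁ * ∫⁻ x in closedBall 0 R', ∫⁻ v in closedBall (0 : W) η, F v x := by
          rw [lintegral_lintegral_swap hmeas.aemeasurable]
      _ ≤ C₁ * ∫⁻ x in closedBall 0 R',
            K * supPow B.rank (t * KPmin N d B.rank) (basisWeight fun _ => 1) (netProd N d x) :=
          mul_le_mul_right (lintegral_mono fun x => hbound (netProd N d x)) _
      _ ≤ _ := by
          rw [lintegral_const_mul' _ _ hK]
          exact mul_le_mul_right (mul_le_mul_right (hlay _) _) _
  have h5 := ne_top_of_le_ne_top (ENNReal.mul_ne_top hC₁ (ENNReal.mul_ne_top hK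
    (ENNReal.mul_ne_top hC₂ (layerIntegral_supPow_ne_top hN hr ht ht1 R')))) h4
  intro htop
  rw [htop, ENNReal.mul_top] at h5
  · exact h5 rfl
  · exact (measure_closedBall_pos volume 0 hη).ne'

lemma locallyIntegrable_DLNloss_rpow {N : ℕ} (hN : 1 ≤ N) (d : ℕ → ℕ)
    (B : Matrix (Fin (d N)) (Fin (d 0)) ℝ) (hr : ∀ i ≤ N, B.rank ≤ d i) {s : ℝ}
    (hs : 2 * s < (d N * B.rank : ℕ) + ((d 0 - B.rank) * B.rank : ℕ) + KPmin N d B.rank) :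
    LocallyIntegrable (fun x => DLNloss N d B x ^ (-s)) volume := by
  have hcont : Continuous fun x => sqDist B (netProd N d x) :=
    (continuous_sqDist B).comp (continuous_netProd N d)
  simp only [DLNloss_eq]
  rcases le_or_gt s 0 with hs0 | hs0
  · refine Continuous.locallyIntegrable ?_
    exact hcont.rpow_const fun x => Or.inr (by linarith)
  set T : ℝ := (d N * B.rank : ℕ) + ((d 0 - B.rank) * B.rank : ℕ) + KPmin N d B.rank with hT
  have hT0 : 0 < T := by linarith
  obtain ⟨ρ, hρ, hbound⟩ := exists_lintegral_truncPow_netProd_ne_top hN d B hr (s := s)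
    (t := 2 * s / T) (by positivity) ((div_lt_one hT0).2 hs) (by
      rw [← mul_add, ← mul_add, ← hT]
      field_simp)
  have hmeas : Measurable fun x => sqDist B (netProd N d x) ^ (-s) := by
    have h1 : Measurable fun y : ℝ => y ^ (-s) := by fun_prop
    simpa only [Function.comp_def] using h1.comp hcont.measurable
  have hle : ∀ x, ‖sqDist B (netProd N d x) ^ (-s)‖ₑ ≤
      truncPow B s ρ (netProd N d x) + ENNReal.ofReal (ρ ^ (-s)) := by
    intro x
    have h0 := sqDist_nonneg B (netProd N d x)
    rw [Real.enorm_of_nonneg (Real.rpow_nonneg h0 _), truncPow]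
    split_ifs with h
    · rcases h0.eq_or_lt with h1 | h1
      · rw [← h1, Real.zero_rpow (by linarith), ENNReal.ofReal_zero]
        exact zero_le
      · rw [ENNReal.ofReal_rpow_of_pos h1]
        exact le_self_add
    · rw [zero_add]
      exact ENNReal.ofReal_le_ofReal
        (Real.rpow_le_rpow_of_nonpos hρ (not_le.1 h).le (by linarith))
  have hHaar := isAddHaarMeasure_volume_net N d
  intro x
  refine ⟨closedBall 0 (‖x‖ + 1), closedBall_mem_nhds_of_mem
    (by rw [mem_ball_zero_iff]; linarith), hmeas.aestronglyMeasurable, ?_⟩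
  refine lt_of_le_of_lt (lintegral_mono hle) ?_
  rw [lintegral_add_right _ measurable_const, setLIntegral_const]
  exact ENNReal.add_lt_top.2 ⟨(hbound _).lt_top, ENNReal.mul_lt_top ENNReal.ofReal_lt_top
    (isCompact_closedBall _ _).measure_lt_top⟩

end NetworkIntegrability

section LowerBound

open MeasureTheory Metric Matrix Topology

/-- Comparison of the volume of a set with the volumes of its sections. -/
lemma exists_mul_lintegral_measure_section_le {n : ℕ} (M : Fin (n + 1) → Type*)
    [∀ i, NormedAddCommGroup (M i)] [∀ i, NormedSpace ℝ (M i)] [∀ i, FiniteDimensional ℝ (M i)]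
    [∀ i, MeasureSpace (M i)] [∀ i, BorelSpace (M i)]
    [∀ i, (volume : Measure (M i)).IsAddHaarMeasure] :
    ∃ c : ENNReal, c ≠ ⊤ ∧ ∀ (R : ℝ) (S : Set (∀ i, M i)), MeasurableSet S →
      ∫⁻ x in closedBall 0 R, volume (closedBall 0 R ∩
        {y : ∀ i : Fin n, M i.succ | (Fin.cons x y : ∀ i, M i) ∈ S}) ≤
        c * volume (closedBall 0 R ∩ S) := by
  have : ∀ i, SecondCountableTopology (M i) := fun i =>
    have := FiniteDimensional.proper_real (M i)
    inferInstance
  obtain ⟨c, hc, h⟩ := exists_lintegral_closedBall_comp_le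
    ((volume : Measure (M 0)).prod (volume : Measure (∀ i : Fin n, M i.succ)))
    (volume : Measure (∀ i, M i)) zero_le_one
  refine ⟨c, hc, fun R S hS => ?_⟩
  have h1 := h (Fin.consLinearEquiv ℝ M)
    (fun y => by
      rw [one_mul]
      exact (norm_finCons y.1 y.2).le)
    (fun x => by
      obtain ⟨y, rfl⟩ := (Fin.consLinearEquiv ℝ M).surjective x
      rw [LinearEquiv.symm_apply_apply, one_mul]
      exact (norm_finCons y.1 y.2).ge) R (S.indicator 1)
  have hcont : Continuous (Fin.consLinearEquiv ℝ M) :=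
    (Fin.consLinearEquiv ℝ M).toLinearMap.continuous_of_finiteDimensional
  have hmeas : Measurable fun z => S.indicator (1 : (∀ i, M i) → ENNReal)
      (Fin.consLinearEquiv ℝ M z) :=
    (measurable_one.indicator hS).comp hcont.measurable
  rw [one_mul, lintegral_indicator_one hS, Measure.restrict_apply hS, Set.inter_comm] at h1
  refine le_trans (le_of_eq ?_) h1
  have hball : closedBall (0 : M 0 × ∀ i : Fin n, M i.succ) R = closedBall 0 R ×ˢ closedBall 0 R :=
    (closedBall_prod_same 0 0 R).symm
  rw [hball, ← Measure.prod_restrict, lintegral_prod _ hmeas.aemeasurable]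
  refine lintegral_congr fun x => ?_
  have hm : MeasurableSet {y : ∀ i : Fin n, M i.succ | (Fin.cons x y : ∀ i, M i) ∈ S} :=
    (hcont.measurable.comp (measurable_const.prodMk measurable_id)) hS
  rw [Set.inter_comm, ← Measure.restrict_apply hm, ← lintegral_indicator_one hm]
  rfl

/-- A lower bound for the integral of a function that is large near a graph. -/
lemma mul_le_lintegral_of_near_graph {ι κ : Type*} [Fintype ι] [Fintype κ]
    {g : (ι → ℝ) × (κ → ℝ) → ENNReal} (hg : Measurable g) {x₀ : κ → ℝ} {η ε : ℝ} (hε : 0 ≤ ε)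
    {C : ENNReal} {φ : (κ → ℝ) → ι → ℝ}
    (h : ∀ x ∈ closedBall x₀ η, ∀ z ∈ closedBall (φ x) ε, C ≤ g (z, x)) :
    C * ENNReal.ofReal ((2 * ε) ^ Fintype.card ι) * volume (closedBall x₀ η) ≤ ∫⁻ w, g w := by
  rw [Measure.volume_eq_prod, lintegral_prod_symm _ hg.aemeasurable]
  calc C * ENNReal.ofReal ((2 * ε) ^ Fintype.card ι) * volume (closedBall x₀ η)
      = ∫⁻ _ in closedBall x₀ η, C * ENNReal.ofReal ((2 * ε) ^ Fintype.card ι) := by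
        rw [setLIntegral_const]
    _ ≤ ∫⁻ x in closedBall x₀ η, ∫⁻ z, g (z, x) := by
        refine setLIntegral_mono' measurableSet_closedBall fun x hx => ?_
        rw [← Real.volume_pi_closedBall (φ x) hε, ← setLIntegral_const]
        exact (setLIntegral_mono' measurableSet_closedBall (h x hx)).trans
          (setLIntegral_le_lintegral _ _)
    _ ≤ _ := setLIntegral_le_lintegral _ _

/-- Reassembling a matrix from its entries in a set of positions and in the complement. -/
def matrixJoin (a b : ℕ) (T : Fin a × Fin b → Prop) [DecidablePred T] :
    (({ij // T ij} → ℝ) × ({ij // ¬T ij} → ℝ)) ≃ₗ[ℝ] (Fin a → Fin b → ℝ) where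
  toFun w i j := if h : T (i, j) then w.1 ⟨(i, j), h⟩ else w.2 ⟨(i, j), h⟩
  invFun A := (fun ij => A ij.1.1 ij.1.2, fun ij => A ij.1.1 ij.1.2)
  map_add' v w := by
    funext i j
    by_cases h : T (i, j) <;> simp [h]
  map_smul' c w := by
    funext i j
    by_cases h : T (i, j) <;> simp [h]
  left_inv w := by
    ext ij
    · simp [ij.2]
    · simp [ij.2]
  right_inv A := by
    funext i j
    by_cases h : T (i, j) <;> simp [h]

lemma norm_matrixJoin_le {a b : ℕ} {T : Fin a × Fin b → Prop} [DecidablePred T]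
    (w : ({ij // T ij} → ℝ) × ({ij // ¬T ij} → ℝ)) : ‖matrixJoin a b T w‖ ≤ ‖w‖ := by
  refine pi_norm_le_of_abs_le (norm_nonneg _) fun i j => ?_
  by_cases h : T (i, j)
  · have : matrixJoin a b T w i j = w.1 ⟨(i, j), h⟩ := dif_pos h
    rw [this, ← Real.norm_eq_abs]
    exact (norm_le_pi_norm w.1 _).trans (norm_fst_le w)
  · have : matrixJoin a b T w i j = w.2 ⟨(i, j), h⟩ := dif_neg h
    rw [this, ← Real.norm_eq_abs]
    exact (norm_le_pi_norm w.2 _).trans (norm_snd_le w)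

lemma norm_matrixJoin_symm_le {a b : ℕ} {T : Fin a × Fin b → Prop} [DecidablePred T]
    (A : Fin a → Fin b → ℝ) : ‖(matrixJoin a b T).symm A‖ ≤ ‖A‖ := by
  refine norm_prod_le_iff.2 ⟨?_, ?_⟩
  · exact (pi_norm_le_iff_of_nonneg (norm_nonneg _)).2 fun ij => pi_norm_apply_le A ij.1.1 ij.1.2
  · exact (pi_norm_le_iff_of_nonneg (norm_nonneg _)).2 fun ij => pi_norm_apply_le A ij.1.1 ij.1.2

/-- A lower bound for the integral of a function of a matrix that is large when the entries in
the positions `T` are close to a function of the other entries. -/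
lemma exists_mul_le_lintegral_matrix {a b : ℕ} (T : Fin a × Fin b → Prop) [DecidablePred T]
    (A₀ : Fin a → Fin b → ℝ) {η : ℝ} (hη : 0 < η) (R : ℝ) :
    ∃ c : ENNReal, c ≠ 0 ∧ ∀ (ε : ℝ), 0 < ε → ∀ (C : ENNReal)
      (g : (Fin a → Fin b → ℝ) → ENNReal), Measurable g →
      (∀ A : Fin a → Fin b → ℝ, (∀ i j, ¬T (i, j) → |A i j - A₀ i j| ≤ η) →
        ∃ φ : Fin a → Fin b → ℝ, ∀ Z : Fin a → Fin b → ℝ, (∀ i j, ¬T (i, j) → Z i j = A i j) →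
          (∀ i j, T (i, j) → |Z i j - φ i j| ≤ ε) → ‖Z‖ ≤ R ∧ C ≤ g Z) →
      c * (C * ENNReal.ofReal (ε ^ Fintype.card {ij // T ij})) ≤
        ∫⁻ Z in closedBall 0 R, g Z := by
  have := isAddHaarMeasure_volume_pi_pi a b
  have : (volume : Measure ({ij // T ij} → ℝ)).IsAddHaarMeasure := inferInstance
  have : (volume : Measure ({ij // ¬T ij} → ℝ)).IsAddHaarMeasure := inferInstance
  obtain ⟨c, hc, hle⟩ := exists_lintegral_closedBall_comp_le
    ((volume : Measure ({ij // T ij} → ℝ)).prod (volume : Measure ({ij // ¬T ij} → ℝ)))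
    (volume : Measure (Fin a → Fin b → ℝ)) zero_le_one
  set x₀ : {ij // ¬T ij} → ℝ := fun ij => A₀ ij.1.1 ij.1.2 with hx₀
  set v := volume (closedBall x₀ η) with hv
  have hv0 : v ≠ 0 := (measure_closedBall_pos _ _ hη).ne'
  have hvt : v ≠ ⊤ := (isCompact_closedBall _ _).measure_lt_top.ne
  refine ⟨(c + 1)⁻¹ * v, mul_ne_zero (ENNReal.inv_ne_zero.2
    (ENNReal.add_ne_top.2 ⟨hc, ENNReal.one_ne_top⟩)) hv0, fun ε hε C g hg hgr => ?_⟩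
  have h1 := hle (matrixJoin a b T) (by simpa using norm_matrixJoin_le)
    (by simpa using norm_matrixJoin_symm_le) R ((closedBall 0 R).indicator g)
  have hcont : Continuous (matrixJoin a b T) :=
    (matrixJoin a b T).toLinearMap.continuous_of_finiteDimensional
  have hmeas : Measurable fun w => (closedBall 0 R).indicator g (matrixJoin a b T w) :=
    (hg.indicator measurableSet_closedBall).comp hcont.measurable
  rw [one_mul, setLIntegral_indicator measurableSet_closedBall, Set.inter_self] at h1
  have key : C * ENNReal.ofReal ((2 * ε) ^ Fintype.card {ij // T ij}) * v ≤
      ∫⁻ w, (closedBall 0 R).indicator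
        (fun w => (closedBall 0 R).indicator g (matrixJoin a b T w)) w := by
    classical
    have hA : ∀ x ∈ closedBall x₀ η, ∀ i j, ¬T (i, j) →
        |matrixJoin a b T (0, x) i j - A₀ i j| ≤ η := by
      intro x hx i j h
      have h2 : matrixJoin a b T (0, x) i j = x ⟨(i, j), h⟩ := dif_neg h
      rw [h2]
      exact (dist_le_pi_dist x x₀ ⟨(i, j), h⟩).trans hx
    refine mul_le_lintegral_of_near_graph (hmeas.indicator measurableSet_closedBall) hε.le
      (φ := fun x => if hx : x ∈ closedBall x₀ η then
        fun ij => (hgr _ (hA x hx)).choose ij.1.1 ij.1.2 else 0) fun x hx z hz => ?_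
    simp only [dif_pos hx] at hz
    obtain ⟨h3, h4⟩ := (hgr _ (hA x hx)).choose_spec (matrixJoin a b T (z, x))
      (fun i j h => by
        have e1 : matrixJoin a b T (z, x) i j = x ⟨(i, j), h⟩ := dif_neg h
        have e2 : matrixJoin a b T (0, x) i j = x ⟨(i, j), h⟩ := dif_neg h
        rw [e1, e2])
      (fun i j h => by
        have e1 : matrixJoin a b T (z, x) i j = z ⟨(i, j), h⟩ := dif_pos h
        rw [e1]
        exact (dist_le_pi_dist z _ ⟨(i, j), h⟩).trans hz)
    have h5 : matrixJoin a b T (z, x) ∈ closedBall 0 R := mem_closedBall_zero_iff.2 h3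
    have h6 : (z, x) ∈ closedBall (0 : ({ij // T ij} → ℝ) × ({ij // ¬T ij} → ℝ)) R := by
      rw [mem_closedBall_zero_iff]
      refine le_trans ?_ h3
      simpa using norm_matrixJoin_symm_le (T := T) (matrixJoin a b T (z, x))
    rw [Set.indicator_of_mem h6, Set.indicator_of_mem h5]
    exact h4
  rw [lintegral_indicator measurableSet_closedBall, Measure.volume_eq_prod] at key
  have h7 := key.trans (h1.trans (mul_le_mul_left (le_self_add (b := 1)) _))
  rw [mul_assoc, ENNReal.inv_mul_le_iff]
  · refine le_trans ?_ h7
    rw [mul_comm v]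
    refine mul_le_mul_left (mul_le_mul_right (ENNReal.ofReal_le_ofReal ?_) _) _
    exact pow_le_pow_left₀ hε.le (by linarith) _
  · simp
  · exact ENNReal.add_ne_top.2 ⟨hc, ENNReal.one_ne_top⟩

end LowerBound

section MatrixGraph

open Matrix

lemma card_fin_subtype (a : ℕ) (P : ℕ → Prop) [DecidablePred P] :
    Fintype.card {i : Fin a // P i} = ((Finset.range a).filter P).card := by
  rw [Fintype.card_subtype, ← Finset.card_map Fin.valEmbedding]
  congr 1
  ext n
  simp only [Finset.mem_map, Finset.mem_filter, Finset.mem_univ, true_and, Fin.valEmbedding_apply,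
    Finset.mem_range]
  constructor
  · rintro ⟨i, hi, rfl⟩
    exact ⟨i.2, hi⟩
  · rintro ⟨h1, h2⟩
    exact ⟨⟨n, h1⟩, h2, rfl⟩

lemma card_determined_positions {a b r p q : ℕ} (hpa : p ≤ a) (hrp : r ≤ p) (hqb : q ≤ b) :
    Fintype.card {ij : Fin a × Fin b // (p ≤ (ij.2 : ℕ) ∧ (ij.2 : ℕ) < q) ∧
      ¬(r ≤ (ij.1 : ℕ) ∧ (ij.1 : ℕ) < p)} = (q - p) * (a - p) + r * (q - p) := by
  have e : {ij : Fin a × Fin b // (p ≤ (ij.2 : ℕ) ∧ (ij.2 : ℕ) < q) ∧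
      ¬(r ≤ (ij.1 : ℕ) ∧ (ij.1 : ℕ) < p)} ≃
      {i : Fin a // ¬(r ≤ (i : ℕ) ∧ (i : ℕ) < p)} × {j : Fin b // p ≤ (j : ℕ) ∧ (j : ℕ) < q} :=
    { toFun := fun ij => (⟨ij.1.1, ij.2.2⟩, ⟨ij.1.2, ij.2.1⟩)
      invFun := fun w => ⟨(w.1.1, w.2.1), w.2.2, w.1.2⟩
      left_inv := fun _ => rfl
      right_inv := fun _ => rfl }
  rw [Fintype.card_congr e, Fintype.card_prod, card_fin_subtype a fun i => ¬(r ≤ i ∧ i < p),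
    card_fin_subtype b fun j => p ≤ j ∧ j < q]
  have h1 : (Finset.range b).filter (fun j => p ≤ j ∧ j < q) = Finset.Ico p q := by
    ext j
    simp only [Finset.mem_filter, Finset.mem_range, Finset.mem_Ico]
    omega
  have h2 : (Finset.range a).filter (fun i => ¬(r ≤ i ∧ i < p)) =
      Finset.range r ∪ Finset.Ico p a := by
    ext i
    simp only [Finset.mem_filter, Finset.mem_range, Finset.mem_Ico, Finset.mem_union]
    omega
  rw [h1, h2, Finset.card_union_of_disjoint, Finset.card_range, Nat.card_Ico, Nat.card_Ico]
  · ring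
  · rw [Finset.disjoint_left]
    intro i
    simp only [Finset.mem_range, Finset.mem_Ico]
    omega

lemma card_first_columns {a b q : ℕ} (hqb : q ≤ b) :
    Fintype.card {ij : Fin a × Fin b // (ij.2 : ℕ) < q} = q * a := by
  have e : {ij : Fin a × Fin b // (ij.2 : ℕ) < q} ≃ Fin a × {j : Fin b // (j : ℕ) < q} :=
    { toFun := fun ij => (ij.1.1, ⟨ij.1.2, ij.2⟩)
      invFun := fun w => ⟨(w.1, w.2.1), w.2.2⟩
      left_inv := fun _ => rfl
      right_inv := fun _ => rfl }
  rw [Fintype.card_congr e, Fintype.card_prod, card_fin_subtype b fun j => j < q, Fintype.card_fin]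
  have h1 : (Finset.range b).filter (fun j => j < q) = Finset.range q := by
    ext j
    simp only [Finset.mem_filter, Finset.mem_range]
    omega
  rw [h1, Finset.card_range, mul_comm]

/-- The matrix with an identity block of size `p` in the upper left corner and zeros elsewhere. -/
def cornerOne (a b p : ℕ) (i : Fin a) (j : Fin b) : ℝ :=
  if (i : ℕ) = j ∧ (i : ℕ) < p then 1 else 0

lemma abs_cornerOne_le (a b p : ℕ) (i : Fin a) (j : Fin b) : |cornerOne a b p i j| ≤ 1 := by
  unfold cornerOne
  split_ifs <;> simp

/-- Near the matrix `cornerOne a b p`, the columns `p ≤ j < q` can be completed from their entries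
in the rows `r ≤ i < p` to linear combinations of the columns `r ≤ l < p`. -/
lemma exists_graph_matrix (a : ℕ) : ∃ η : ℝ, 0 < η ∧ η ≤ 1 ∧
    ∀ (b r p q : ℕ) (hpb : p ≤ b) (A : Fin a → Fin b → ℝ),
      (∀ (i : Fin a) (j : Fin b), ¬((p ≤ (j : ℕ) ∧ (j : ℕ) < q) ∧ ¬(r ≤ (i : ℕ) ∧ (i : ℕ) < p)) →
        |A i j - cornerOne a b p i j| ≤ η) →
      ∃ (h : Matrix (Fin a) (Fin a) ℝ) (w : Matrix (Fin a) (Fin b) ℝ), IsBddInv 2 h ∧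
        (∀ (i l : Fin a) (hl : (l : ℕ) < p), h i l = A i ⟨l, hl.trans_le hpb⟩) ∧
        (∀ l j, |w l j| ≤ 4 * a) ∧ (∀ (l : Fin a) (j : Fin b), ¬(r ≤ (l : ℕ) ∧ (l : ℕ) < p) → w l j = 0) ∧
        ∀ (i : Fin a) (j : Fin b), r ≤ (i : ℕ) → (i : ℕ) < p → p ≤ (j : ℕ) → (j : ℕ) < q →
          (h * w) i j = A i j := by
  obtain ⟨η, hη, hinv⟩ := exists_isBddInv_of_near_one a
  refine ⟨min η 1, lt_min hη one_pos, min_le_right _ _, fun b r p q hpb A hA => ?_⟩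
  have hcol : ∀ (i l : Fin a) (hl : (l : ℕ) < p),
      |A i ⟨l, hl.trans_le hpb⟩ - (1 : Matrix (Fin a) (Fin a) ℝ) i l| ≤ η := by
    intro i l hl
    have h1 : (1 : Matrix (Fin a) (Fin a) ℝ) i l = cornerOne a b p i ⟨l, hl.trans_le hpb⟩ := by
      rw [one_apply, cornerOne]
      refine if_congr ?_ rfl rfl
      rw [Fin.ext_iff]
      constructor
      · intro h
        exact ⟨h, h ▸ hl⟩
      · exact fun h => h.1
    rw [h1]
    refine (hA i ⟨l, hl.trans_le hpb⟩ fun h => ?_).trans (min_le_left _ _)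
    exact absurd h.1.1 (not_le.2 hl)
  set h : Matrix (Fin a) (Fin a) ℝ := fun i l => if hl : (l : ℕ) < p then A i ⟨l, hl.trans_le hpb⟩
    else (1 : Matrix (Fin a) (Fin a) ℝ) i l with hh
  set k : Matrix (Fin a) (Fin a) ℝ := fun i l => if r ≤ (l : ℕ) ∧ (l : ℕ) < p then h i l
    else (1 : Matrix (Fin a) (Fin a) ℝ) i l with hk
  have hh1 : ∀ i l, |(h - 1) i l| ≤ η := by
    intro i l
    rw [Matrix.sub_apply]
    by_cases hl : (l : ℕ) < p
    · simpa only [hh, dif_pos hl] using hcol i l hl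
    · simp [hh, dif_neg hl, hη.le]
  have hk1 : ∀ i l, |(k - 1) i l| ≤ η := by
    intro i l
    rw [Matrix.sub_apply]
    by_cases hl : r ≤ (l : ℕ) ∧ (l : ℕ) < p
    · rw [show k i l = h i l from if_pos hl, ← Matrix.sub_apply]
      exact hh1 i l
    · simp [hk, if_neg hl, hη.le]
  obtain ⟨k', e1, -, -, e2⟩ := hinv k hk1
  set y : Matrix (Fin a) (Fin b) ℝ := fun i j =>
    if (r ≤ (i : ℕ) ∧ (i : ℕ) < p) ∧ p ≤ (j : ℕ) ∧ (j : ℕ) < q then A i j else 0 with hy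
  have hy1 : ∀ i j, |y i j| ≤ 2 := by
    intro i j
    by_cases hc : (r ≤ (i : ℕ) ∧ (i : ℕ) < p) ∧ p ≤ (j : ℕ) ∧ (j : ℕ) < q
    · simp only [hy, if_pos hc]
      have h1 := (hA i j fun h => h.2 hc.1).trans (min_le_right _ _)
      have h2 := abs_cornerOne_le a b p i j
      rw [abs_le] at *
      constructor <;> linarith
    · simp [hy, if_neg hc]
  set w : Matrix (Fin a) (Fin b) ℝ := fun l j =>
    if r ≤ (l : ℕ) ∧ (l : ℕ) < p then (k' * y) l j else 0 with hw
  refine ⟨h, w, hinv h hh1, fun i l hl => by simp only [hh, dif_pos hl], fun l j => ?_,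
    fun l j hl => by simp only [hw, if_neg hl], fun i j h1 h2 h3 h4 => ?_⟩
  · by_cases hl : r ≤ (l : ℕ) ∧ (l : ℕ) < p
    · simp only [hw, if_pos hl]
      refine (Matrix.abs_mul_apply_le e2 hy1 zero_le_two l j).trans (le_of_eq ?_)
      rw [Fintype.card_fin]
      ring
    · simp only [hw, if_neg hl, abs_zero]
      positivity
  · have h5 : (k * (k' * y)) i j = A i j := by
      rw [← Matrix.mul_assoc, e1, Matrix.one_mul]
      exact if_pos ⟨⟨h1, h2⟩, h3, h4⟩
    rw [← h5, mul_apply, mul_apply]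
    refine Finset.sum_congr rfl fun l _ => ?_
    by_cases hl : r ≤ (l : ℕ) ∧ (l : ℕ) < p
    · simp only [hw, hk, if_pos hl]
    · have hil : i ≠ l := fun h => hl (h ▸ ⟨h1, h2⟩)
      simp only [hw, hk, if_neg hl, one_apply_ne hil, mul_zero, zero_mul]

lemma abs_mul_sub_le_of_near {m a b r p q : ℕ} (hpb : p ≤ b) (hrp : r ≤ p) {ε M : ℝ} (hε : 0 ≤ ε)
    (hM : 0 ≤ M) {B : Matrix (Fin m) (Fin b) ℝ} (hB : ∀ i (j : Fin b), r ≤ (j : ℕ) → B i j = 0)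
    {Q : Matrix (Fin m) (Fin a) ℝ} {h : Matrix (Fin a) (Fin a) ℝ} {w Z : Matrix (Fin a) (Fin b) ℝ}
    (hQM : ∀ i l, |Q i l| ≤ M)
    (hQ : ∀ i (l : Fin a) (hl : (l : ℕ) < p), |(Q * h) i l - B i ⟨l, hl.trans_le hpb⟩| ≤ ε)
    (hpa : p ≤ a) (hZ : ∀ (i l : Fin a) (hl : (l : ℕ) < p), h i l = Z i ⟨l, hl.trans_le hpb⟩)
    (hw : ∀ l j, |w l j| ≤ 4 * a) (hw0 : ∀ (l : Fin a) (j : Fin b), ¬(r ≤ (l : ℕ) ∧ (l : ℕ) < p) → w l j = 0)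
    (hZw : ∀ i (j : Fin b), p ≤ (j : ℕ) → (j : ℕ) < q → |Z i j - (h * w) i j| ≤ ε)
    (i : Fin m) (j : Fin b) (hj : (j : ℕ) < q) :
    |(Q * Z - B) i j| ≤ (a * (4 * a) + a * M + 1) * ε := by
  have hrest : 0 ≤ (a * (4 * a) + a * M) * ε := by positivity
  rw [Matrix.sub_apply]
  rcases lt_or_ge (j : ℕ) p with hjp | hjp
  · have h1 := hQ i ⟨j, hjp.trans_le hpa⟩ hjp
    have h2 : (Q * h) i ⟨j, hjp.trans_le hpa⟩ = (Q * Z) i j := by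
      rw [mul_apply, mul_apply]
      exact Finset.sum_congr rfl fun l _ => by rw [hZ l ⟨j, hjp.trans_le hpa⟩ hjp]
    rw [h2] at h1
    exact h1.trans (by linarith)
  · have h1 : (Q * Z) i j = ∑ l, (Q * h) i l * w l j + ∑ l, Q i l * (Z l j - (h * w) l j) := by
      rw [← mul_apply, Matrix.mul_assoc, mul_apply, mul_apply, ← Finset.sum_add_distrib]
      exact Finset.sum_congr rfl fun l _ => by ring
    have h2 : |∑ l, (Q * h) i l * w l j| ≤ a * (4 * a * ε) := by
      refine (Finset.abs_sum_le_sum_abs _ _).trans ((Finset.sum_le_card_nsmul _ _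
        (4 * a * ε) fun l _ => ?_).trans (by simp))
      by_cases hl : r ≤ (l : ℕ) ∧ (l : ℕ) < p
      · have h3 := hQ i l hl.2
        rw [hB i ⟨l, hl.2.trans_le hpb⟩ hl.1, sub_zero] at h3
        rw [abs_mul, mul_comm]
        exact mul_le_mul (hw l j) h3 (abs_nonneg _) (by positivity)
      · rw [hw0 l j hl, mul_zero, abs_zero]
        positivity
    have h3 : |∑ l, Q i l * (Z l j - (h * w) l j)| ≤ a * (M * ε) := by
      refine (Finset.abs_sum_le_sum_abs _ _).trans ((Finset.sum_le_card_nsmul _ _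
        (M * ε) fun l _ => ?_).trans (by simp))
      rw [abs_mul]
      exact mul_le_mul (hQM i l) (hZw l j hjp hj) (abs_nonneg _) hM
    rw [hB i j (hrp.trans hjp), sub_zero, h1]
    refine (abs_add_le _ _).trans ((add_le_add h2 h3).trans ?_)
    linarith

end MatrixGraph

section NetworkVolume

open MeasureTheory Metric Matrix Topology

/-- The weights whose end-to-end matrix, multiplied by `Z`, is `ε`-close to `B` in the first `q`
columns. -/
def nearSet {b : ℕ} (N : ℕ) (d : ℕ → ℕ) (Z : Matrix (Fin (d 0)) (Fin b) ℝ)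
    (B : Matrix (Fin (d N)) (Fin b) ℝ) (q : ℕ) (ε : ℝ) :
    Set (∀ i : Fin N, Fin (d ((i : ℕ) + 1)) → Fin (d (i : ℕ)) → ℝ) :=
  {x | ∀ i (j : Fin b), (j : ℕ) < q → |(netProd N d x * Z - B) i j| ≤ ε}

lemma isClosed_nearSet_prod {b : ℕ} (N : ℕ) (d : ℕ → ℕ) (B : Matrix (Fin (d N)) (Fin b) ℝ) (q : ℕ)
    (ε : ℝ) : IsClosed {z : (Fin (d 0) → Fin b → ℝ) ×
      (∀ i : Fin N, Fin (d ((i : ℕ) + 1)) → Fin (d (i : ℕ)) → ℝ) |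
        z.2 ∈ nearSet N d (Matrix.of z.1) B q ε} := by
  have h1 : Continuous fun z : (Fin (d 0) → Fin b → ℝ) ×
      (∀ i : Fin N, Fin (d ((i : ℕ) + 1)) → Fin (d (i : ℕ)) → ℝ) =>
      (netProd N d z.2 * Matrix.of z.1 - B : Matrix (Fin (d N)) (Fin b) ℝ) := by
    have k1 : Continuous fun z : (Fin (d 0) → Fin b → ℝ) ×
        (∀ i : Fin N, Fin (d ((i : ℕ) + 1)) → Fin (d (i : ℕ)) → ℝ) =>
        (Matrix.of z.1 : Matrix (Fin (d 0)) (Fin b) ℝ) := continuous_fst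
    exact (((continuous_netProd N d).comp continuous_snd).matrix_mul k1).sub continuous_const
  simp only [nearSet, Set.mem_ofPred_eq]
  simp only [Set.ofPred_forall]
  exact isClosed_iInter fun i => isClosed_iInter fun j => isClosed_iInter fun _ =>
    isClosed_le (h1.matrix_elem i j).abs continuous_const

lemma isClosed_nearSet {b : ℕ} (N : ℕ) (d : ℕ → ℕ) (Z : Matrix (Fin (d 0)) (Fin b) ℝ)
    (B : Matrix (Fin (d N)) (Fin b) ℝ) (q : ℕ) (ε : ℝ) : IsClosed (nearSet N d Z B q ε) :=
  (isClosed_nearSet_prod N d B q ε).preimage (f := fun x => ((fun i j => Z i j), x))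
    (continuous_const.prodMk continuous_id)

lemma exists_abs_netProd_le (N : ℕ) (d : ℕ → ℕ) (R : ℝ) : ∃ M : ℝ, 0 ≤ M ∧
    ∀ x ∈ closedBall (0 : ∀ i : Fin N, Fin (d ((i : ℕ) + 1)) → Fin (d (i : ℕ)) → ℝ) R,
      ∀ i j, |netProd N d x i j| ≤ M := by
  have h1 : Continuous fun x => (fun i j => netProd N d x i j : Fin (d N) → Fin (d 0) → ℝ) :=
    continuous_netProd N d
  obtain ⟨M, hM⟩ := ((isCompact_closedBall (0 : ∀ i : Fin N, Fin (d ((i : ℕ) + 1)) →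
    Fin (d (i : ℕ)) → ℝ) R).image h1).isBounded.exists_norm_le
  refine ⟨max M 0, le_max_right _ _, fun x hx i j => ?_⟩
  exact (pi_norm_apply_le (fun i j => netProd N d x i j) i j).trans
    ((hM _ (Set.mem_image_of_mem _ hx)).trans (le_max_left _ _))

/-- Multiplying the end-to-end matrix by a boundedly invertible matrix distorts volumes by a
bounded factor. -/
lemma exists_measure_mul_le {N : ℕ} (hN : 1 ≤ N) (d : ℕ → ℕ) {K : ℝ} (hK : 1 ≤ K) :
    ∃ (K' : ℝ) (c : ENNReal), 0 ≤ K' ∧ c ≠ ⊤ ∧ ∀ h : Matrix (Fin (d 0)) (Fin (d 0)) ℝ,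
      IsBddInv K h → ∀ (R : ℝ) (S S' : Set (∀ i : Fin N, Fin (d ((i : ℕ) + 1)) →
        Fin (d (i : ℕ)) → ℝ)), MeasurableSet S → MeasurableSet S' →
      (∀ x ∈ closedBall 0 R ∩ S, ∀ y, netProd N d y * h = netProd N d x → y ∈ S') →
      volume (closedBall 0 R ∩ S) ≤ c * volume (closedBall 0 (K' * R) ∩ S') := by
  have hHaar := isAddHaarMeasure_volume_net N d
  obtain ⟨K', hK', hL⟩ := exists_equiv_netProd hN d hK
  obtain ⟨c, hc, hcomp⟩ := exists_lintegral_closedBall_comp_le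
    (volume : Measure (∀ i : Fin N, Fin (d ((i : ℕ) + 1)) → Fin (d (i : ℕ)) → ℝ))
    (volume : Measure (∀ i : Fin N, Fin (d ((i : ℕ) + 1)) → Fin (d (i : ℕ)) → ℝ)) hK'
  refine ⟨K', c, hK', hc, fun h hh R S S' hS hS' hSS' => ?_⟩
  obtain ⟨h', i1, i2, i3, i4⟩ := id hh
  obtain ⟨L, hL0, hL1, hL2⟩ := hL 1 h' (IsBddInv.one.mono hK) (hh.symm i1)
  have h1 := hcomp L hL1 hL2 R (S'.indicator 1)
  rw [lintegral_indicator_one hS', Measure.restrict_apply hS', Set.inter_comm] at h1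
  refine le_trans ?_ h1
  rw [Set.inter_comm, ← Measure.restrict_apply hS, ← lintegral_indicator_one hS]
  refine setLIntegral_mono' measurableSet_closedBall fun x hx => ?_
  by_cases hxS : x ∈ S
  · have h2 : L x ∈ S' := hSS' x ⟨hx, hxS⟩ _ (by
      rw [hL0, Matrix.one_mul, Matrix.mul_assoc, i2, Matrix.mul_one])
    rw [Set.indicator_of_mem hxS, Set.indicator_of_mem h2]
    exact le_rfl
  · rw [Set.indicator_of_notMem hxS]
    exact zero_le

lemma exists_lintegral_volume_nearSet_le (n : ℕ) (d : ℕ → ℕ) : ∃ c : ENNReal, c ≠ ⊤ ∧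
    ∀ (R : ℝ) (B : Matrix (Fin (d (n + 1))) (Fin (d 0)) ℝ) (q : ℕ) (ε : ℝ),
      ∫⁻ A : Fin (d 1) → Fin (d 0) → ℝ in closedBall 0 R,
        volume (closedBall 0 R ∩ nearSet n (fun i => d (i + 1)) (Matrix.of A) B q ε) ≤
      c * volume (closedBall 0 R ∩ nearSet (n + 1) d 1 B q ε) := by
  obtain ⟨c, hc, h⟩ := @exists_mul_lintegral_measure_section_le n
    (fun i : Fin (n + 1) => Fin (d ((i : ℕ) + 1)) → Fin (d (i : ℕ)) → ℝ) _ _ _ _ _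
    fun i => isAddHaarMeasure_volume_pi_pi _ _
  refine ⟨c, hc, fun R B q ε => ?_⟩
  refine le_trans (le_of_eq ?_) (h R _ (isClosed_nearSet (n + 1) d 1 B q ε).measurableSet)
  refine lintegral_congr fun A => ?_
  congr 2
  ext y
  simp only [nearSet, Set.mem_ofPred_eq, Matrix.mul_one]
  exact forall_congr' fun i => forall_congr' fun j => forall_congr' fun _ => by rw [netProd_cons]

/-- A lower bound for the volume of a tubular neighbourhood, from uniform lower bounds for the
sections over the first layers that are close to a graph. -/
lemma exists_le_volume_nearSet_succ (n : ℕ) (d : ℕ → ℕ) (T : Fin (d 1) × Fin (d 0) → Prop)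
    [DecidablePred T] (A₀ : Fin (d 1) → Fin (d 0) → ℝ) {η : ℝ} (hη : 0 < η) (R : ℝ) :
    ∃ c : ENNReal, c ≠ 0 ∧ ∀ (B : Matrix (Fin (d (n + 1))) (Fin (d 0)) ℝ) (q : ℕ) (ε δ : ℝ), 0 < ε →
      ∀ C : ENNReal,
      (∀ A : Fin (d 1) → Fin (d 0) → ℝ, (∀ i j, ¬T (i, j) → |A i j - A₀ i j| ≤ η) →
        ∃ φ : Fin (d 1) → Fin (d 0) → ℝ, ∀ Z : Fin (d 1) → Fin (d 0) → ℝ,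
          (∀ i j, ¬T (i, j) → Z i j = A i j) → (∀ i j, T (i, j) → |Z i j - φ i j| ≤ ε) →
          ‖Z‖ ≤ R ∧
          C ≤ volume (closedBall 0 R ∩ nearSet n (fun i => d (i + 1)) (Matrix.of Z) B q δ)) →
      c * (C * ENNReal.ofReal (ε ^ Fintype.card {ij // T ij})) ≤
        volume (closedBall 0 R ∩ nearSet (n + 1) d 1 B q δ) := by
  obtain ⟨c₁, hc₁, h1⟩ := exists_mul_le_lintegral_matrix T A₀ hη R
  obtain ⟨c₂, hc₂, h2⟩ := exists_lintegral_volume_nearSet_le n d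
  refine ⟨(c₂ + 1)⁻¹ * c₁, mul_ne_zero (ENNReal.inv_ne_zero.2
    (ENNReal.add_ne_top.2 ⟨hc₂, ENNReal.one_ne_top⟩)) hc₁, fun B q ε δ hε C hC => ?_⟩
  have h3 := h1 ε hε C (fun A => volume (closedBall 0 R ∩
    nearSet n (fun i => d (i + 1)) (Matrix.of A) B q δ)) ?_ hC
  · rw [mul_assoc, ENNReal.inv_mul_le_iff (by simp)
      (ENNReal.add_ne_top.2 ⟨hc₂, ENNReal.one_ne_top⟩)]
    exact h3.trans ((h2 R B q δ).trans (mul_le_mul_left (le_self_add (b := 1)) _))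
  · exact measurable_measure_prodMk_left ((measurableSet_closedBall.preimage measurable_snd).inter
      (isClosed_nearSet_prod n (fun i => d (i + 1)) B q δ).measurableSet)

/-- A lower bound for the volume of a tubular neighbourhood of a fibre of the end-to-end map. -/
theorem exists_le_volume_nearSet (n : ℕ) : ∀ (d p : ℕ → ℕ), p 0 ≤ d 0 →
    (∀ k < n + 1, p (k + 1) ≤ p k) → (∀ k ≤ n + 1, p k ≤ d k) →
    ∀ B : Matrix (Fin (d (n + 1))) (Fin (d 0)) ℝ,
      (∀ i (j : Fin (d 0)), p (n + 1) ≤ (j : ℕ) → B i j = 0) →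
    ∃ (R : ℝ) (c : ENNReal), c ≠ 0 ∧ ∀ ε : ℝ, 0 < ε → ε ≤ 1 →
      c * ENNReal.ofReal (ε ^ (pathCost (n + 1) d p + p (n + 1) * (p 0 - p (n + 1)) +
        p (n + 1) * d (n + 1))) ≤
      volume (closedBall 0 R ∩ nearSet (n + 1) d 1 B (p 0) ε) := by
  induction n with
  | zero =>
    intro d p hp0 hanti hle B hB
    obtain ⟨KB, hKB, hBb⟩ := exists_abs_apply_le B
    obtain ⟨c, hc, h⟩ := exists_le_volume_nearSet_succ 0 d
      (fun ij : Fin (d 1) × Fin (d 0) => (ij.2 : ℕ) < p 0) (fun _ _ => 0) one_pos (KB + 1)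
    refine ⟨KB + 1, c, hc, fun ε hε hε1 => ?_⟩
    have h1 := h B (p 0) ε ε hε 1 fun A hA => ⟨fun i j => B i j, fun Z hZA hZB => ⟨?_, ?_⟩⟩
    · rw [card_first_columns hp0, one_mul] at h1
      have h2 : pathCost (0 + 1) d p + p (0 + 1) * (p 0 - p (0 + 1)) + p (0 + 1) * d (0 + 1) =
          p 0 * d 1 := by
        have h3 := hanti 0 (by omega)
        have h4 := hle 1 le_rfl
        simp only [pathCost, Finset.sum_range_one, zero_add] at *
        zify [h3, h4]
        ring
      rw [h2]
      exact h1
    · refine pi_norm_le_of_abs_le (by positivity) fun i j => ?_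
      by_cases hj : (j : ℕ) < p 0
      · have h2 := hZB i j hj
        have h3 := hBb i j
        have h4 := abs_add_le (Z i j - B i j) (B i j)
        rw [sub_add_cancel] at h4
        linarith
      · have h2 := hA i j hj
        rw [sub_zero, ← hZA i j hj] at h2
        linarith
    · have h2 : nearSet 0 (fun i => d (i + 1)) (Matrix.of Z) B (p 0) ε = Set.univ := by
        refine Set.eq_univ_of_forall fun x i j hj => ?_
        have h3 : netProd 0 (fun i => d (i + 1)) x = 1 := rfl
        rw [h3, Matrix.one_mul]
        exact hZB i j hj
      have h3 : closedBall (0 : ∀ i : Fin 0, Fin (d ((i : ℕ) + 1 + 1)) → Fin (d ((i : ℕ) + 1)) → ℝ)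
          (KB + 1) = Set.univ := by
        refine Set.eq_univ_of_forall fun x => ?_
        rw [Subsingleton.elim x 0]
        exact mem_closedBall_self (by positivity)
      rw [h2, h3, Set.univ_inter, volume_pi, Measure.pi_univ]
      simp
  | succ n ih =>
    intro d p hp0 hanti hle B hB
    have hp1 : p 1 ≤ d 1 := hle 1 (by omega)
    have hp10 : p 1 ≤ p 0 := hanti 0 (by omega)
    have hanti' : ∀ k ≤ n + 1, p (n + 2) ≤ p (k + 1) := by
      intro k hk
      induction hk using Nat.decreasingInduction with
      | self => exact le_rfl
      | of_succ k hk ihk => exact ihk.trans (hanti (k + 1) (by omega))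
    have hpr : p (n + 2) ≤ p 1 := hanti' 0 (Nat.zero_le _)
    set r := p (n + 2) with hr
    have hpb : p 1 ≤ d 0 := hp10.trans hp0
    set B' : Matrix (Fin (d (n + 2))) (Fin (d 1)) ℝ := fun i l =>
      if hl : (l : ℕ) < p 1 then B i ⟨l, hl.trans_le hpb⟩ else 0 with hB'
    obtain ⟨R', c', hc', h'⟩ := ih (fun i => d (i + 1)) (fun i => p (i + 1)) hp1
      (fun k hk => hanti (k + 1) (by omega)) (fun k hk => hle (k + 1) (by omega)) B'
      fun i j hj => by
        simp only [hB']
        split_ifs with hl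
        · exact hB i _ hj
        · rfl
    obtain ⟨η, hη, hη1, hgraph⟩ := exists_graph_matrix (d 1)
    obtain ⟨K, c₂, hK, hc₂, hmeas⟩ :=
      exists_measure_mul_le (Nat.le_add_left 1 n) (fun i => d (i + 1)) one_le_two
    obtain ⟨M, hM, hbd⟩ := exists_abs_netProd_le (n + 1) (fun i => d (i + 1)) R'
    set D : ℝ := d 1 * (4 * d 1) + d 1 * (d 1 * (M * 2)) + 1 with hD
    have hD1 : 1 ≤ D := by
      rw [hD]
      have : (0 : ℝ) ≤ d 1 * (4 * d 1) + d 1 * (d 1 * (M * 2)) := by positivity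
      linarith
    have hD0 : 0 < D := by linarith
    set R := max (K * R') (d 1 * (2 * (4 * d 1)) + 2) with hR
    have hR2 : d 1 * (2 * (4 * d 1)) + 2 ≤ R := le_max_right _ _
    have hR0 : (0 : ℝ) ≤ d 1 * (2 * (4 * d 1)) := by positivity
    obtain ⟨c₁, hc₁, hsucc⟩ := exists_le_volume_nearSet_succ (n + 1) d
      (fun ij : Fin (d 1) × Fin (d 0) => (p 1 ≤ (ij.2 : ℕ) ∧ (ij.2 : ℕ) < p 0) ∧
        ¬(r ≤ (ij.1 : ℕ) ∧ (ij.1 : ℕ) < p 1)) (cornerOne (d 1) (d 0) (p 1)) hη R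
    set E' := pathCost (n + 1) (fun i => d (i + 1)) (fun i => p (i + 1)) + r * (p 1 - r) +
      r * d (n + 2) with hE'
    set E := pathCost (n + 2) d p + r * (p 0 - r) + r * d (n + 2) with hE
    have hEE : E = E' + ((p 0 - p 1) * (d 1 - p 1) + r * (p 0 - p 1)) := by
      rw [hE, hE', pathCost, Finset.sum_range_succ', pathCost]
      have h1 : p 0 - r = (p 0 - p 1) + (p 1 - r) := by omega
      rw [h1]
      ring
    refine ⟨R, c₁ * ((c₂ + 1)⁻¹ * c') * ENNReal.ofReal ((1 / D) ^ E), ?_, fun ε hε hε1 => ?_⟩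
    · refine mul_ne_zero (mul_ne_zero hc₁ (mul_ne_zero (ENNReal.inv_ne_zero.2
        (ENNReal.add_ne_top.2 ⟨hc₂, ENNReal.one_ne_top⟩)) hc')) ?_
      rw [ENNReal.ofReal_ne_zero_iff]
      positivity
    · have hδ : 0 < ε / D := by positivity
      have hδε : D * (ε / D) = ε := mul_div_cancel₀ _ hD0.ne'
      have hδ1 : ε / D ≤ 1 := (div_le_one hD0).2 (by linarith)
      have h1 := hsucc B (p 0) (ε / D) ε hδ ((c₂ + 1)⁻¹ * (c' * ENNReal.ofReal ((ε / D) ^ E')))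
        fun A hA => ?_
      · rw [card_determined_positions hp1 hpr hp0] at h1
        refine le_trans (le_of_eq ?_) h1
        have h2 : ENNReal.ofReal ((1 / D) ^ E) * ENNReal.ofReal (ε ^ E) =
            ENNReal.ofReal ((ε / D) ^ E') *
              ENNReal.ofReal ((ε / D) ^ ((p 0 - p 1) * (d 1 - p 1) + r * (p 0 - p 1))) := by
          rw [← ENNReal.ofReal_mul (by positivity), ← ENNReal.ofReal_mul (by positivity),
            ← mul_pow, ← pow_add, ← hEE, one_div_mul_eq_div]
        rw [mul_assoc, h2]
        ring
      · obtain ⟨h, w, hh, hhA, hw, hw0, hhw⟩ := hgraph (d 0) r (p 1) (p 0) hpb A hA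
        obtain ⟨k, i1, i2, i3, i4⟩ := id hh
        refine ⟨fun i j => (h * w) i j, fun Z hZA hZw => ?_⟩
        have hφ : ∀ i j, |(h * w) i j| ≤ d 1 * (2 * (4 * d 1)) := fun i j =>
          (Matrix.abs_mul_apply_le i3 hw zero_le_two i j).trans (by rw [Fintype.card_fin])
        refine ⟨pi_norm_le_of_abs_le (by linarith) fun i j => ?_, ?_⟩
        · by_cases hT : (p 1 ≤ (j : ℕ) ∧ (j : ℕ) < p 0) ∧ ¬(r ≤ (i : ℕ) ∧ (i : ℕ) < p 1)
          · have h2 := hZw i j hT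
            have h3 := hφ i j
            have h4 := abs_add_le (Z i j - (h * w) i j) ((h * w) i j)
            rw [sub_add_cancel] at h4
            linarith
          · have h2 := hA i j hT
            have h3 := abs_cornerOne_le (d 1) (d 0) (p 1) i j
            have h4 := abs_add_le (A i j - cornerOne (d 1) (d 0) (p 1) i j)
              (cornerOne (d 1) (d 0) (p 1) i j)
            rw [sub_add_cancel] at h4
            rw [hZA i j hT]
            linarith
        · rw [ENNReal.inv_mul_le_iff (by simp)
            (ENNReal.add_ne_top.2 ⟨hc₂, ENNReal.one_ne_top⟩)]
          refine (h' (ε / D) hδ hδ1).trans ?_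
          refine (hmeas h hh R' _ (nearSet (n + 1) (fun i => d (i + 1)) (Matrix.of Z) B (p 0) ε)
            (isClosed_nearSet _ _ _ _ _ _).measurableSet
            (isClosed_nearSet _ _ _ _ _ _).measurableSet fun x hx y hy => ?_).trans
            (mul_le_mul' le_self_add (measure_mono (Set.inter_subset_inter_left _
              (closedBall_subset_closedBall (le_max_left _ _)))))
          intro i j hj
          rw [← hδε, hD]
          have hy' : netProd (n + 1) (fun i => d (i + 1)) y =
              netProd (n + 1) (fun i => d (i + 1)) x * k := by
            rw [← hy, Matrix.mul_assoc, i1, Matrix.mul_one]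
          refine abs_mul_sub_le_of_near hpb hpr hδ.le (by positivity) hB (h := h) (w := w)
            (fun i l => ?_) (fun i l hl => ?_) hp1 (fun i l hl => ?_) hw hw0 (fun i j h2 h3 => ?_)
            i j hj
          · rw [hy']
            exact (Matrix.abs_mul_apply_le (hbd x hx.1) i4 hM i l).trans (by rw [Fintype.card_fin])
          · have h2 := hx.2 i l hl
            rw [Matrix.mul_one, Matrix.sub_apply] at h2
            rw [hy]
            simpa only [hB', dif_pos hl] using h2
          · rw [hhA i l hl]
            exact (hZA i _ fun h2 => absurd h2.1.1 (not_le.2 hl)).symm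
          · by_cases hi : r ≤ (i : ℕ) ∧ (i : ℕ) < p 1
            · have h4 : Z i j = A i j := hZA i j fun h5 => h5.2 hi
              rw [Matrix.of_apply, h4, hhw i j hi.1 hi.2 h2 h3, sub_self, abs_zero]
              exact hδ.le
            · exact hZw i j ⟨⟨h2, h3⟩, hi⟩

end NetworkVolume

section LossVolume

open MeasureTheory Metric Matrix Topology

/-- An invertible matrix of column operations moves the kernel of `B` to the last columns. -/
lemma exists_mul_eq_zero_of_rank_le {q m : ℕ} (B : Matrix (Fin q) (Fin m) ℝ) (hm : B.rank ≤ m) :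
    ∃ g g' : Matrix (Fin m) (Fin m) ℝ, g * g' = 1 ∧ g' * g = 1 ∧
      ∀ i (j : Fin m), B.rank ≤ (j : ℕ) → (B * g) i j = 0 := by
  obtain ⟨k, hk⟩ : ∃ k, m = B.rank + k := ⟨m - B.rank, by omega⟩
  obtain ⟨ℓ, c, c', e, e', -, hc', -, -, -, -, hsum⟩ := exists_kernel_splitting B hk
  let σ : Fin m ≃ Fin B.rank ⊕ Fin k := (finCongr hk).trans finSumFinEquiv.symm
  have h1 : (fromCols c c').submatrix id σ * (fromRows e e').submatrix σ id = 1 := by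
    rw [submatrix_mul_equiv, fromCols_mul_fromRows, hsum, submatrix_id_id]
  refine ⟨_, _, h1, mul_eq_one_comm.1 h1, fun i j hj => ?_⟩
  have h2 : B * (fromCols c c').submatrix id σ = (B * fromCols c c').submatrix id σ := by
    ext
    rfl
  have h3 : σ j = Sum.inr ⟨j - B.rank, by omega⟩ := by
    rw [← Equiv.eq_symm_apply]
    ext
    simp [σ, hj]
  rw [h2, mul_fromCols, hc', submatrix_apply, h3]
  rfl

lemma sqDist_le_of_abs_le {a b : ℕ} {B Q : Matrix (Fin a) (Fin b) ℝ} {δ : ℝ}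
    (h : ∀ i j, |(Q - B) i j| ≤ δ) : sqDist B Q ≤ a * (b * δ ^ 2) := by
  have h1 : ∀ i j, (Q i j - B i j) ^ 2 ≤ δ ^ 2 := fun i j => by
    have := h i j
    rw [Matrix.sub_apply] at this
    exact sq_le_sq' (abs_le.1 this).1 (abs_le.1 this).2
  calc sqDist B Q ≤ ∑ _i : Fin a, ∑ _j : Fin b, δ ^ 2 :=
        Finset.sum_le_sum fun i _ => Finset.sum_le_sum fun j _ => h1 i j
    _ = a * (b * δ ^ 2) := by simp

/-- Sublevel sets of the loss are large. -/
theorem exists_le_volume_DLNloss_le {N : ℕ} (hN : 1 ≤ N) (d : ℕ → ℕ)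
    (B : Matrix (Fin (d N)) (Fin (d 0)) ℝ) (hr : ∀ i ≤ N, B.rank ≤ d i) :
    ∃ (R C : ℝ) (c : ENNReal), 0 < C ∧ c ≠ 0 ∧ ∀ ε : ℝ, 0 < ε → ε ≤ 1 →
      c * ENNReal.ofReal (ε ^ (KPmin N d B.rank + B.rank * (d 0 - B.rank) + B.rank * d N)) ≤
        volume (closedBall 0 R ∩ {x | DLNloss N d B x ≤ C * ε ^ 2}) := by
  obtain ⟨p, hp, hpN, hcost⟩ := exists_path_pathCost_eq_KPmin hN hr
  obtain ⟨g, g', hgg, hgg', hBg⟩ := exists_mul_eq_zero_of_rank_le B (hr 0 (Nat.zero_le _))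
  obtain ⟨K₁, hK₁, hb₁⟩ := exists_abs_apply_le g
  obtain ⟨K₂, hK₂, hb₂⟩ := exists_abs_apply_le g'
  have hinv : IsBddInv (K₁ + K₂ + 1) g := ⟨g', hgg, hgg',
    fun i j => (hb₁ i j).trans (by linarith), fun i j => (hb₂ i j).trans (by linarith)⟩
  obtain ⟨K', c₁, -, hc₁, hmeas⟩ := exists_measure_mul_le hN d (K := K₁ + K₂ + 1) (by linarith)
  obtain ⟨R, c, hc, hvol⟩ : ∃ (R : ℝ) (c : ENNReal), c ≠ 0 ∧ ∀ ε : ℝ, 0 < ε → ε ≤ 1 →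
      c * ENNReal.ofReal (ε ^ (KPmin N d B.rank + B.rank * (d 0 - B.rank) + B.rank * d N)) ≤
        volume (closedBall 0 R ∩ nearSet N d 1 (B * g) (d 0) ε) := by
    obtain ⟨n, rfl⟩ : ∃ n, N = n + 1 := ⟨N - 1, by omega⟩
    have h := exists_le_volume_nearSet n d p hp.zero.le hp.anti hp.le (B * g)
      (by rw [hpN]; exact hBg)
    rwa [hpN, hp.zero, hcost] at h
  refine ⟨K' * R, d N * (d 0 * (d 0 * K₂) ^ 2) + 1, (c₁ + 1)⁻¹ * c, by positivity,
    mul_ne_zero (by simp [hc₁]) hc, fun ε hε hε1 => ?_⟩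
  rw [mul_assoc, ENNReal.inv_mul_le_iff (by simp) (ENNReal.add_ne_top.2 ⟨hc₁, ENNReal.one_ne_top⟩)]
  have hcont : Continuous fun x => DLNloss N d B x := by
    simp only [DLNloss_eq]
    exact (continuous_sqDist B).comp (continuous_netProd N d)
  refine (hvol ε hε hε1).trans ((hmeas g hinv R _ _ (isClosed_nearSet _ _ _ _ _ _).measurableSet
    (isClosed_le hcont continuous_const).measurableSet fun x hx y hy => ?_).trans
    (mul_le_mul' le_self_add le_rfl))
  have h1 : netProd N d y - B = (netProd N d x - B * g) * g' := by
    rw [← hy, ← Matrix.sub_mul, Matrix.mul_assoc, hgg, Matrix.mul_one]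
  have h2 : ∀ i j, |(netProd N d x - B * g) i j| ≤ ε := fun i j => by
    simpa only [Matrix.mul_one] using hx.2 i j j.2
  have h3 : ∀ i j, |(netProd N d y - B) i j| ≤ d 0 * (ε * K₂) := fun i j => by
    rw [h1]
    exact (Matrix.abs_mul_apply_le h2 hb₂ hε.le i j).trans (by rw [Fintype.card_fin])
  rw [Set.mem_ofPred_eq, DLNloss_eq]
  refine (sqDist_le_of_abs_le h3).trans (le_of_sub_nonneg ?_)
  ring_nf
  positivity

end LossVolume

section LossThreshold

open MeasureTheory Metric Matrix Topology

lemma volume_DLNloss_eq_zero {N : ℕ} (hN : 1 ≤ N) (d : ℕ → ℕ)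
    (B : Matrix (Fin (d N)) (Fin (d 0)) ℝ) (hr : ∀ i ≤ N, B.rank ≤ d i)
    (hm : 0 < KPmin N d B.rank + B.rank * (d 0 - B.rank) + B.rank * d N) (R : ℝ) :
    volume.restrict (closedBall 0 R) {x | DLNloss N d B x = 0} = 0 := by
  have hm' : (0 : ℝ) < (KPmin N d B.rank + B.rank * (d 0 - B.rank) + B.rank * d N : ℕ) := by
    exact_mod_cast hm
  set s : ℝ := (KPmin N d B.rank + B.rank * (d 0 - B.rank) + B.rank * d N : ℕ) / 4 with hs
  have hs0 : 0 < s := by positivity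
  obtain ⟨ρ, hρ, h⟩ := exists_lintegral_truncPow_netProd_ne_top hN d B hr (s := s) (t := 1 / 2)
    (by norm_num) (by norm_num) (by rw [hs]; push_cast; ring)
  refine measure_mono_null (fun x hx => ?_) (measure_eq_top_of_lintegral_ne_top
    (measurable_truncPow_comp B s ρ (continuous_netProd N d)).aemeasurable (h R))
  rw [Set.mem_ofPred_eq, DLNloss_eq] at hx
  rw [Set.mem_ofPred_eq, truncPow, hx, if_pos hρ.le, ENNReal.ofReal_zero,
    ENNReal.zero_rpow_of_neg (by linarith)]

lemma not_locallyIntegrable_DLNloss_rpow {N : ℕ} (hN : 1 ≤ N) (d : ℕ → ℕ)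
    (B : Matrix (Fin (d N)) (Fin (d 0)) ℝ) (hr : ∀ i ≤ N, B.rank ≤ d i) {m : ℕ}
    (hm : m = KPmin N d B.rank + B.rank * (d 0 - B.rank) + B.rank * d N) (hm0 : 0 < m) {s : ℝ}
    (hs : m < 2 * s) : ¬LocallyIntegrable (fun x => DLNloss N d B x ^ (-s)) volume := by
  intro hbound
  obtain ⟨R, C, c, hC, hc, hvol⟩ := exists_le_volume_DLNloss_le hN d B hr
  have hcont : Continuous fun x => DLNloss N d B x := by
    simp only [DLNloss_eq]
    exact (continuous_sqDist B).comp (continuous_netProd N d)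
  have hHaar := isAddHaarMeasure_volume_net N d
  have hI := (hbound.integrableOn_isCompact (isCompact_closedBall 0 R)).2
  rw [HasFiniteIntegral] at hI
  set I := ∫⁻ x in closedBall 0 R, ‖DLNloss N d B x ^ (-s)‖ₑ with hIdef
  have hs0 : 0 < s := by
    have : (0 : ℝ) ≤ m := by positivity
    linarith
  have hnull := volume_DLNloss_eq_zero hN d B hr (hm ▸ hm0) R
  have key : ∀ ε : ℝ, 0 < ε → ε ≤ 1 →
      c * ENNReal.ofReal (ε ^ m * (C * ε ^ 2) ^ (-s)) ≤ I := by
    intro ε hε hε1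
    set S := {x | DLNloss N d B x ≤ C * ε ^ 2} with hS
    have hSm : MeasurableSet S := (isClosed_le hcont continuous_const).measurableSet
    have h1 := hvol ε hε hε1
    rw [← hm, Set.inter_comm, ← Measure.restrict_apply hSm] at h1
    rw [ENNReal.ofReal_mul (by positivity), ← mul_assoc, mul_comm]
    refine (mul_le_mul_right h1 _).trans ?_
    rw [← setLIntegral_const]
    refine le_trans (lintegral_mono_ae ?_) (setLIntegral_le_lintegral S _)
    have h2 : ∀ᵐ x ∂(volume.restrict (closedBall 0 R)).restrict S, DLNloss N d B x ≠ 0 :=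
      ae_restrict_of_ae (measure_eq_zero_iff_ae_notMem.1 hnull)
    filter_upwards [h2, ae_restrict_mem hSm] with x hx0 hxS
    have h3 : 0 ≤ DLNloss N d B x := sqDist_nonneg _ _
    rw [Real.enorm_of_nonneg (Real.rpow_nonneg h3 _)]
    exact ENNReal.ofReal_le_ofReal (Real.rpow_le_rpow_of_nonpos (h3.lt_of_ne' hx0) hxS
      (by linarith))
  have hlim : Filter.Tendsto (fun x : ℝ => c * ENNReal.ofReal (C ^ (-s) * x ^ (2 * s - m)))
      Filter.atTop (𝓝 (c * ⊤)) :=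
    ENNReal.Tendsto.const_mul (ENNReal.tendsto_ofReal_atTop.comp
      ((tendsto_rpow_atTop (by linarith)).const_mul_atTop (by positivity)))
      (Or.inl ENNReal.top_ne_zero)
  rw [ENNReal.mul_top hc] at hlim
  refine hI.not_ge (le_of_tendsto hlim ?_)
  filter_upwards [Filter.eventually_ge_atTop 1] with x hx
  have hx0 : 0 < x := by linarith
  refine le_trans (le_of_eq ?_) (key x⁻¹ (by positivity) (inv_le_one_of_one_le₀ hx))
  congr 2
  rw [Real.mul_rpow hC.le (by positivity), ← Real.rpow_natCast, ← Real.rpow_natCast,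
    ← Real.rpow_mul (by positivity), Real.inv_rpow hx0.le, Real.inv_rpow hx0.le,
    ← Real.rpow_neg hx0.le, ← Real.rpow_neg hx0.le, mul_left_comm, ← Real.rpow_add hx0]
  congr 2
  push_cast
  ring

lemma KPmin_zero_eq_zero {N : ℕ} (hN : 1 ≤ N) {d : ℕ → ℕ} {i : ℕ} (hi : i ≤ N) (hdi : d i = 0) :
    KPmin N d 0 = 0 := by
  have h0 : ∀ k, ∃ l ≤ k, ∀ l' ≤ k, d l ≤ d l' := fun k => by
    obtain ⟨l, hl, h⟩ := Finset.exists_min_image (Finset.range (k + 1)) d ⟨0, by simp⟩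
    exact ⟨l, by simpa [Nat.lt_succ_iff] using hl,
      fun l' hl' => h l' (by simpa [Nat.lt_succ_iff] using hl')⟩
  choose l hl hmin using h0
  have hp : IsRankPath N d fun k => d (l k) := by
    refine ⟨?_, fun k _ => hmin _ _ ((hl k).trans (Nat.le_succ k)), fun k _ => hmin k k le_rfl⟩
    rw [Nat.le_zero.1 (hl 0)]
  refine Nat.le_zero.1 ((hp.KPmin_le_of_le hN (fun _ _ => Nat.zero_le _)
    ((hmin N i hi).trans hdi.le)).trans (le_of_eq ?_))
  refine Finset.sum_eq_zero fun k _ => ?_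
  dsimp only
  rcases (hl (k + 1)).eq_or_lt with h | h
  · rw [h, Nat.sub_self, mul_zero]
  · rw [Nat.sub_eq_zero_of_le (hmin k _ (Nat.lt_succ_iff.1 h)), zero_mul]

lemma KPmin_zero_pos {N : ℕ} (hN : 1 ≤ N) {d : ℕ → ℕ} (hd : ∀ i ≤ N, d i ≠ 0) :
    0 < KPmin N d 0 := by
  obtain ⟨p, hp, hpN, hcost⟩ := exists_path_pathCost_eq_KPmin hN fun i _ => Nat.zero_le (d i)
  rw [← hcost, Nat.pos_iff_ne_zero]
  intro h
  have h1 : ∀ k ≤ N, p k ≠ 0 := by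
    intro k
    induction k with
    | zero => exact fun hk => by rw [hp.zero]; exact hd 0 hk
    | succ k ih =>
      intro hk h0
      have h2 := Finset.sum_eq_zero_iff.1 h k (Finset.mem_range.2 hk)
      rw [h0, Nat.sub_zero, Nat.sub_zero, mul_eq_zero] at h2
      exact h2.elim (ih (by omega)) (hd _ hk)
  exact h1 N le_rfl hpN

lemma netProd_eq_zero {N : ℕ} {d : ℕ → ℕ} {i : ℕ} (hi : i ≤ N) (hdi : d i = 0)
    (x : ∀ i : Fin N, Fin (d ((i : ℕ) + 1)) → Fin (d (i : ℕ)) → ℝ) : netProd N d x = 0 := by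
  have h : ∀ (A : ∀ i : ℕ, Matrix (Fin (d (i + 1))) (Fin (d i)) ℝ) (n : ℕ), i ≤ n →
      matProd ℝ d A n = 0 := fun A n hn => by
    induction n, hn using Nat.le_induction with
    | base =>
      ext a
      exact absurd a.2 (by omega)
    | succ n _ ih => rw [matProd, ih, Matrix.mul_zero]
  exact h _ N hi

end LossThreshold

/-- The real log-canonical threshold of the deep linear network loss `K^DLN_B`
equals half the codimension of `mult⁻¹(B)`:
`rlct(K) = (min_{μ ∈ M^r_d} c(μ) + r(d_0 + d_N − r))/2` where `r = rank B`. -/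
theorem stmt13 (N : ℕ) (hN : 1 ≤ N) (d : ℕ → ℕ)
    (B : Matrix (Fin (d N)) (Fin (d 0)) ℝ) (hB : ∀ i ≤ N, B.rank ≤ d i) :
    sSup {s : ℝ | MeasureTheory.LocallyIntegrable
        (fun x : (∀ i : Fin N, Fin (d ((i : ℕ) + 1)) → Fin (d (i : ℕ)) → ℝ) =>
          DLNloss N d B x ^ (-s)) MeasureTheory.volume} =
      (1 / 2) * ((KPmin N d B.rank : ℝ) +
        (B.rank : ℝ) * ((d 0 : ℝ) + (d N : ℝ) - (B.rank : ℝ))) := by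
  have hr0 := hB 0 (Nat.zero_le N)
  obtain ⟨m, hm⟩ : ∃ m, m = KPmin N d B.rank + B.rank * (d 0 - B.rank) + B.rank * d N := ⟨_, rfl⟩
  have hmR : (1 / 2) * ((KPmin N d B.rank : ℝ) + B.rank * (d 0 + d N - B.rank)) = m / 2 := by
    rw [hm]
    push_cast [Nat.cast_sub hr0]
    ring
  rw [hmR]
  by_cases hd : ∀ i ≤ N, d i ≠ 0
  · have hm0 : 0 < m := by
      rcases Nat.eq_zero_or_pos B.rank with h | h
      · have := KPmin_zero_pos hN hd
        rw [hm, h]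
        omega
      · have := Nat.mul_pos h (Nat.pos_of_ne_zero (hd N le_rfl))
        omega
    have hlow : ∀ s : ℝ, s < m / 2 →
        MeasureTheory.LocallyIntegrable (fun x => DLNloss N d B x ^ (-s)) MeasureTheory.volume :=
      fun s hs => locallyIntegrable_DLNloss_rpow hN d B hB (by
        rw [hm] at hs
        push_cast at hs ⊢
        linarith)
    refine csSup_eq_of_forall_le_of_forall_lt_exists_gt
      ⟨(m : ℝ) / 2 - 1, hlow _ (by linarith)⟩ (fun s hs => ?_) fun w hw => ?_
    · by_contra! h
      exact not_locallyIntegrable_DLNloss_rpow hN d B hB hm hm0 (by linarith) hs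
    · exact ⟨(w + m / 2) / 2, hlow _ (by linarith), by linarith⟩
  · push Not at hd
    obtain ⟨i, hi, hdi⟩ := hd
    have hr : B.rank = 0 := Nat.le_zero.1 ((hB i hi).trans hdi.le)
    have hm0 : m = 0 := by simp [hm, hr, KPmin_zero_eq_zero hN hi hdi]
    have huniv : {s : ℝ | MeasureTheory.LocallyIntegrable (fun x => DLNloss N d B x ^ (-s))
        MeasureTheory.volume} = Set.univ := Set.eq_univ_of_forall fun s => by
      have hHaar := isAddHaarMeasure_volume_net N d
      simp only [Set.mem_ofPred_eq, DLNloss_eq, netProd_eq_zero hi hdi]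
      exact continuous_const.locallyIntegrable
    rw [huniv, Real.sSup_univ, hm0, Nat.cast_zero, zero_div]
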